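/- Let d ≥ 4 and R = ℤ[x]. For every m ∈ ℕ there exists an ideal U of finite index in R such that the finite abelian group SK_1(R, U; d) = G(U)/EL(d;U) cannot be generated by m elements. Consequently the congruence kernel of SL_d(ℤ[x]) is not finitely generated. -/

import Mathlib

/-- The elementary matrix `E_{ij}(r)`: the identity matrix with the entry `r`
added in position `(i,j)`, as an element of `SL_d(A)`. -/
def elem {A : Type*} [CommRing A] {d : ℕ} (i j : Fin d) (h : i ≠ j) (r : A) :
    Matrix.SpecialLinearGroup (Fin d) A :=
  ⟨Matrix.transvection i j r, Matrix.det_transvection_of_ne i j h r⟩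

/-- `EL(d;U)`: the normal subgroup of `SL_d(R)` generated by the elementary matrices
`E_{ij}(u)` with `u ∈ U`. -/
abbrev EL {R : Type*} [CommRing R] (d : ℕ) (U : Ideal R) :
    Subgroup (Matrix.SpecialLinearGroup (Fin d) R) :=
  Subgroup.normalClosure
    {g | ∃ (i j : Fin d) (h : i ≠ j) (u : R), u ∈ U ∧ g = elem i j h u}

/-- The principal congruence subgroup `G(U)`: the kernel of the reduction map
`SL_d(R) → SL_d(R/U)`. -/
def congSubgroup {R : Type*} [CommRing R] (d : ℕ) (U : Ideal R) :
    Subgroup (Matrix.SpecialLinearGroup (Fin d) R) :=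
  (Matrix.SpecialLinearGroup.map (Ideal.Quotient.mk U)).ker

open scoped NumberTheorySymbols

namespace SKN

abbrev A := GaussianInt

/-- primary elements: congruent to 1 mod 2 -/
def prim (a : A) : Prop := Odd a.re ∧ Even a.im

def iA : A := ⟨0, 1⟩

lemma prim_iff_exists {a : A} : prim a ↔ ∃ c : A, a = 1 + 2 * c := by
  constructor
  · rintro ⟨⟨x, hx⟩, ⟨y, hy⟩⟩
    refine ⟨⟨x, y⟩, ?_⟩
    ext <;> simp <;> omega
  · rintro ⟨c, rfl⟩
    refine ⟨⟨c.re, ?_⟩, ⟨c.im, ?_⟩⟩ <;> simp <;> ring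

lemma prim_one : prim 1 := prim_iff_exists.2 ⟨0, by simp⟩

lemma prim.mul {a b : A} (ha : prim a) (hb : prim b) : prim (a * b) := by
  obtain ⟨c, rfl⟩ := prim_iff_exists.1 ha
  obtain ⟨d, rfl⟩ := prim_iff_exists.1 hb
  exact prim_iff_exists.2 ⟨c + d + 2 * c * d, by ring⟩

lemma prim.of_mul {a b : A} (ha : prim a) (hb : prim (a * b)) : prim b := by
  obtain ⟨c, rfl⟩ := prim_iff_exists.1 ha
  obtain ⟨d, hd⟩ := prim_iff_exists.1 hb
  exact prim_iff_exists.2 ⟨d - c * b, by linear_combination hd⟩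

lemma prim.neg {a : A} (ha : prim a) : prim (-a) := by
  obtain ⟨c, rfl⟩ := prim_iff_exists.1 ha
  exact prim_iff_exists.2 ⟨-1 - c, by ring⟩

lemma prim.add_two {a : A} (ha : prim a) (t : A) : prim (a + 2 * t) := by
  obtain ⟨c, rfl⟩ := prim_iff_exists.1 ha
  exact prim_iff_exists.2 ⟨c + t, by ring⟩

lemma prim.ne_zero {a : A} (ha : prim a) : a ≠ 0 := by
  rintro rfl; have := ha.1; simp at this

lemma prim.pow {a : A} (ha : prim a) (n : ℕ) : prim (a ^ n) := by
  induction n with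
  | zero => simpa using prim_one
  | succ n ih => rw [pow_succ]; exact ih.mul ha

lemma norm_eq (a : A) : a.norm = a.re * a.re + a.im * a.im := by
  simp [Zsqrtd.norm]

lemma isUnit_cases {u : A} (h : IsUnit u) : u = 1 ∨ u = -1 ∨ u = iA ∨ u = -iA := by
  have h1 := (Zsqrtd.norm_eq_one_iff' (by norm_num) u).2 h
  rw [norm_eq] at h1
  have hr : -1 ≤ u.re ∧ u.re ≤ 1 := by constructor <;> nlinarith [mul_self_nonneg u.im]
  have hi : -1 ≤ u.im ∧ u.im ≤ 1 := by constructor <;> nlinarith [mul_self_nonneg u.re]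
  obtain ⟨a, b⟩ := u
  simp only at hr hi h1
  obtain ⟨h2, h3⟩ := hr
  obtain ⟨h4, h5⟩ := hi
  interval_cases a <;> interval_cases b <;> simp [Zsqrtd.ext_iff, iA] at h1 ⊢

lemma prim_unit {u : A} (h : IsUnit u) (hp : prim u) : u = 1 ∨ u = -1 := by
  rcases isUnit_cases h with h | h | h | h
  · exact Or.inl h
  · exact Or.inr h
  · subst h; have := hp.1; simp [iA] at this
  · subst h; have := hp.1; simp [iA] at this

lemma iA_mul : iA * iA = -1 := by ext <;> simp [iA]

/-- trichotomy -/
lemma exists_prim_or (a : A) : prim a ∨ prim (iA * a) ∨ ∃ b, a = (1 + iA) * b := by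
  obtain ⟨x, y⟩ := a
  rcases Int.even_or_odd x with hx | hx <;> rcases Int.even_or_odd y with hy | hy
  · right; right
    have : Even (x + y) := hx.add hy
    obtain ⟨s, hs⟩ := this
    refine ⟨⟨s, s - x⟩, ?_⟩
    ext <;> simp [iA] <;> omega
  · right; left
    refine ⟨?_, ?_⟩ <;> simp [iA, hx, hy]
  · left; exact ⟨hx, hy⟩
  · right; right
    have : Even (x + y) := hx.add_odd hy
    obtain ⟨s, hs⟩ := this
    refine ⟨⟨s, s - x⟩, ?_⟩
    ext <;> simp [iA] <;> omega

lemma prim_prime_cases {π : A} (hπ : Prime π) (hp : prim π) :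
    (π.im = 0 ∧ Nat.Prime π.re.natAbs ∧ Prime (π.re.natAbs : A)) ∨
    (π.im ≠ 0 ∧ Nat.Prime π.norm.natAbs) := by
  have hn0 : π.norm.natAbs ≠ 0 := by
    rw [Ne, Int.natAbs_eq_zero, GaussianInt.norm_eq_zero]; exact hπ.ne_zero
  have hdn : π ∣ ((π.norm.natAbs : ℕ) : A) := by
    have : ((π.norm.natAbs : ℕ) : A) = ((π.norm : ℤ) : A) := by
      rw [← GaussianInt.abs_natCast_norm π]; simp
    rw [this, Zsqrtd.norm_eq_mul_conj]; exact Dvd.intro _ rfl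
  have hl : (π.norm.natAbs : A) = ((π.norm.natAbs.primeFactorsList.map (Nat.cast : ℕ → A))).prod := by
    conv_lhs => rw [← Nat.prod_primeFactorsList hn0]
    exact map_list_prod (Nat.castRingHom A) _
  rw [hl, hπ.dvd_prod_iff] at hdn
  obtain ⟨a, ha, hpa⟩ := hdn
  obtain ⟨p, hp1, rfl⟩ := List.mem_map.1 ha
  have hpp := Nat.prime_of_mem_primeFactorsList hp1
  obtain ⟨t, ht⟩ := hpa
  have hnorm : (p : ℤ) * p = π.norm * t.norm := by
    rw [← Zsqrtd.norm_mul, ← ht]; simp [norm_eq]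
  have hnorm' : p ^ 2 = π.norm.natAbs * t.norm.natAbs := by
    rw [← Int.natAbs_mul, ← hnorm, Int.natAbs_mul, Int.natAbs_natCast]; ring
  have hd2 : π.norm.natAbs ∣ p ^ 2 := ⟨_, hnorm'⟩
  obtain ⟨k, hk, hk2⟩ := (Nat.dvd_prime_pow hpp).1 hd2
  have hnu : π.norm.natAbs ≠ 1 := by
    intro h
    exact hπ.not_isUnit (Zsqrtd.norm_eq_one_iff.1 h)
  interval_cases k
  · simp at hk2; exact absurd hk2 (by simpa using hnu)
  · simp only [pow_one] at hk2
    right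
    refine ⟨?_, by rw [hk2]; exact hpp⟩
    intro h0
    have : π.norm.natAbs = π.re.natAbs * π.re.natAbs := by
      rw [norm_eq, h0]; simp [Int.natAbs_mul]
    rw [← hk2, this] at hpp
    exact absurd hpp (Nat.not_prime_mul (by
      intro h; rw [h] at this; simp at this; exact hnu (by simpa using this))
       (by intro h; rw [h] at this; simp at this; exact hnu (by simpa using this)))
  · left
    have ht1 : t.norm.natAbs = 1 := by
      rw [hk2] at hnorm'
      have : 0 < p ^ 2 := pow_pos hpp.pos 2
      nlinarith
    have htu := Zsqrtd.norm_eq_one_iff.1 ht1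
    have hre := hp.1
    have key : π.im = 0 ∧ π.re.natAbs = p := by
      have e1 := congrArg Zsqrtd.re ht
      have e2 := congrArg Zsqrtd.im ht
      rcases isUnit_cases htu with h | h | h | h <;> subst h <;> simp [iA] at e1 e2
      · exact ⟨e2.symm, by omega⟩
      · exact ⟨by omega, by omega⟩
      · rw [← e2] at hre; simp at hre
      · rw [e2] at hre; simp at hre
    refine ⟨key.1, by rw [key.2]; exact hpp, ?_⟩
    rw [key.2, ht]
    exact (Associated.prime_iff ⟨htu.unit, rfl⟩).1 hπ

lemma norm_mod4 {a : A} (ha : prim a) : a.norm.natAbs % 4 = 1 := by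
  obtain ⟨⟨x, hx⟩, ⟨y, hy⟩⟩ := ha
  have : a.norm = 4 * (x * x + x + y * y) + 1 := by rw [norm_eq, hx, hy]; ring
  have h2 := GaussianInt.abs_natCast_norm a
  omega

lemma prim_of_prime_odd {π p : A} (hp : prim p) (h : π ∣ p) : ∃ u : A, IsUnit u ∧ prim (u * π) := by
  rcases exists_prim_or π with h1 | h1 | ⟨b, rfl⟩
  · exact ⟨1, isUnit_one, by simpa using h1⟩
  · exact ⟨iA, ⟨⟨iA, -iA, by simp [iA_mul], by simp [iA_mul]⟩, rfl⟩, h1⟩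
  · exfalso
    obtain ⟨c, hc⟩ := h
    have h1 := hp.1
    have h2 := hp.2
    have h3 : Odd (p.re + p.im) := h1.add_even h2
    have : p.re + p.im = 2 * (b * c).re := by
      rw [hc, mul_assoc]; simp [iA]; ring
    rw [this] at h3
    exact Int.not_odd_iff_even.2 ⟨_, two_mul _⟩ h3

/-- induction principle -/
lemma prim_induction {P : A → Prop} (h1 : P 1) (hm : P (-1))
    (hs : ∀ π p : A, Prime π → prim π → prim p → P p → P (π * p)) :
    ∀ p, prim p → P p := by
  have : ∀ n : ℕ, ∀ p, prim p → p.norm.natAbs = n → P p := by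
    intro n
    induction n using Nat.strong_induction_on with
    | _ n ih =>
      intro p hp hn
      by_cases hu : IsUnit p
      · rcases prim_unit hu hp with rfl | rfl <;> assumption
      · obtain ⟨π, hπ, hd⟩ := WfDvdMonoid.exists_irreducible_factor hu hp.ne_zero
        obtain ⟨u, hu1, hu2⟩ := prim_of_prime_odd hp hd
        have hπ' : Prime (u * π) :=
          (Associated.prime_iff (show Associated π (u * π) from ⟨hu1.unit, by simp [mul_comm]⟩)).1
            hπ.prime
        have hd' : u * π ∣ p := (hu1.mul_left_dvd).2 hd
        obtain ⟨q, hq⟩ := hd'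
        have hqp : prim q := hu2.of_mul (hq ▸ hp)
        rw [hq]
        refine hs _ _ hπ' hu2 hqp (ih q.norm.natAbs ?_ q hqp rfl)
        rw [← hn, hq, Zsqrtd.norm_mul, Int.natAbs_mul]
        have a1 : (u * π).norm.natAbs ≠ 1 := fun h => hπ'.not_isUnit (Zsqrtd.norm_eq_one_iff.1 h)
        have a2 : (u * π).norm.natAbs ≠ 0 := by
          rw [Ne, Int.natAbs_eq_zero, GaussianInt.norm_eq_zero]; exact hπ'.ne_zero
        have a3 : q.norm.natAbs ≠ 0 := by
          rw [Ne, Int.natAbs_eq_zero, GaussianInt.norm_eq_zero]; exact hqp.ne_zero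
        have : 2 ≤ (u * π).norm.natAbs := by omega
        have : 0 < q.norm.natAbs := by omega
        nlinarith
  exact fun p hp => this _ p hp rfl

end SKN
open scoped NumberTheorySymbols

namespace SKN

open Classical in
/-- Legendre symbol at a primary prime. -/
noncomputable def leg (a π : A) : ℤ :=
  if π.im = 0 then J(a.norm | π.re.natAbs)
  else J(a.re * π.re + a.im * π.im | π.norm.natAbs)

lemma leg_neg_right (a π : A) (hp : prim π) : leg a (-π) = leg a π := by
  unfold leg
  have h1 : (-π).norm = π.norm := by simp
  have h2 : (-π).re.natAbs = π.re.natAbs := by simp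
  have h3 : (-π).im = 0 ↔ π.im = 0 := by simp
  simp only [h3]
  split_ifs with h
  · rw [h2]
  · rw [h1]
    have : a.re * (-π).re + a.im * (-π).im = -(a.re * π.re + a.im * π.im) := by simp; ring
    have h4 := norm_mod4 hp
    rw [this, jacobiSym.neg _ (Nat.odd_iff.2 (by omega)), ZMod.χ₄_nat_one_mod_four h4, one_mul]

lemma J_abs (x : ℤ) {n : ℕ} (h : n % 4 = 1) : J((x.natAbs : ℤ) | n) = J(x | n) := by
  rcases Int.natAbs_eq x with h1 | h1
  · rw [← h1]
  · conv_rhs => rw [h1]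
    rw [jacobiSym.neg _ (Nat.odd_iff.2 (by omega)), ZMod.χ₄_nat_one_mod_four h, one_mul]

lemma J_congr {x y : ℤ} {n : ℕ} (h : (n : ℤ) ∣ x - y) : J(x | n) = J(y | n) := by
  apply jacobiSym.mod_left'
  exact Int.emod_eq_emod_iff_emod_sub_eq_zero.2 (Int.emod_eq_zero_of_dvd h)

lemma J_sym (x : ℤ) {n : ℕ} (h : n % 4 = 1) (hx : Odd x) : J(x | n) = J((n : ℤ) | x.natAbs) := by
  rw [← J_abs x h]
  exact jacobiSym.quadratic_reciprocity_one_mod_four' (by simpa using hx) h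

lemma norm_cast_natAbs (a : A) : (a.norm.natAbs : ℤ) = a.re * a.re + a.im * a.im := by
  rw [GaussianInt.abs_natCast_norm, norm_eq]

/-- for `c` coprime: J(re|norm)=1 -/
lemma J_re {π : A} (hp : prim π) (hn : Nat.Prime π.norm.natAbs) :
    J(π.re | π.norm.natAbs) = 1 := by
  rw [J_sym _ (norm_mod4 hp) hp.1]
  have h0 : π.re ≠ 0 := by intro h; have := hp.1; simp [h] at this
  have : J((π.norm.natAbs : ℤ) | π.re.natAbs) = J(π.im ^ 2 | π.re.natAbs) := by
    apply J_congr
    rw [norm_cast_natAbs, Int.natAbs_dvd]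
    exact ⟨π.re, by ring⟩
  rw [this]
  apply jacobiSym.sq_one'
  by_contra hg
  rw [Int.gcd_eq_natAbs, Int.natAbs_natCast] at hg
  obtain ⟨p, hpp, hd1, hd2⟩ := Nat.Prime.not_coprime_iff_dvd.1 hg
  have h1 : (p : ℤ) ∣ π.im := Int.natCast_dvd.2 hd1
  have h2 : (p : ℤ) ∣ π.re := Int.natCast_dvd.2 hd2
  obtain ⟨x, hx⟩ := h1
  obtain ⟨y, hy⟩ := h2
  have : (π.norm.natAbs : ℤ) = (p * p : ℕ) * (x * x + y * y) := by
    rw [norm_cast_natAbs, hx, hy]; push_cast; ring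
  have h3 : p * p ∣ π.norm.natAbs := by
    rw [← Int.natCast_dvd_natCast, this]; exact Dvd.intro _ rfl
  rcases (Nat.dvd_prime hn).1 h3 with h | h
  · exact hpp.one_lt.ne' (Nat.eq_one_of_mul_eq_one_right h)
  · rw [← h] at hn; exact Nat.not_prime_mul hpp.one_lt.ne' hpp.one_lt.ne' hn

lemma leg_mul {π : A} (hπ : Prime π) (hp : prim π) (a b : A) :
    leg (a * b) π = leg a π * leg b π := by
  unfold leg
  split_ifs with h
  · rw [Zsqrtd.norm_mul, jacobiSym.mul_left]
  · have hn := ((prim_prime_cases hπ hp).resolve_left (fun h' => h h'.1)).2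
    rw [← jacobiSym.mul_left]
    have : J((a.re * π.re + a.im * π.im) * (b.re * π.re + b.im * π.im) | π.norm.natAbs)
       = J(π.re * ((a * b).re * π.re + (a * b).im * π.im) | π.norm.natAbs) := by
      apply J_congr
      rw [norm_cast_natAbs]
      refine ⟨a.im * b.im, ?_⟩
      simp; ring
    rw [this, jacobiSym.mul_left, J_re hp hn, one_mul]

lemma leg_congr {π a b : A} (h : π ∣ a - b) : leg a π = leg b π := by
  obtain ⟨t, ht⟩ := h
  have ha : a = b + π * t := by linear_combination ht
  subst ha
  unfold leg
  split_ifs with h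
  · apply J_congr
    rw [Int.natAbs_dvd]
    refine ⟨2 * (b.re * t.re + b.im * t.im) + π.re * t.norm, ?_⟩
    simp [norm_eq, h]; ring
  · apply J_congr
    rw [norm_cast_natAbs]
    refine ⟨t.re, ?_⟩
    simp; ring

lemma leg_one (π : A) (hπ : Prime π) (hp : prim π) : leg 1 π = 1 := by
  unfold leg
  split_ifs with h
  · simp
  · have hn := ((prim_prime_cases hπ hp).resolve_left (fun h' => h h'.1)).2
    simpa using J_re hp hn

lemma leg_neg_one (π : A) (hπ : Prime π) (hp : prim π) : leg (-1) π = 1 := by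
  have h1 : leg iA π * leg iA π = leg (-1) π := by rw [← leg_mul hπ hp, iA_mul]
  have h2 : leg (-1) π * leg (-1) π = 1 := by rw [← leg_mul hπ hp]; simpa using leg_one π hπ hp
  have h3 : leg iA π = 0 ∨ leg iA π = 1 ∨ leg iA π = -1 := by
    unfold leg; split_ifs <;> exact jacobiSym.trichotomy _ _
  rcases h3 with h | h | h <;> rw [h] at h1 <;> rw [← h1] at h2 ⊢ <;> first | (exfalso; norm_num at h2; done) | norm_num

lemma leg_vals {π a : A} (hπ : Prime π) (hp : prim π) (h : ¬ π ∣ a) :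
    leg a π = 1 ∨ leg a π = -1 := by
  unfold leg
  split_ifs with h0
  · obtain ⟨-, hq, hq2⟩ := (prim_prime_cases hπ hp).resolve_right (fun h' => h'.1 h0)
    apply jacobiSym.eq_one_or_neg_one
    rw [Int.gcd_comm, Int.gcd_eq_natAbs, Int.natAbs_natCast]
    refine (Nat.Prime.coprime_iff_not_dvd hq).2 fun hd => h ?_
    have h2 : ((π.re.natAbs : ℕ) : A) ∣ ((a.norm : ℤ) : A) := by
      have : ((π.re.natAbs : ℤ)) ∣ a.norm := Int.natCast_dvd.2 hd
      have h9 := map_dvd (Int.castRingHom A) this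
      rw [eq_intCast, eq_intCast, Int.cast_natCast] at h9
      exact h9
    rw [Zsqrtd.norm_eq_mul_conj] at h2
    have hd3 : ((π.re.natAbs : ℕ) : A) ∣ a := by
      rcases hq2.dvd_or_dvd h2 with h3 | h3
      · exact h3
      · have := map_dvd (starRingEnd A) h3
        rw [map_natCast, starRingEnd_apply, star_star] at this
        exact this
    refine dvd_trans ?_ hd3
    have h5 : π = (π.re : A) := by ext <;> simp [h0]
    have h6 : ((π.re.natAbs : ℕ) : A) = ((π.re.natAbs : ℤ) : A) := by simp
    rw [h6]
    conv_lhs => rw [h5]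
    exact (Int.castRingHom A).map_dvd (Int.dvd_natAbs.2 dvd_rfl)
  · have hn := ((prim_prime_cases hπ hp).resolve_left (fun h' => h0 h'.1)).2
    apply jacobiSym.eq_one_or_neg_one
    rw [Int.gcd_comm, Int.gcd_eq_natAbs, Int.natAbs_natCast]
    refine (Nat.Prime.coprime_iff_not_dvd hn).2 fun hd => h ?_
    have hnz := Nat.prime_iff_prime_int.1 hn
    obtain ⟨k, hk⟩ : (π.norm.natAbs : ℤ) ∣ a.re * π.re + a.im * π.im := Int.natCast_dvd.2 hd
    rw [norm_cast_natAbs] at hk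
    have hm : (π.norm.natAbs : ℤ) ∣ (a.im * π.re - a.re * π.im) := by
      apply hnz.dvd_of_dvd_pow (n := 2)
      refine ⟨a.norm - (a.re * π.re + a.im * π.im) * k, ?_⟩
      rw [norm_cast_natAbs, norm_eq]
      linear_combination (-(a.re * π.re + a.im * π.im)) * hk
    obtain ⟨l, hl⟩ := hm
    rw [norm_cast_natAbs] at hl
    have hN : π.re * π.re + π.im * π.im ≠ 0 := by
      rw [← norm_cast_natAbs]; exact hnz.ne_zero
    refine ⟨⟨k, l⟩, ?_⟩
    ext
    · simp
      apply mul_left_cancel₀ hN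
      linear_combination π.re * hk - π.im * hl
    · simp
      apply mul_left_cancel₀ hN
      linear_combination π.im * hk + π.re * hl

lemma leg_qr {π ρ : A} (hπ : Prime π) (hp : prim π) (hρ : Prime ρ) (hr : prim ρ)
    (hne : ¬ π ∣ ρ) (hne' : ¬ ρ ∣ π) : leg π ρ = leg ρ π := by
  have hv1 := leg_vals hρ hr hne'
  have hv2 := leg_vals hπ hp hne
  -- split-inert
  have si : ∀ {π ρ : A} (hπ : Prime π) (hp : prim π) (hρ : Prime ρ) (hr : prim ρ)
    (h : π.im ≠ 0) (h' : ρ.im = 0), leg π ρ = leg ρ π := by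
    intro π ρ hπ hp hρ hr h h'
    have hn := ((prim_prime_cases hπ hp).resolve_left (fun h' => h h'.1)).2
    simp only [leg, h, h', if_true, if_false, zero_mul, add_zero]
    rw [jacobiSym.mul_left, J_re hp hn, mul_one, J_sym _ (norm_mod4 hp) hr.1,
      GaussianInt.abs_natCast_norm]
  by_cases h : π.im = 0 <;> by_cases h' : ρ.im = 0
  · have key : ∀ {π ρ : A}, π.im = 0 → ρ.im = 0 → (leg π ρ = 1 ∨ leg π ρ = -1) → leg π ρ = 1 := by
      intro π ρ h h' hv
      simp only [leg, h', if_true] at hv ⊢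
      rw [norm_eq, h] at hv ⊢
      simp only [mul_zero, add_zero, jacobiSym.mul_left] at hv ⊢
      rcases jacobiSym.trichotomy π.re ρ.re.natAbs with h | h | h <;> simp_all
    rw [key h h' hv1, key h' h hv2]
  · exact (si hρ hr hπ hp h' h).symm
  · exact si hπ hp hρ hr h h'
  · simp only [leg, h, h', if_false] at hv1 hv2 ⊢
    have hc : ρ.re * π.re + ρ.im * π.im = π.re * ρ.re + π.im * ρ.im := by ring
    rw [hc] at hv2 ⊢
    set x := π.re * ρ.re + π.im * ρ.im with hx
    have hodd : Odd x := (hp.1.mul hr.1).add_even (hp.2.mul_right _)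
    have hmul : J(x | π.norm.natAbs * ρ.norm.natAbs) = J(x | π.norm.natAbs) * J(x | ρ.norm.natAbs) := by
      apply jacobiSym.mul_right'
      · rw [Ne, Int.natAbs_eq_zero, GaussianInt.norm_eq_zero]; exact hπ.ne_zero
      · rw [Ne, Int.natAbs_eq_zero, GaussianInt.norm_eq_zero]; exact hρ.ne_zero
    have h4 : (π.norm.natAbs * ρ.norm.natAbs) % 4 = 1 := by
      rw [Nat.mul_mod, norm_mod4 hp, norm_mod4 hr]
    have h5 : J(x | π.norm.natAbs * ρ.norm.natAbs) = J((π.re * ρ.im - π.im * ρ.re) | x.natAbs) *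
        J((π.re * ρ.im - π.im * ρ.re) | x.natAbs):= by
      rw [J_sym _ h4 hodd, ← jacobiSym.mul_left]
      apply J_congr
      rw [Int.natAbs_dvd]
      refine ⟨x, ?_⟩
      rw [Nat.cast_mul, norm_cast_natAbs, norm_cast_natAbs, hx]; ring
    rcases jacobiSym.trichotomy (π.re * ρ.im - π.im * ρ.re) x.natAbs with h | h | h <;>
    rw [hmul, h] at h5 <;> rcases hv1 with hv1 | hv1 <;> rcases hv2 with hv2 | hv2 <;>
      rw [hv1, hv2] at h5 ⊢ <;> norm_num at h5

lemma leg_two_mul_i {π : A} (hπ : Prime π) (hp : prim π) :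
    leg iA π = ZMod.χ₈ (π.norm : ZMod 8) := by
  have h2 : leg 2 π = ZMod.χ₈ (π.norm : ZMod 8) := by
    unfold leg
    split_ifs with h
    · have ho : Odd π.re.natAbs := by simpa using hp.1
      have : (2 : A).norm = 2 * 2 := by simp [norm_eq]
      rw [this, jacobiSym.mul_left, jacobiSym.at_two ho, ← map_mul]
      congr 1
      rw [norm_eq, h]
      have : ((π.re.natAbs : ℤ) * (π.re.natAbs : ℤ)) = π.re * π.re + 0 * 0 := by
        simp
      rw [← this, Int.cast_mul, Int.cast_natCast]
    · have hn := ((prim_prime_cases hπ hp).resolve_left (fun h' => h h'.1)).2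
      have h4 := norm_mod4 hp
      have : (2 : A).re * π.re + (2 : A).im * π.im = 2 * π.re := by simp
      rw [this, jacobiSym.mul_left, J_re hp hn, mul_one,
        jacobiSym.at_two (Nat.odd_iff.2 (by omega))]
      congr 1
      rw [← GaussianInt.abs_natCast_norm, Int.cast_natCast, Int.natAbs_natCast]
  rw [← h2]
  have h3 : leg iA π * leg 2 π = leg (1 + iA) π * leg (1 + iA) π := by
    rw [← leg_mul hπ hp, ← leg_mul hπ hp]; congr 1
  have h4 : leg iA π * leg iA π = 1 := by
    rw [← leg_mul hπ hp, iA_mul, leg_neg_one π hπ hp]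
  have h6 : ∀ a, leg a π = 0 ∨ leg a π = 1 ∨ leg a π = -1 := by
    intro a; unfold leg; split_ifs <;> exact jacobiSym.trichotomy _ _
  have h7 : leg 2 π ≠ 0 := by
    have : ¬ π ∣ 2 := by
      rintro ⟨t, ht⟩
      have e : π.norm * t.norm = 4 := by rw [← Zsqrtd.norm_mul, ← ht]; simp [norm_eq]
      have h8 := norm_mod4 hp
      have h9 : π.norm.natAbs ∣ 2 ^ 2 := ⟨t.norm.natAbs, by rw [← Int.natAbs_mul, e]; decide⟩
      obtain ⟨k, hk, hk2⟩ := (Nat.dvd_prime_pow Nat.prime_two).1 h9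
      interval_cases k
      · exact hπ.not_isUnit (Zsqrtd.norm_eq_one_iff.1 (by simpa using hk2))
      · omega
      · omega
    rcases leg_vals hπ hp this with h | h <;> rw [h] <;> norm_num
  rcases h6 iA with h | h | h <;> rcases h6 2 with h' | h' | h' <;>
   rcases h6 (1 + iA) with h'' | h'' | h'' <;> rw [h] at h4 <;> rw [h, h', h''] at h3 <;> 
   first | exact absurd h' h7 | (exfalso; norm_num at h3 ; done) | (exfalso; norm_num at h4; done) | rw [h, h']

lemma leg_one_add_i {π : A} (hπ : Prime π) (hp : prim π) :
    leg (1 + iA) π = ZMod.χ₈ ((π.re + π.im : ℤ) : ZMod 8) := by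
  have habs : ∀ x : ℤ, ZMod.χ₈ ((x.natAbs : ℕ) : ZMod 8) = ZMod.χ₈ ((x : ℤ) : ZMod 8) := by
    intro x
    rcases Int.natAbs_eq x with h1 | h1
    · conv_rhs => rw [h1]
      simp
    · conv_rhs => rw [h1]
      rw [Int.cast_neg, Int.cast_natCast]
      have : ∀ y : ZMod 8, ZMod.χ₈ (-y) = ZMod.χ₈ y := by decide
      rw [this]
  unfold leg
  split_ifs with h
  · have ho : Odd π.re.natAbs := by simpa using hp.1
    have : (1 + iA : A).norm = 2 := by simp [norm_eq, iA]
    rw [this, jacobiSym.at_two ho, h, habs, add_zero]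
  · have hn := ((prim_prime_cases hπ hp).resolve_left (fun h' => h h'.1)).2
    have e : (1 + iA).re * π.re + (1 + iA).im * π.im = π.re + π.im := by simp [iA]
    have hv : J(π.re + π.im | π.norm.natAbs) = 1 ∨ J(π.re + π.im | π.norm.natAbs) = -1 := by
      have h1 : ¬ π ∣ (1 + iA) := by
        rintro ⟨t, ht⟩
        have e : π.norm * t.norm = 2 := by rw [← Zsqrtd.norm_mul, ← ht]; simp [norm_eq, iA]
        have h8 := norm_mod4 hp
        have h9 : π.norm.natAbs ∣ 2 := ⟨t.norm.natAbs, by rw [← Int.natAbs_mul, e]; rfl⟩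
        have := Nat.le_of_dvd (by norm_num) h9
        have h10 : π.norm.natAbs = 1 := by omega
        exact hπ.not_isUnit (Zsqrtd.norm_eq_one_iff.1 h10)
      have := leg_vals hπ hp h1
      simpa only [leg, h, if_false, e] using this
    rw [e]
    have ho : Odd (π.re + π.im) := hp.1.add_even hp.2
    rw [J_sym _ (norm_mod4 hp) ho] at hv ⊢
    have ho' : Odd (π.re + π.im).natAbs := by simpa using ho
    rw [← habs, ← jacobiSym.at_two ho']
    have h5 : J(2 | (π.re + π.im).natAbs) * J((π.norm.natAbs : ℤ) | (π.re + π.im).natAbs) =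
        J((π.re - π.im) | (π.re + π.im).natAbs) * J((π.re - π.im) | (π.re + π.im).natAbs) := by
      rw [← jacobiSym.mul_left, ← jacobiSym.mul_left]
      apply J_congr
      rw [Int.natAbs_dvd]
      refine ⟨π.re + π.im, ?_⟩
      rw [norm_cast_natAbs]; ring
    have h6 : J(2 | (π.re + π.im).natAbs) = 1 ∨ J(2 | (π.re + π.im).natAbs) = -1 := by
      apply jacobiSym.eq_one_or_neg_one
      rw [Int.gcd_eq_natAbs, Int.natAbs_natCast]
      exact (Nat.coprime_two_left).2 ho'
    rcases jacobiSym.trichotomy (π.re - π.im) (π.re + π.im).natAbs with h | h | h <;>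
    rw [h] at h5 <;> rcases hv with hv1 | hv1 <;> rcases h6 with hv2 | hv2 <;>
      rw [hv1, hv2] at h5 ⊢ <;> norm_num at h5

end SKN
open scoped NumberTheorySymbols

namespace SKN
open UniqueFactorizationMonoid

noncomputable local instance instNormA : StrongNormalizationMonoid A :=
  UniqueFactorizationMonoid.strongNormalizationMonoid

open Classical in
/-- primary associate of an odd element -/
noncomputable def primOf (π : A) : A := if prim π then π else iA * π

/-- the quadratic symbol -/
noncomputable def sym (a p : A) : ℤ :=
  ((normalizedFactors p).map (fun π => leg a (primOf π))).prod

lemma sym_unit (a : A) {u : A} (hu : IsUnit u) : sym a u = 1 := by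
  simp [sym, normalizedFactors_of_isUnit hu]

lemma sym_one_right (a : A) : sym a 1 = 1 := sym_unit a isUnit_one

lemma sym_neg_one_right (a : A) : sym a (-1) = 1 := sym_unit a isUnit_one.neg

lemma sym_mul_right (a : A) {p q : A} (hp : p ≠ 0) (hq : q ≠ 0) :
    sym a (p * q) = sym a p * sym a q := by
  simp [sym, normalizedFactors_mul hp hq]

lemma not_prim_iA_mul {π : A} (h : prim π) : ¬ prim (iA * π) := by
  intro h'
  have := h'.1
  simp [iA] at this
  exact absurd h.2 (by simpa using this)

lemma leg_primOf {π π' : A} (a : A) (hp : prim π) (h : Associated π π') :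
    leg a (primOf π') = leg a π := by
  obtain ⟨u, rfl⟩ := h
  rcases isUnit_cases u.isUnit with h | h | h | h <;> rw [h]
  · rw [mul_one, primOf, if_pos hp]
  · rw [mul_neg, mul_one, primOf, if_pos hp.neg, leg_neg_right _ _ hp]
  · rw [mul_comm, primOf, if_neg (not_prim_iA_mul hp), ← mul_assoc, iA_mul, neg_one_mul,
      leg_neg_right _ _ hp]
  · have : ¬ prim (π * -iA) := by
      intro h'
      apply not_prim_iA_mul hp
      have := h'.neg
      simpa [mul_comm] using this
    rw [primOf, if_neg this]
    congr 1
    linear_combination (-π) * iA_mul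

lemma sym_prime (a : A) {π : A} (hπ : Prime π) (hp : prim π) : sym a π = leg a π := by
  rw [sym, normalizedFactors_irreducible hπ.irreducible]
  simp [leg_primOf a hp (normalize_associated π).symm]

lemma sym_step (a : A) {π p : A} (hπ : Prime π) (hp : prim π) (hq : prim p) :
    sym a (π * p) = leg a π * sym a p := by
  rw [sym_mul_right a hp.ne_zero hq.ne_zero, sym_prime a hπ hp]

lemma sym_mul (a b : A) {p : A} (hp : prim p) : sym (a * b) p = sym a p * sym b p := by
  revert p
  apply prim_induction
  · simp [sym_one_right]
  · simp [sym_neg_one_right]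
  · intro π p hπ hp hq ih
    rw [sym_step _ hπ hp hq, sym_step _ hπ hp hq, sym_step _ hπ hp hq, ih, leg_mul hπ hp]; ring

lemma sym_congr {a b p : A} (hp : prim p) : p ∣ a - b → sym a p = sym b p := by
  revert p
  apply prim_induction
  · simp [sym_one_right]
  · simp [sym_neg_one_right]
  · intro π p hπ hp hq ih h
    rw [sym_step _ hπ hp hq, sym_step _ hπ hp hq, ih (dvd_of_mul_left_dvd h),
      leg_congr (dvd_of_mul_right_dvd h)]

lemma sym_one_left {p : A} (hp : prim p) : sym 1 p = 1 := by
  revert p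
  apply prim_induction
  · simp [sym_one_right]
  · simp [sym_neg_one_right]
  · intro π p hπ hp hq ih
    rw [sym_step _ hπ hp hq, ih, leg_one π hπ hp, one_mul]

lemma sym_neg_one_left {p : A} (hp : prim p) : sym (-1) p = 1 := by
  revert p
  apply prim_induction
  · simp [sym_one_right]
  · simp [sym_neg_one_right]
  · intro π p hπ hp hq ih
    rw [sym_step _ hπ hp hq, ih, leg_neg_one π hπ hp, one_mul]

lemma sym_neg (a : A) {p : A} (hp : prim p) : sym (-a) p = sym a p := by
  rw [neg_eq_neg_one_mul, sym_mul _ _ hp, sym_neg_one_left hp, one_mul]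

lemma sym_neg_right (a : A) {p : A} (hp : prim p) : sym a (-p) = sym a p := by
  rw [neg_eq_neg_one_mul, sym_mul_right _ (by simp) hp.ne_zero, sym_neg_one_right, one_mul]

lemma sym_vals {a p : A} (hp : prim p) : IsCoprime a p → sym a p = 1 ∨ sym a p = -1 := by
  revert p
  apply prim_induction
  · simp [sym_one_right]
  · simp [sym_neg_one_right]
  · intro π p hπ hp hq ih h
    rw [sym_step _ hπ hp hq]
    have h1 : ¬ π ∣ a := by
      intro hd
      have := (h.of_mul_right_left).isUnit_of_dvd' hd dvd_rfl
      exact hπ.not_isUnit this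
    rcases ih h.of_mul_right_right with h2 | h2 <;> rcases leg_vals hπ hp h1 with h3 | h3 <;>
      rw [h2, h3] <;> norm_num

lemma sym_sq {a p : A} (hp : prim p) (h : IsCoprime a p) : sym a p * sym a p = 1 := by
  rcases sym_vals hp h with h | h <;> rw [h] <;> norm_num

lemma sym_qr {p q : A} (hp : prim p) (hq : prim q) : IsCoprime p q → sym p q = sym q p := by
  revert p
  apply prim_induction
  · simp [sym_one_right, sym_one_left hq]
  · simp [sym_neg_one_right, sym_neg_one_left hq]
  · intro π p hπ hp hp' ih h
    rw [sym_step _ hπ hp hp', sym_mul _ _ hq, ih h.of_mul_left_right]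
    congr 1
    have h1 := h.of_mul_left_left
    clear h ih
    revert q
    intro q hq
    revert q
    apply prim_induction
    · simp [sym_one_right, leg_one π hπ hp]
    · simp [sym_neg_one_right, leg_neg_one π hπ hp]
    · intro ρ q hρ hr hq ih h
      rw [sym_step _ hρ hr hq, leg_mul hπ hp, ih h.of_mul_right_right]
      congr 1
      have h2 := h.of_mul_right_left
      exact leg_qr hπ hp hρ hr (fun h3 => hπ.not_isUnit (h2.isUnit_of_dvd' dvd_rfl h3))
        (fun h3 => hρ.not_isUnit (h2.isUnit_of_dvd' h3 dvd_rfl))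

lemma sym_iA {p : A} (hp : prim p) : sym iA p = ZMod.χ₈ (p.norm : ZMod 8) := by
  revert p
  apply prim_induction
  · simp [sym_one_right]
  · simp [sym_neg_one_right]
  · intro π p hπ hp hq ih
    rw [sym_step _ hπ hp hq, ih, leg_two_mul_i hπ hp, ← map_mul, Zsqrtd.norm_mul, Int.cast_mul]

lemma sym_one_add_iA {p : A} (hp : prim p) :
    sym (1 + iA) p = ZMod.χ₈ ((p.re + p.im : ℤ) : ZMod 8) := by
  revert p
  apply prim_induction
  · simp [sym_one_right]
  · simp [sym_neg_one_right]; decide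
  · intro π p hπ hp hq ih
    rw [sym_step _ hπ hp hq, ih, leg_one_add_i hπ hp, ← map_mul, ← Int.cast_mul]
    congr 1
    rw [ZMod.intCast_eq_intCast_iff_dvd_sub]
    obtain ⟨x, hx⟩ := hp.2
    obtain ⟨y, hy⟩ := hq.2
    refine ⟨-(x * y), ?_⟩
    simp [hx, hy]; ring

lemma sym_iA_congr {p t : A} (hp : prim p) : sym iA (p + 4 * t) = sym iA p := by
  have hp' : prim (p + 4 * t) := by
    have := hp.add_two (2 * t); rwa [← mul_assoc, show (2 : A) * 2 = 4 by norm_num] at this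
  rw [sym_iA hp, sym_iA hp']
  congr 1
  rw [ZMod.intCast_eq_intCast_iff_dvd_sub]
  obtain ⟨x, hx⟩ := hp.2
  refine ⟨-(p.re * t.re + p.im * t.im + 2 * t.norm), ?_⟩
  simp [norm_eq]; ring

lemma sym_one_add_iA_congr {p t : A} (hp : prim p) :
    sym (1 + iA) (p + 4 * ((1 + iA) * t)) = sym (1 + iA) p := by
  have hp' : prim (p + 4 * ((1 + iA) * t)) := by
    have := hp.add_two (2 * ((1 + iA) * t))
    rwa [← mul_assoc, show (2 : A) * 2 = 4 by norm_num] at this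
  rw [sym_one_add_iA hp, sym_one_add_iA hp']
  congr 1
  rw [ZMod.intCast_eq_intCast_iff_dvd_sub]
  refine ⟨-t.re, ?_⟩
  simp [iA]; ring

/-- S7 -/
lemma sym_shift (s : A) : ∀ (D C : A), prim D → IsCoprime s D →
    sym s (D + s * (4 * C)) = sym s D := by
  have hprim : ∀ {s D C : A}, prim s → prim D → IsCoprime s D →
     sym s (D + s * (4 * C)) = sym s D := by
    intro s D C hs hD h
    have hD' : prim (D + s * (4 * C)) := by
      have := hD.add_two (2 * (s * C))
      convert this using 2; ring
    rw [sym_qr hs hD' ?_, sym_qr hs hD h]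
    · apply sym_congr hs; exact ⟨4 * C, by ring⟩
    · exact (IsCoprime.add_mul_left_right_iff).2 h
  induction hn : s.norm.natAbs using Nat.strong_induction_on generalizing s with
  | _ n ih =>
    intro D C hD h
    have hD' : prim (D + s * (4 * C)) := by
      have := hD.add_two (2 * (s * C))
      convert this using 2; ring
    by_cases hs0 : s = 0
    · simp [hs0]
    rcases exists_prim_or s with h1 | h1 | ⟨b, rfl⟩
    · exact hprim h1 hD h
    · have e : s = -(iA * (iA * s)) := by linear_combination s * iA_mul
      have hu : IsUnit iA := ⟨⟨iA, -iA, by simp [iA_mul], by simp [iA_mul]⟩, rfl⟩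
      have h2 : IsCoprime (iA * s) D := (isCoprime_mul_unit_left_left hu s D).2 h
      have e2 : ∀ p, prim p → sym s p = sym iA p * sym (iA * s) p := by
        intro p hp
        conv_lhs => rw [e]
        rw [sym_neg _ hp, sym_mul _ _ hp]
      rw [e2 _ hD', e2 _ hD]
      congr 1
      · have : s * (4 * C) = 4 * (s * C) := by ring
        rw [this, sym_iA_congr hD]
      · have : s * (4 * C) = (iA * s) * (4 * (-iA * C)) := by
          linear_combination (4 * s * C) * iA_mul
        rw [this, hprim h1 hD h2]
    · rw [sym_mul _ _ hD', sym_mul _ _ hD]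
      congr 1
      · have : (1 + iA) * b * (4 * C) = 4 * ((1 + iA) * (b * C)) := by ring
        rw [this, sym_one_add_iA_congr hD]
      · have : (1 + iA) * b * (4 * C) = b * (4 * ((1 + iA) * C)) := by ring
        rw [this]
        refine ih _ ?_ b rfl D _ hD h.of_mul_left_right
        rw [← hn, Zsqrtd.norm_mul, Int.natAbs_mul]
        have : (1 + iA : A).norm.natAbs = 2 := by decide
        rw [this]
        have : b.norm.natAbs ≠ 0 := by
          rw [Ne, Int.natAbs_eq_zero, GaussianInt.norm_eq_zero]; rintro rfl; simp at hs0
        omega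

lemma sym_one_add_iA_special (ε : A) (h : ε = iA ∨ ε = -iA) : sym (1 + iA) (1 - 4 * ε) = -1 := by
  have hp : prim (1 - 4 * ε) := prim_iff_exists.2 ⟨-2 * ε, by ring⟩
  rw [sym_one_add_iA hp]
  rcases h with rfl | rfl <;> simp [iA] <;> decide

end SKN

namespace SKN

abbrev K := FractionRing A

/-- coercion from `A` to `K` -/
abbrev cc (a : A) : K := algebraMap A K a

lemma cc_inj {a b : A} (h : cc a = cc b) : a = b := IsFractionRing.injective A K h

lemma cc_ne_zero {a : A} (h : a ≠ 0) : cc a ≠ 0 := fun h' => h (cc_inj (by simpa using h'))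

lemma smul_cc (a : A) (z : K) : a • z = cc a * z := Algebra.smul_def a z

def Lam (z : K) : Prop := ∃ a c : A, prim a ∧ cc a * z = cc c

def Lam1 (z : K) : Prop := ∃ a c : A, prim a ∧ prim c ∧ cc a * z = cc c

lemma Lam1.lam {z : K} (h : Lam1 z) : Lam z := by
  obtain ⟨a, c, ha, _, h⟩ := h; exact ⟨a, c, ha, h⟩

lemma Lam_cc (a : A) : Lam (cc a) := ⟨1, a, prim_one, by simp⟩

lemma Lam1_cc {a : A} (h : prim a) : Lam1 (cc a) := ⟨1, a, prim_one, h, by simp⟩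

lemma Lam1_one : Lam1 1 := ⟨1, 1, prim_one, prim_one, by simp⟩
lemma Lam_one : Lam 1 := Lam1_one.lam
lemma Lam_zero : Lam 0 := ⟨1, 0, prim_one, by simp⟩

lemma Lam.mul {x y : K} (hx : Lam x) (hy : Lam y) : Lam (x * y) := by
  obtain ⟨a, c, ha, h⟩ := hx
  obtain ⟨a', c', ha', h'⟩ := hy
  refine ⟨a * a', c * c', ha.mul ha', ?_⟩
  simp only [cc, map_mul] at *
  rw [← h, ← h']; ring

lemma Lam.add {x y : K} (hx : Lam x) (hy : Lam y) : Lam (x + y) := by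
  obtain ⟨a, c, ha, h⟩ := hx
  obtain ⟨a', c', ha', h'⟩ := hy
  refine ⟨a * a', a' * c + a * c', ha.mul ha', ?_⟩
  simp only [cc, map_mul, map_add] at *
  rw [← h, ← h']; ring

lemma Lam.neg {x : K} (hx : Lam x) : Lam (-x) := by
  obtain ⟨a, c, ha, h⟩ := hx
  exact ⟨a, -c, ha, by simp only [cc, map_neg] at *; rw [← h]; ring⟩

lemma Lam.sub {x y : K} (hx : Lam x) (hy : Lam y) : Lam (x - y) := by
  rw [sub_eq_add_neg]; exact hx.add hy.neg

lemma Lam.sum {ι : Type*} {s : Finset ι} {f : ι → K} (h : ∀ i ∈ s, Lam (f i)) :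
    Lam (∑ i ∈ s, f i) := by
  classical
  induction s using Finset.induction_on with
  | empty => simpa using Lam_zero
  | insert a s ha ih =>
    rw [Finset.sum_insert ha]
    exact (h a (by simp)).add (ih fun i hi => h i (by simp [hi]))

lemma Lam1.mul {x y : K} (hx : Lam1 x) (hy : Lam1 y) : Lam1 (x * y) := by
  obtain ⟨a, c, ha, hc, h⟩ := hx
  obtain ⟨a', c', ha', hc', h'⟩ := hy
  refine ⟨a * a', c * c', ha.mul ha', hc.mul hc', ?_⟩
  simp only [cc, map_mul] at *
  rw [← h, ← h']; ring

lemma Lam1.ne_zero {x : K} (hx : Lam1 x) : x ≠ 0 := by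
  rintro rfl
  obtain ⟨a, c, ha, hc, h⟩ := hx
  exact cc_ne_zero hc.ne_zero (by rw [← h, mul_zero])

lemma Lam1.inv {x : K} (hx : Lam1 x) : Lam1 x⁻¹ := by
  have h0 := hx.ne_zero
  obtain ⟨a, c, ha, hc, h⟩ := hx
  exact ⟨c, a, hc, ha, by rw [← h]; field_simp⟩

lemma Lam1.prod {ι : Type*} {s : Finset ι} {f : ι → K} (h : ∀ i ∈ s, Lam1 (f i)) :
    Lam1 (∏ i ∈ s, f i) := by
  classical
  induction s using Finset.induction_on with
  | empty => simpa using Lam1_one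
  | insert a s ha ih =>
    rw [Finset.prod_insert ha]
    exact (h a (by simp)).mul (ih fun i hi => h i (by simp [hi]))

lemma Lam1.add_four {x y : K} (hx : Lam1 x) (hy : Lam y) : Lam1 (x + 4 * y) := by
  obtain ⟨a, c, ha, hc, h⟩ := hx
  obtain ⟨a', c', ha', h'⟩ := hy
  refine ⟨a * a', a' * c + 2 * (2 * a * c'), ha.mul ha', (ha'.mul hc).add_two _, ?_⟩
  simp only [cc, map_mul, map_add, map_ofNat] at *
  rw [← h, ← h']; ring

lemma Lam1.neg {x : K} (hx : Lam1 x) : Lam1 (-x) := by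
  obtain ⟨a, c, ha, hc, h⟩ := hx
  exact ⟨a, -c, ha, hc.neg, by simp only [cc, map_neg] at *; rw [← h]; ring⟩

lemma prim_of_Lam1 {n : A} (h : Lam1 (cc n)) : prim n := by
  obtain ⟨a, c, ha, hc, h⟩ := h
  have : a * n = c := cc_inj (by rw [← h]; simp [cc])
  exact ha.of_mul (this ▸ hc)

lemma Lam.div {x y : K} (hx : Lam x) (hy : Lam1 y) : Lam (x / y) := by
  rw [div_eq_mul_inv]; exact hx.mul hy.inv.lam

def isRep (z : K) (ac : A × A) : Prop := prim ac.1 ∧ IsCoprime ac.1 ac.2 ∧ cc ac.1 * z = cc ac.2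

lemma Lam.exists_rep {z : K} (h : Lam z) : ∃ p q : A, isRep z (p, q) := by
  obtain ⟨a, c, ha, h⟩ := h
  obtain ⟨g, hg⟩ : ∃ g, g = EuclideanDomain.gcd a c := ⟨_, rfl⟩
  have hg0 : g ≠ 0 := by
    intro h0
    rw [h0] at hg
    exact ha.ne_zero (EuclideanDomain.gcd_eq_zero_iff.1 hg.symm).1
  obtain ⟨a1, ha1⟩ : g ∣ a := hg ▸ EuclideanDomain.gcd_dvd_left a c
  obtain ⟨c1, hc1⟩ : g ∣ c := hg ▸ EuclideanDomain.gcd_dvd_right a c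
  obtain ⟨u, hu, hu2⟩ := prim_of_prime_odd ha (π := a1) ⟨g, by rw [ha1]; ring⟩
  have hco : IsCoprime a1 c1 := by
    have hb := EuclideanDomain.gcd_eq_gcd_ab a c
    rw [← hg] at hb
    refine ⟨EuclideanDomain.gcdA a c, EuclideanDomain.gcdB a c, ?_⟩
    apply mul_left_cancel₀ hg0
    conv_rhs => rw [mul_one, hb]
    linear_combination (-EuclideanDomain.gcdA a c) * ha1 - EuclideanDomain.gcdB a c * hc1
  refine ⟨u * a1, u * c1, hu2, ?_, ?_⟩
  · exact (isCoprime_mul_unit_left hu a1 c1).2 hco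
  · have : cc a1 * z = cc c1 := by
      apply mul_left_cancel₀ (cc_ne_zero hg0)
      rw [ha1, hc1] at h
      simp only [cc, map_mul] at *
      rw [← h]; ring
    simp only [cc, map_mul] at *
    rw [← this]; ring

open Classical in
/-- Jacobi-type symbol of a fraction -/
noncomputable def JJ (z : K) : ℤ :=
  if h : ∃ ac : A × A, isRep z ac then sym h.choose.2 h.choose.1 else 1

lemma rep_unique {z : K} {p q p' q' : A} (h : isRep z (p, q)) (h' : isRep z (p', q')) :
    (p' = p ∧ q' = q) ∨ (p' = -p ∧ q' = -q) := by
  obtain ⟨hp, hco, h⟩ := h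
  obtain ⟨hp', hco', h'⟩ := h'
  simp only at *
  have e : p * q' = p' * q := by
    apply cc_inj
    simp only [cc, map_mul] at *
    rw [← h, ← h']; ring
  have d1 : p ∣ p' := hco.dvd_of_dvd_mul_right ⟨q', e.symm⟩
  have d2 : p' ∣ p := hco'.dvd_of_dvd_mul_right ⟨q, e⟩
  obtain ⟨u, hu⟩ := associated_of_dvd_dvd d1 d2
  have hup : prim (u : A) := hp.of_mul (hu ▸ hp')
  have hp0 := hp.ne_zero
  rcases prim_unit u.isUnit hup with h1 | h1 <;> rw [h1] at hu
  · left
    refine ⟨by rw [← hu]; ring, ?_⟩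
    apply mul_left_cancel₀ hp0
    rw [e, ← hu]; ring
  · right
    refine ⟨by rw [← hu]; ring, ?_⟩
    apply mul_left_cancel₀ hp0
    rw [e, ← hu]; ring

lemma JJ_eq {z : K} {p q : A} (h : isRep z (p, q)) : JJ z = sym q p := by
  have hex : ∃ ac : A × A, isRep z ac := ⟨_, h⟩
  rw [JJ, dif_pos hex]
  have h' := hex.choose_spec
  rcases rep_unique h (p' := hex.choose.1) (q' := hex.choose.2) h' with ⟨h1, h2⟩ | ⟨h1, h2⟩
  · rw [h1, h2]
  · rw [h1, h2, sym_neg _ h.1.neg, sym_neg_right _ h.1]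

lemma JJ_vals (z : K) : JJ z = 1 ∨ JJ z = -1 := by
  by_cases hex : ∃ ac : A × A, isRep z ac
  · obtain ⟨⟨p, q⟩, h⟩ := hex
    rw [JJ_eq h]
    exact sym_vals h.1 h.2.1.symm
  · rw [JJ, dif_neg hex]; exact Or.inl rfl

lemma JJ_mul_self (z : K) : JJ z * JJ z = 1 := by
  rcases JJ_vals z with h | h <;> rw [h] <;> norm_num

lemma JJ_add {z : K} (hz : Lam z) (n : A) : JJ (z + cc n) = JJ z := by
  obtain ⟨p, q, h⟩ := hz.exists_rep
  have h' : isRep (z + cc n) (p, q + p * n) := by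
    refine ⟨h.1, (IsCoprime.add_mul_left_right_iff).2 h.2.1, ?_⟩
    have := h.2.2
    simp only [cc, map_mul, map_add] at *
    rw [← this]; ring
  rw [JJ_eq h, JJ_eq h']
  exact sym_congr h.1 ⟨n, by ring⟩

lemma JJ_neg {z : K} (hz : Lam z) : JJ (-z) = JJ z := by
  obtain ⟨p, q, h⟩ := hz.exists_rep
  have h' : isRep (-z) (p, -q) := by
    refine ⟨h.1, h.2.1.neg_right, ?_⟩
    have := h.2.2
    simp only [cc, map_neg] at *
    rw [← this]; ring
  rw [JJ_eq h, JJ_eq h', sym_neg _ h.1]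

lemma JJ_cc (n : A) : JJ (cc n) = 1 := by
  have h : isRep (cc n) (1, n) := ⟨prim_one, isCoprime_one_left, by simp⟩
  rw [JJ_eq h, sym_one_right]

lemma JJ_zero : JJ 0 = 1 := by simpa [cc] using JJ_cc 0

/-- shift invariance -/
lemma JJ_shift {z : K} (hz : Lam z) (C : A) : JJ (z / (1 + z * (4 * cc C))) = JJ z := by
  obtain ⟨p, q, h⟩ := hz.exists_rep
  have hp' : prim (p + q * (4 * C)) := by
    have := h.1.add_two (2 * (q * C)); convert this using 2; ring
  have hr := h.2.2
  simp only at hr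
  have e : cc p * (1 + z * (4 * cc C)) = cc (p + q * (4 * C)) := by
    simp only [cc, map_mul, map_add, map_ofNat] at *
    rw [← hr]; ring
  have hne : 1 + z * (4 * cc C) ≠ 0 := by
    intro h0; rw [h0, mul_zero] at e; exact cc_ne_zero hp'.ne_zero e.symm
  have h' : isRep (z / (1 + z * (4 * cc C))) (p + q * (4 * C), q) := by
    refine ⟨hp', ?_, ?_⟩
    · exact (IsCoprime.add_mul_left_left_iff).2 h.2.1
    · simp only
      rw [← e, ← hr, mul_assoc, mul_comm _ (z / _), div_mul_cancel₀ _ hne]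
  rw [JJ_eq h, JJ_eq h']
  exact sym_shift q p C h.1 h.2.1.symm

end SKN

namespace SKN

variable {ι : Type*} [Fintype ι] [DecidableEq ι]

/-- integral vector -/
def vcc (w : ι → A) : ι → K := fun k => cc (w k)

def Odd_ (L : Submodule A (ι → K)) : Prop :=
  ∃ m : A, prim m ∧ (∀ w : ι → A, m • vcc w ∈ L) ∧ ∀ v ∈ L, ∃ w : ι → A, m • v = vcc w

def supp (l : List ι) (v : ι → K) : Prop := ∀ k, k ∉ l → v k = 0

lemma supp.add {l : List ι} {v w : ι → K} (hv : supp l v) (hw : supp l w) : supp l (v + w) :=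
  fun k hk => by simp [hv k hk, hw k hk]

lemma supp.sub {l : List ι} {v w : ι → K} (hv : supp l v) (hw : supp l w) : supp l (v - w) :=
  fun k hk => by simp [hv k hk, hw k hk]

lemma supp.smul {l : List ι} {v : ι → K} (hv : supp l v) (n : A) : supp l (n • v) :=
  fun k hk => by simp [hv k hk]

lemma supp.mono {l l' : List ι} {v : ι → K} (hv : supp l v) (h : ∀ k ∈ l, k ∈ l') : supp l' v :=
  fun k hk => hv k fun h' => hk (h k h')

structure Lead (l : List ι) (j : ι) (L : Submodule A (ι → K)) (v : ι → K) : Prop where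
  mem : v ∈ L
  supp : supp (j :: l) v
  lam : Lam1 (v j)
  gen : ∀ w ∈ L, SKN.supp (j :: l) w → ∃ n : A, w j = cc n * v j

lemma Lead.congr {l l' : List ι} {j : ι} {L : Submodule A (ι → K)} {v : ι → K}
    (h : Lead l j L v) (hl : ∀ k, k ∈ l ↔ k ∈ l') : Lead l' j L v := by
  refine ⟨h.mem, h.supp.mono ?_, h.lam, fun w hw hs => h.gen w hw (hs.mono ?_)⟩ <;>
  · intro k; simp [hl]

lemma lead_exists {L : Submodule A (ι → K)} (hL : Odd_ L) (l : List ι) (j : ι) :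
    ∃ v, Lead l j L v := by
  obtain ⟨m, hm, h1, h2⟩ := hL
  let I : Ideal A :=
    { carrier := {x | ∃ v ∈ L, supp (j :: l) v ∧ cc m * v j = cc x}
      add_mem' := by
        rintro x y ⟨v, hv, hs, e⟩ ⟨v', hv', hs', e'⟩
        refine ⟨v + v', L.add_mem hv hv', hs.add hs', ?_⟩
        simp only [cc, map_add, Pi.add_apply] at *
        rw [← e, ← e']; ring
      zero_mem' := ⟨0, L.zero_mem, fun k _ => rfl, by simp [cc]⟩
      smul_mem' := by
        rintro n x ⟨v, hv, hs, e⟩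
        refine ⟨n • v, L.smul_mem n hv, hs.smul n, ?_⟩
        simp only [Pi.smul_apply, smul_cc, smul_eq_mul]
        simp only [cc, map_mul] at *
        rw [← e]; ring }
  have hmI : m * m ∈ I := by
    refine ⟨m • vcc (Pi.single j 1), h1 _, ?_, ?_⟩
    · intro k hk
      have : k ≠ j := fun h => hk (by simp [h])
      simp [vcc, this]
    · simp [vcc, smul_cc, cc]
  obtain ⟨g, hg⟩ := (IsPrincipalIdealRing.principal I).principal
  have hgI : g ∈ I := by rw [hg]; exact Submodule.mem_span_singleton_self g
  have hgm : g ∣ m * m := by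
    rw [hg] at hmI; exact Ideal.mem_span_singleton.1 hmI
  obtain ⟨u, hu, hug⟩ := prim_of_prime_odd (hm.mul hm) hgm
  obtain ⟨v, hv, hs, e⟩ := I.mul_mem_left u hgI
  have hm0 := cc_ne_zero hm.ne_zero
  refine ⟨v, hv, hs, ⟨m, u * g, hm, hug, e⟩, fun w hw hws => ?_⟩
  obtain ⟨w', hw'⟩ := h2 w hw
  have ew : cc m * w j = cc (w' j) := by
    have := congrFun hw' j
    simpa [vcc, smul_cc] using this
  have hwI : w' j ∈ I := ⟨w, hw, hws, ew⟩
  rw [hg] at hwI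
  obtain ⟨n, hn⟩ := Ideal.mem_span_singleton.1 hwI
  refine ⟨n * (↑hu.unit⁻¹ : A), ?_⟩
  apply mul_left_cancel₀ hm0
  rw [ew, hn, mul_left_comm, e]
  simp only [cc, ← map_mul]
  congr 1
  have : (↑hu.unit⁻¹ : A) * u = 1 := by simp
  linear_combination (-n * g) * this

lemma lead_diff {L : Submodule A (ι → K)} {l : List ι} {j : ι} {v w : ι → K}
    (h : Lead l j L v) (hw : w ∈ L) (hs : supp (j :: l) w) :
    ∃ n : A, ∃ x ∈ L, supp l x ∧ x j = 0 ∧ w = n • v + x ∧ w j = cc n * v j := by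
  obtain ⟨n, hn⟩ := h.gen w hw hs
  have hj : (w - n • v) j = 0 := by simp [hn, smul_cc]
  refine ⟨n, w - n • v, L.sub_mem hw (L.smul_mem n h.mem), fun k hk => ?_, hj, by abel, hn⟩
  by_cases hkj : k = j
  · subst hkj; exact hj
  · exact (hs.sub (h.supp.smul n)) k (by simp [hk, hkj])

lemma lead_unique {L : Submodule A (ι → K)} {l : List ι} {j : ι} {v v' : ι → K}
    (h : Lead l j L v) (h' : Lead l j L v') :
    ∃ n : A, (n = 1 ∨ n = -1) ∧ ∃ x ∈ L, supp l x ∧ x j = 0 ∧ v' = n • v + x := by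
  obtain ⟨n, x, hx, hs, hxj, e, en⟩ := lead_diff h h'.mem h'.supp
  obtain ⟨n', en'⟩ := h'.gen v h.mem h.supp
  have hv0 := h.lam.ne_zero
  have hu : n * n' = 1 := by
    apply cc_inj
    apply mul_right_cancel₀ hv0
    rw [en] at en'
    simp only [cc, map_mul, map_one] at *
    conv_rhs => rw [one_mul, en']
    ring
  have hp : prim n := by
    apply prim_of_Lam1
    have : cc n = v' j * (v j)⁻¹ := by rw [en]; field_simp
    rw [this]
    exact h'.lam.mul h.lam.inv
  exact ⟨n, prim_unit (IsUnit.of_mul_eq_one _ hu) hp, x, hx, hs, hxj, e⟩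

lemma Odd_.lam {L : Submodule A (ι → K)} (hL : Odd_ L) {v : ι → K} (hv : v ∈ L) (k : ι) :
    Lam (v k) := by
  obtain ⟨m, hm, h1, h2⟩ := hL
  obtain ⟨w, hw⟩ := h2 v hv
  refine ⟨m, w k, hm, ?_⟩
  have := congrFun hw k
  simpa [vcc, smul_cc] using this

open Classical in
noncomputable def f2 (l : List ι) (a b : ι) (L : Submodule A (ι → K)) : ℤ :=
  if h : ∃ v : (ι → K) × (ι → K), Lead l a L v.1 ∧ Lead (a :: l) b L v.2 then
    JJ (h.choose.2 a / h.choose.1 a) else 1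

lemma f2_eq {L : Submodule A (ι → K)} (hL : Odd_ L) {l : List ι} {a b : ι} {v1 v2 : ι → K}
    (h1 : Lead l a L v1) (h2 : Lead (a :: l) b L v2) : f2 l a b L = JJ (v2 a / v1 a) := by
  have hex : ∃ v : (ι → K) × (ι → K), Lead l a L v.1 ∧ Lead (a :: l) b L v.2 := ⟨(v1, v2), h1, h2⟩
  rw [f2, dif_pos hex]
  obtain ⟨h1', h2'⟩ := hex.choose_spec
  generalize hex.choose.1 = w1 at *
  generalize hex.choose.2 = w2 at *
  obtain ⟨n, hn, x, hx, hxs, hxa, e⟩ := lead_unique h1 h1'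
  obtain ⟨n', hn', x', hx', hxs', hxb, e'⟩ := lead_unique h2 h2'
  obtain ⟨m, hm⟩ := h1.gen x' hx' hxs'
  have hv0 := h1.lam.ne_zero
  have hz := (hL.lam h2.mem a).div h1.lam
  have key : JJ (w2 a / v1 a) = JJ (v2 a / v1 a) := by
    have : w2 a / v1 a = cc n' * (v2 a / v1 a) + cc m := by
      rw [e']; simp only [Pi.add_apply, Pi.smul_apply, smul_cc, hm]; field_simp
    rw [this]
    rcases hn' with rfl | rfl
    · simp only [cc, map_one, one_mul]; exact JJ_add hz m
    · simp only [cc, map_neg, map_one, neg_mul, one_mul]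
      have := JJ_add hz.neg m
      rw [cc] at this
      rw [this, JJ_neg hz]
  rw [← key]
  have hw1 : w1 a = cc n * v1 a := by rw [e]; simp [hxa, smul_cc]
  have hz' := (hL.lam h2'.mem a).div h1.lam
  rw [hw1]
  rcases hn with rfl | rfl
  · simp [cc]
  · simp only [cc, map_neg, map_one, neg_mul, one_mul, div_neg]
    exact JJ_neg hz'

lemma f2_mul_self (l : List ι) (a b : ι) (L : Submodule A (ι → K)) :
    f2 l a b L * f2 l a b L = 1 := by
  unfold f2; split_ifs
  · exact JJ_mul_self _
  · norm_num

structure Adj (π : A) (lam : (ι → K) → A) (L L' : Submodule A (ι → K)) : Prop where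
  prime : Prime π
  prim : prim π
  add : ∀ v ∈ L, ∀ w ∈ L, π ∣ lam (v + w) - (lam v + lam w)
  smul : ∀ n : A, ∀ v ∈ L, π ∣ lam (n • v) - n * lam v
  nz : ∃ v ∈ L, ¬ π ∣ lam v
  mem : ∀ v, v ∈ L' ↔ v ∈ L ∧ π ∣ lam v

namespace Adj
variable {π : A} {lam : (ι → K) → A} {L L' : Submodule A (ι → K)}

lemma comb (h : Adj π lam L L') (n m : A) {v w : ι → K} (hv : v ∈ L) (hw : w ∈ L) :
    π ∣ lam (n • v + m • w) - (n * lam v + m * lam w) := by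
  have h1 := h.add _ (L.smul_mem n hv) _ (L.smul_mem m hw)
  have h2 := h.smul n v hv
  have h3 := h.smul m w hw
  have := dvd_add (dvd_add h1 h2) h3
  convert this using 1; ring

lemma comb3 (h : Adj π lam L L') (n m : A) {v w x : ι → K} (hv : v ∈ L) (hw : w ∈ L)
    (hx : x ∈ L) (hx0 : π ∣ lam x) :
    π ∣ lam (n • v + m • w + x) - (n * lam v + m * lam w) := by
  have h1 := h.add _ (L.add_mem (L.smul_mem n hv) (L.smul_mem m hw)) _ hx
  have h2 := h.comb n m hv hw
  have := dvd_add (dvd_add h1 h2) hx0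
  convert this using 1; ring

lemma comb2 (h : Adj π lam L L') (n : A) {v x : ι → K} (hv : v ∈ L)
    (hx : x ∈ L) (hx0 : π ∣ lam x) :
    π ∣ lam (n • v + x) - n * lam v := by
  have h1 := h.add _ (L.smul_mem n hv) _ hx
  have h2 := h.smul n v hv
  have := dvd_add (dvd_add h1 h2) hx0
  convert this using 1; ring

lemma le (h : Adj π lam L L') {v} (hv : v ∈ L') : v ∈ L := ((h.mem v).1 hv).1

lemma odd (h : Adj π lam L L') (hL : Odd_ L) : Odd_ L' := by
  obtain ⟨m, hm, h1, h2⟩ := hL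
  refine ⟨m * π, hm.mul h.prim, fun w => (h.mem _).2 ⟨?_, ?_⟩, fun v hv => ?_⟩
  · rw [mul_comm, mul_smul]; exact L.smul_mem _ (h1 w)
  · rw [mul_comm, mul_smul]
    have := h.smul π _ (h1 w)
    exact (dvd_sub_left (Dvd.intro _ rfl)).1 this
  · obtain ⟨w, hw⟩ := h2 v (h.le hv)
    refine ⟨π • w, ?_⟩
    rw [mul_comm, mul_smul, hw]
    ext k; simp [vcc, smul_cc]

lemma pi_smul_mem (h : Adj π lam L L') {v} (hv : v ∈ L) : π • v ∈ L' := by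
  refine (h.mem _).2 ⟨L.smul_mem _ hv, ?_⟩
  exact (dvd_sub_left (Dvd.intro _ rfl)).1 (h.smul π _ hv)

/-- solving congruences -/
lemma solve {π : A} (hπ : Prime π) {x : A} (hx : ¬ π ∣ x) (y : A) : ∃ n, π ∣ y - n * x := by
  have : IsCoprime π x := (hπ.irreducible.coprime_iff_not_dvd).2 hx
  obtain ⟨a, b, hab⟩ := this
  exact ⟨y * b, ⟨y * a, by linear_combination (-y) * hab⟩⟩

end Adj

def Jump (l : List ι) (π : A) (lam : (ι → K) → A) (L : Submodule A (ι → K)) (v : ι → K) : Prop :=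
  ∃ l1 j l2, l = l1 ++ j :: l2 ∧ Lead l1 j L v ∧ ¬ π ∣ lam v ∧ ∀ w ∈ L, supp l1 w → π ∣ lam w

section jump
variable {π : A} {lam : (ι → K) → A} {L L' : Submodule A (ι → K)}

lemma Jump.append {l : List ι} {v : ι → K} (h : Jump l π lam L v) (l' : List ι) :
    Jump (l ++ l') π lam L v := by
  obtain ⟨l1, j, l2, rfl, h⟩ := h
  exact ⟨l1, j, l2 ++ l', by simp, h⟩

lemma jump_or (h : Adj π lam L L') (hL : Odd_ L) (l : List ι) :
    (∀ w ∈ L, supp l w → π ∣ lam w) ∨ ∃ v, Jump l π lam L v := by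
  induction l using List.reverseRecOn with
  | nil =>
    left
    intro w hw hs
    have : w = (0 : A) • w := by
      ext k; simp [hs k (by simp)]
    have h1 := h.smul 0 w hw
    rw [← this] at h1; simpa using h1
  | append_singleton l j ih =>
    rcases ih with ih | ⟨v, hv⟩
    · obtain ⟨v, hv⟩ := lead_exists hL l j
      by_cases hd : π ∣ lam v
      · left
        intro w hw hs
        obtain ⟨n, x, hx, hxs, -, e, -⟩ := lead_diff hv hw (hs.mono (by
          intro k; simp [or_comm]))
        have := h.comb2 n hv.mem hx (ih x hx hxs)
        rw [← e] at this
        exact (dvd_sub_left (hd.mul_left n)).1 this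
      · right
        exact ⟨v, l, j, [], rfl, hv, hd, ih⟩
    · exact Or.inr ⟨v, hv.append _⟩

lemma jump_exists (h : Adj π lam L L') (hL : Odd_ L) {l : List ι} (hl : ∀ k, k ∈ l) :
    ∃ v, Jump l π lam L v := by
  rcases jump_or h hL l with h1 | h1
  · obtain ⟨v, hv, hn⟩ := h.nz
    exact absurd (h1 v hv fun k hk => absurd (hl k) hk) hn
  · exact h1

lemma jump_unique (h : Adj π lam L L') {l : List ι} {v v' : ι → K}
    (hv : Jump l π lam L v) (hv' : Jump l π lam L v') : sym (lam v) π = sym (lam v') π := by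
  obtain ⟨l1, j, l2, e, h1, h2, h3⟩ := hv
  obtain ⟨l1', j', l2', e', h1', h2', h3'⟩ := hv'
  have key : ∀ {l1 l1' l2 l2' : List ι} {j j' : ι} {v : ι → K},
      l1 ++ j :: l2 = l1' ++ j' :: l2' → Lead l1 j L v → ¬ π ∣ lam v →
      (∀ w ∈ L, supp l1' w → π ∣ lam w) → l1'.length ≤ l1.length := by
    intro l1 l1' l2 l2' j j' v e h1 h2 h3
    by_contra hlt
    push Not at hlt
    apply h2
    apply h3 v h1.mem
    apply h1.supp.mono
    have hp : (l1 ++ [j]) <+: l1' := by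
      apply List.prefix_of_prefix_length_le (l₃ := l1 ++ j :: l2)
      · exact ⟨l2, by simp⟩
      · exact ⟨j' :: l2', e.symm⟩
      · simp; omega
    intro k hk
    apply hp.subset
    simpa [or_comm] using hk
  have hlen : l1.length = l1'.length :=
    le_antisymm (key (e' ▸ e) h1' h2' h3) (key (e ▸ e') h1 h2 h3')
  rw [e] at e'
  obtain ⟨rfl, e2⟩ := List.append_inj e' hlen
  simp only [List.cons.injEq] at e2
  obtain ⟨rfl, -⟩ := e2
  obtain ⟨n, hn, x, hx, hxs, -, ev⟩ := lead_unique h1 h1'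
  have := h.comb2 n h1.mem hx (h3 x hx hxs)
  rw [← ev] at this
  rw [sym_congr h.prim this]
  rcases hn with rfl | rfl
  · simp
  · rw [neg_one_mul, sym_neg _ h.prim]

end jump

def AdjProp (F : Submodule A (ι → K) → ℤ) (l l' : List ι) : Prop :=
  ∀ π lam L L', Adj π lam L L' → Odd_ L → ∀ v v', Jump l π lam L v → Jump l' π lam L v' →
    F L * F L' = sym (lam v) π * sym (lam v') π

lemma sym_sq' {π a : A} (hπ : Prime π) (hp : prim π) (h : ¬ π ∣ a) : sym a π * sym a π = 1 :=
  sym_sq hp ((hπ.irreducible.coprime_iff_not_dvd).2 h).symm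

lemma AdjProp.trans {F G : Submodule A (ι → K) → ℤ} {l l' l'' : List ι} (hl : ∀ k, k ∈ l')
    (h : AdjProp F l l') (h' : AdjProp G l' l'') : AdjProp (fun L => F L * G L) l l'' := by
  intro π lam L L' ha hL v v'' hv hv''
  obtain ⟨v', hv'⟩ := jump_exists ha hL hl
  have h1 := h π lam L L' ha hL v v' hv hv'
  have h2 := h' π lam L L' ha hL v' v'' hv' hv''
  have hnd : ¬ π ∣ lam v' := by obtain ⟨_, _, _, _, _, h, _⟩ := hv'; exact h
  have h3 := sym_sq' ha.prime ha.prim hnd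
  calc F L * G L * (F L' * G L') = (F L * F L') * (G L * G L') := by ring
    _ = _ := by rw [h1, h2]; linear_combination (sym (lam v) π * sym (lam v'') π) * h3

end SKN

set_option linter.unusedSectionVars false

namespace SKN

variable {ι : Type*} [Fintype ι] [DecidableEq ι]

section swap
variable {π : A} {lam : (ι → K) → A} {L L' : Submodule A (ι → K)}
  {pre suf : List ι} {a b : ι} {v1 v2 : ι → K}

lemma lead_decomp (h1 : Lead pre a L v1) (h2 : Lead (a :: pre) b L v2)
    (hb : b ∉ pre) (ha : a ∉ pre) {w : ι → K} (hw : w ∈ L)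
    (hs : supp (b :: a :: pre) w) :
    ∃ n m : A, ∃ y ∈ L, supp pre y ∧ w = n • v2 + m • v1 + y ∧ y a = 0 ∧ y b = 0 := by
  obtain ⟨n, x, hx, hxs, -, e, -⟩ := lead_diff h2 hw hs
  obtain ⟨m, y, hy, hys, -, e', -⟩ := lead_diff h1 hx hxs
  exact ⟨n, m, y, hy, hys, by rw [e, e']; abel, hys a ha, hys b hb⟩

lemma jump_first (h1 : Lead pre a L v1)
    (hpre : ∀ w ∈ L, supp pre w → π ∣ lam w) (h : ¬ π ∣ lam v1) :
    Jump (pre ++ a :: b :: suf) π lam L v1 :=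
  ⟨pre, a, b :: suf, rfl, h1, h, hpre⟩

lemma jump_second (had : Adj π lam L L') (h1 : Lead pre a L v1) (h2 : Lead (a :: pre) b L v2)
    (hpre : ∀ w ∈ L, supp pre w → π ∣ lam w) (h : π ∣ lam v1) (h' : ¬ π ∣ lam v2) :
    Jump (pre ++ a :: b :: suf) π lam L v2 := by
  refine ⟨pre ++ [a], b, suf, by simp, h2.congr (by intro k; simp [or_comm]), h', ?_⟩
  intro w hw hs
  obtain ⟨n, x, hx, hxs, -, e, -⟩ := lead_diff h1 hw (hs.mono (by intro k; simp [or_comm]))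
  have := had.comb2 n h1.mem hx (hpre x hx hxs)
  rw [← e] at this
  exact (dvd_sub_left (h.mul_left n)).1 this

/-- leads after swapping -/
lemma swap_leads (h1 : Lead pre a L v1) (h2 : Lead (a :: pre) b L v2)
    (hab : a ≠ b) (hb : b ∉ pre) (ha : a ∉ pre) {p q α β : A} (hp : prim p)
    (hz : cc p * (v2 a / v1 a) = cc q) (hco : α * p + β * q = 1) :
    Lead pre b L (p • v2 + (-q) • v1) ∧ Lead (b :: pre) a L (β • v2 + α • v1) := by
  have hv0 := h1.lam.ne_zero
  have hp0 := cc_ne_zero hp.ne_zero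
  have hv1b : v1 b = 0 := h1.supp b (by simp [hb, hab.symm])
  have hz' : cc p * v2 a = cc q * v1 a := by rw [← hz]; field_simp
  have hcoK : cc α * cc p + cc β * cc q = 1 := by
    simp only [cc, ← map_mul, ← map_add, hco, map_one]
  refine ⟨⟨?_, ?_, ?_, ?_⟩, ⟨?_, ?_, ?_, ?_⟩⟩
  · exact L.add_mem (L.smul_mem _ h2.mem) (L.smul_mem _ h1.mem)
  · intro k hk
    by_cases hka : k = a
    · subst hka
      simp only [Pi.add_apply, Pi.smul_apply, smul_cc, hz']
      simp [cc]
    · simp only [List.mem_cons, not_or] at hk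
      simp [h2.supp k (by simp [hk, hka]), h1.supp k (by simp [hk, hka])]
  · have : (p • v2 + (-q) • v1) b = cc p * v2 b := by simp [hv1b, smul_cc]
    rw [this]
    exact (Lam1_cc hp).mul h2.lam
  · intro w hw hs
    obtain ⟨n, m, y, hy, hys, e, hya, hyb⟩ := lead_decomp h1 h2 hb ha hw
      (hs.mono (by intro k; simp; tauto))
    have hwa : w a = 0 := hs a (by simp [ha, hab])
    rw [e] at hwa
    simp only [Pi.add_apply, Pi.smul_apply, smul_cc, hya, add_zero] at hwa
    have h3 : n * q + m * p = 0 := by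
      apply cc_inj
      simp only [cc, map_add, map_mul, map_zero] at *
      apply mul_right_cancel₀ hv0
      linear_combination (algebraMap A K p) * hwa - algebraMap A K n * hz'
    have hdv : p ∣ n := ⟨n * α - m * β, by linear_combination (-n) * hco + β * h3⟩
    obtain ⟨n', rfl⟩ := hdv
    refine ⟨n', ?_⟩
    rw [e]
    simp only [Pi.add_apply, Pi.smul_apply, smul_cc, hyb, hv1b, cc, map_mul]
    ring
  · exact L.add_mem (L.smul_mem _ h2.mem) (L.smul_mem _ h1.mem)
  · intro k hk
    simp only [List.mem_cons, not_or] at hk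
    simp [h2.supp k (by simp [hk]), h1.supp k (by simp [hk])]
  · have : (β • v2 + α • v1) a = (cc p)⁻¹ * v1 a := by
      simp only [Pi.add_apply, Pi.smul_apply, smul_cc]
      field_simp
      linear_combination cc β * hz' + v1 a * hcoK
    rw [this]
    exact (Lam1_cc hp).inv.mul h1.lam
  · intro w hw hs
    obtain ⟨n, m, y, hy, hys, e, hya, hyb⟩ := lead_decomp h1 h2 hb ha hw
      (hs.mono (by intro k; simp; tauto))
    refine ⟨n * q + m * p, ?_⟩
    rw [e]
    simp only [Pi.add_apply, Pi.smul_apply, smul_cc, hya, cc, map_add, map_mul] at *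
    apply mul_left_cancel₀ hp0
    linear_combination (algebraMap A K n - (algebraMap A K n * algebraMap A K q + algebraMap A K m * algebraMap A K p) * algebraMap A K β) * hz' - (algebraMap A K n * algebraMap A K q + algebraMap A K m * algebraMap A K p) * v1 a * hcoK

/-- the case where both jumps occur at the swapped positions -/
lemma swap_main (had : Adj π lam L L') (hL : Odd_ L) (hab : a ≠ b) (ha : a ∉ pre) (hb : b ∉ pre)
    (hpre : ∀ w ∈ L, supp pre w → π ∣ lam w)
    (hnot : ¬ ∀ w ∈ L, supp (b :: a :: pre) w → π ∣ lam w) :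
    ∃ v v', Jump (pre ++ a :: b :: suf) π lam L v ∧ Jump (pre ++ b :: a :: suf) π lam L v' ∧
      f2 pre a b L * f2 pre a b L' = sym (lam v) π * sym (lam v') π := by
  have hL' := had.odd hL
  have hπ := had.prime
  have hπp := had.prim
  obtain ⟨v1, h1⟩ := lead_exists hL pre a
  obtain ⟨v2, h2⟩ := lead_exists hL (a :: pre) b
  have hv1b : v1 b = 0 := h1.supp b (by simp [hb, hab.symm])
  have hv0 := h1.lam.ne_zero
  have hπ0 := cc_ne_zero hπ.ne_zero
  by_cases hl1 : π ∣ lam v1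
  · -- case A
    have hl2 : ¬ π ∣ lam v2 := by
      intro h
      apply hnot
      intro w hw hs
      obtain ⟨n, m, y, hy, hys, e, -, -⟩ := lead_decomp h1 h2 hb ha hw hs
      have := had.comb3 n m h2.mem h1.mem hy (hpre y hy hys)
      rw [← e] at this
      exact (dvd_sub_left (dvd_add (h.mul_left n) (hl1.mul_left m))).1 this
    have hzL := (hL.lam h2.mem a).div h1.lam
    obtain ⟨p, q, hp, ⟨α, β, hco⟩, hz⟩ := hzL.exists_rep
    simp only at hp hco hz
    obtain ⟨k2, k1⟩ := swap_leads h1 h2 hab hb ha hp hz hco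
    have e2 := had.comb p (-q) h2.mem h1.mem
    have e1 := had.comb β α h2.mem h1.mem
    have h1' : Lead pre a L' v1 := ⟨(had.mem _).2 ⟨h1.mem, hl1⟩, h1.supp, h1.lam,
      fun w hw hs => h1.gen w (had.le hw) hs⟩
    have h2' : Lead (a :: pre) b L' (π • v2) := by
      refine ⟨had.pi_smul_mem h2.mem, h2.supp.smul π, ?_, ?_⟩
      · simp only [Pi.smul_apply, smul_cc]; exact (Lam1_cc hπp).mul h2.lam
      · intro w hw hs
        obtain ⟨n, m, y, hy, hys, e, hya, hyb⟩ := lead_decomp h1 h2 hb ha (had.le hw) hs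
        have := had.comb3 n m h2.mem h1.mem hy (hpre y hy hys)
        rw [← e] at this
        have h3 := (dvd_sub_right ((had.mem _).1 hw).2).1 this
        have h4 := (dvd_add_left (hl1.mul_left m)).1 h3
        obtain ⟨n', rfl⟩ := (hπ.dvd_or_dvd h4).resolve_right hl2
        refine ⟨n', ?_⟩
        rw [e]
        simp only [Pi.add_apply, Pi.smul_apply, smul_cc, hyb, hv1b, cc, map_mul]
        ring
    have hJ : f2 pre a b L = sym q p := by
      rw [f2_eq hL h1 h2, JJ_eq ⟨hp, ⟨α, β, hco⟩, hz⟩]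
    have hf' : f2 pre a b L' = JJ (cc π * (v2 a / v1 a)) := by
      rw [f2_eq hL' h1' h2']; simp only [Pi.smul_apply, smul_cc, mul_div_assoc]
    have hqp : IsCoprime q p := ⟨β, α, by linear_combination hco⟩
    by_cases hpp : π ∣ p
    · obtain ⟨r, rfl⟩ := hpp
      have hr : prim r := prim.of_mul hπp hp
      have hw2 : π ∣ lam (((π * r) • v2) + (-q) • v1) := by
        refine (dvd_sub_left ?_).1 e2
        exact dvd_add ⟨r * lam v2, by ring⟩ (hl1.mul_left _)
      have hβ : ¬ π ∣ β := fun ⟨t, ht⟩ => hπ.not_isUnit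
        (IsUnit.of_mul_eq_one (α * r + t * q) (by rw [← hco, ht]; ring))
      have hw1d : π ∣ lam (β • v2 + α • v1) - β * lam v2 := by
        have := dvd_add e1 (hl1.mul_left α)
        convert this using 1; ring
      have hw1 : ¬ π ∣ lam (β • v2 + α • v1) := by
        intro h
        exact (hπ.dvd_or_dvd ((dvd_sub_right h).1 hw1d)).elim hβ hl2
      refine ⟨v2, _, jump_second had h1 h2 hpre hl1 hl2,
        jump_second had k2 k1 hpre hw2 hw1, ?_⟩
      have hJ' : f2 pre a b L' = sym q r := by
        rw [hf']
        apply JJ_eq (q := q) (p := r)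
        refine ⟨hr, ⟨α * π, β, by linear_combination hco⟩, ?_⟩
        rw [← hz]; simp only [cc, map_mul]; ring
      rw [hJ, hJ', sym_congr hπp hw1d, sym_mul _ _ hπp, sym_mul_right _ hπ.ne_zero hr.ne_zero]
      have s1 := sym_sq hr (a := q) ⟨β, α * π, by linear_combination hco⟩
      have s2 := sym_sq' hπ hπp hl2
      have s3 := sym_sq' hπ hπp hβ
      have s4 : sym β π * sym q π = 1 := by
        rw [← sym_mul _ _ hπp]
        refine Eq.trans ?_ (sym_one_left hπp)
        exact sym_congr hπp ⟨-(α * r), by linear_combination hco⟩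
      linear_combination (sym q π) * s1 - (sym β π) * s2 + sym β π * s4 - sym q π * s3
    · have hcop : IsCoprime π p := (hπ.irreducible.coprime_iff_not_dvd).2 hpp
      have hw2d : π ∣ lam (p • v2 + (-q) • v1) - p * lam v2 := by
        have := dvd_add e2 (hl1.mul_left (-q))
        convert this using 1; ring
      have hw2 : ¬ π ∣ lam (p • v2 + (-q) • v1) := by
        intro h
        exact (hπ.dvd_or_dvd ((dvd_sub_right h).1 hw2d)).elim hpp hl2
      refine ⟨v2, _, jump_second had h1 h2 hpre hl1 hl2, jump_first k2 hpre hw2, ?_⟩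
      have hJ' : f2 pre a b L' = sym (π * q) p := by
        rw [hf']
        apply JJ_eq (q := π * q) (p := p)
        refine ⟨hp, (hcop.mul_left hqp).symm, ?_⟩
        simp only [cc, map_mul] at *
        rw [← hz]; ring
      rw [hJ, hJ', sym_congr hπp hw2d, sym_mul _ _ hπp, sym_mul _ _ hp, sym_qr hπp hp hcop]
      have s1 := sym_sq hp hqp
      have s2 := sym_sq' hπ hπp hl2
      linear_combination (sym p π) * s1 - (sym p π) * s2
  · -- case B
    obtain ⟨s, hs⟩ := Adj.solve hπ hl1 (lam v2)
    -- replace v2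
    obtain ⟨v2', rfl⟩ : ∃ v2', v2 = v2' + s • v1 := ⟨v2 - s • v1, by abel⟩
    have h2' : Lead (a :: pre) b L v2' := by
      have e : v2' = (v2' + s • v1) - s • v1 := by abel
      have eb : v2' b = (v2' + s • v1) b := by simp [hv1b]
      refine ⟨?_, ?_, ?_, ?_⟩
      · rw [e]; exact L.sub_mem h2.mem (L.smul_mem s h1.mem)
      · rw [e]; exact h2.supp.sub ((h1.supp.mono (by intro k; simp; tauto)).smul s)
      · rw [eb]; exact h2.lam
      · rw [eb]; exact h2.gen
    have hl2 : π ∣ lam v2' := by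
      have := had.comb 1 s h2'.mem h1.mem
      rw [one_smul] at this
      have h3 := dvd_sub hs this
      convert h3 using 1; ring
    clear h2 hs
    rename' v2' => v2, h2' => h2
    have hzL := (hL.lam h2.mem a).div h1.lam
    obtain ⟨p, q, hp, ⟨α, β, hco⟩, hz⟩ := hzL.exists_rep
    simp only at hp hco hz
    obtain ⟨k2, k1⟩ := swap_leads h1 h2 hab hb ha hp hz hco
    have e2 := had.comb p (-q) h2.mem h1.mem
    have e1 := had.comb β α h2.mem h1.mem
    have h2' : Lead (a :: pre) b L' v2 := ⟨(had.mem _).2 ⟨h2.mem, hl2⟩, h2.supp, h2.lam,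
      fun w hw hs => h2.gen w (had.le hw) hs⟩
    have h1' : Lead pre a L' (π • v1) := by
      refine ⟨had.pi_smul_mem h1.mem, h1.supp.smul π, ?_, ?_⟩
      · simp only [Pi.smul_apply, smul_cc]; exact (Lam1_cc hπp).mul h1.lam
      · intro w hw hs
        obtain ⟨n, x, hx, hxs, hxa, e, -⟩ := lead_diff h1 (had.le hw) hs
        have := had.comb2 n h1.mem hx (hpre x hx hxs)
        rw [← e] at this
        have h3 := (dvd_sub_right ((had.mem _).1 hw).2).1 this
        obtain ⟨n', rfl⟩ := (hπ.dvd_or_dvd h3).resolve_right hl1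
        refine ⟨n', ?_⟩
        rw [e]
        simp only [Pi.add_apply, Pi.smul_apply, smul_cc, hxa, cc, map_mul]
        ring
    have hJ : f2 pre a b L = sym q p := by
      rw [f2_eq hL h1 h2, JJ_eq ⟨hp, ⟨α, β, hco⟩, hz⟩]
    have hf' : f2 pre a b L' = JJ (v2 a / (cc π * v1 a)) := by
      rw [f2_eq hL' h1' h2']; simp only [Pi.smul_apply, smul_cc]
    have hqp : IsCoprime q p := ⟨β, α, by linear_combination hco⟩
    have hw2d : π ∣ lam (p • v2 + (-q) • v1) - (-q) * lam v1 := by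
      have := dvd_add e2 (hl2.mul_left p)
      convert this using 1; ring
    have hw1d : π ∣ lam (β • v2 + α • v1) - α * lam v1 := by
      have := dvd_add e1 (hl2.mul_left β)
      convert this using 1; ring
    by_cases hpq : π ∣ q
    · obtain ⟨r, rfl⟩ := hpq
      have hw2 : π ∣ lam (p • v2 + (-(π * r)) • v1) := by
        refine (dvd_sub_left ?_).1 hw2d
        exact ⟨-r * lam v1, by ring⟩
      have hα : ¬ π ∣ α := fun ⟨t, ht⟩ => hπ.not_isUnit
        (IsUnit.of_mul_eq_one (t * p + β * r) (by rw [← hco, ht]; ring))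
      have hw1 : ¬ π ∣ lam (β • v2 + α • v1) := by
        intro h
        exact (hπ.dvd_or_dvd ((dvd_sub_right h).1 hw1d)).elim hα hl1
      refine ⟨v1, _, jump_first h1 hpre hl1, jump_second had k2 k1 hpre hw2 hw1, ?_⟩
      have hrp : IsCoprime r p := ⟨β * π, α, by linear_combination hco⟩
      have hcop : IsCoprime π p := ⟨β * r, α, by linear_combination hco⟩
      have hJ' : f2 pre a b L' = sym r p := by
        rw [hf']
        apply JJ_eq (q := r) (p := p)
        refine ⟨hp, hrp.symm, ?_⟩
        apply mul_left_cancel₀ hπ0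
        simp only [cc, map_mul] at *
        rw [← hz]; field_simp
      rw [hJ, hJ', sym_congr hπp hw1d, sym_mul _ _ hπp, sym_mul _ _ hp, sym_qr hπp hp hcop]
      have s1 := sym_sq hp hrp
      have s2 := sym_sq' hπ hπp hl1
      have s3 := sym_sq' hπ hπp hα
      have s4 : sym α π * sym p π = 1 := by
        rw [← sym_mul _ _ hπp]
        refine Eq.trans ?_ (sym_one_left hπp)
        exact sym_congr hπp ⟨-(β * r), by linear_combination hco⟩
      linear_combination (sym p π) * s1 - (sym α π) * s2 + sym α π * s4 - sym p π * s3
    · have hcop : IsCoprime π q := (hπ.irreducible.coprime_iff_not_dvd).2 hpq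
      have hw2 : ¬ π ∣ lam (p • v2 + (-q) • v1) := by
        intro h
        exact (hπ.dvd_or_dvd ((dvd_sub_right h).1 hw2d)).elim (by simpa using hpq) hl1
      refine ⟨v1, _, jump_first h1 hpre hl1, jump_first k2 hpre hw2, ?_⟩
      have hJ' : f2 pre a b L' = sym q (p * π) := by
        rw [hf']
        apply JJ_eq (q := q) (p := p * π)
        refine ⟨hp.mul hπp, (hqp.symm.mul_left hcop), ?_⟩
        simp only [cc, map_mul] at *
        rw [← hz]; field_simp
      rw [hJ, hJ', sym_congr hπp hw2d, sym_mul _ _ hπp, sym_neg _ hπp,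
        sym_mul_right _ hp.ne_zero hπ.ne_zero]
      have s1 := sym_sq hp hqp
      have s2 := sym_sq' hπ hπp hl1
      linear_combination (sym q π) * s1 - (sym q π) * s2

lemma swap_adj (hab : a ≠ b) (ha : a ∉ pre) (hb : b ∉ pre) :
    AdjProp (f2 pre a b) (pre ++ a :: b :: suf) (pre ++ b :: a :: suf) := by
  intro π lam L L' had hL v v' hv hv'
  have hL' := had.odd hL
  have hπ := had.prime
  have hπp := had.prim
  suffices H : ∃ v v', Jump (pre ++ a :: b :: suf) π lam L v ∧
      Jump (pre ++ b :: a :: suf) π lam L v' ∧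
      f2 pre a b L * f2 pre a b L' = sym (lam v) π * sym (lam v') π by
    obtain ⟨w, w', hw, hw', e⟩ := H
    rw [e, jump_unique had hv hw, jump_unique had hv' hw']
  rcases jump_or had hL pre with hpre | ⟨w, hw⟩
  · by_cases hnot : ∀ w ∈ L, supp (b :: a :: pre) w → π ∣ lam w
    · -- jump after the block
      obtain ⟨l1, j, l2, e, hl, hnd, hall⟩ := hv
      have hpp : (pre ++ [a, b]) <+: l1 := by
        by_contra hc
        have h1 : (pre ++ [a, b]) <+: (l1 ++ j :: l2) := by
          rw [← e]; exact ⟨suf, by simp⟩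
        have h2 : (l1 ++ [j]) <+: (l1 ++ j :: l2) := ⟨l2, by simp⟩
        rcases List.prefix_or_prefix_of_prefix h1 h2 with h3 | h3
        · rcases List.prefix_concat_iff.1 h3 with h4 | h4
          · apply hnd
            apply hnot _ hl.mem
            apply hl.supp.mono
            intro k hk
            have : k ∈ pre ++ [a, b] := by rw [h4]; simpa [or_comm] using hk
            simp at this ⊢; tauto
          · exact hc h4
        · apply hnd
          apply hnot _ hl.mem
          apply hl.supp.mono
          intro k hk
          have : k ∈ pre ++ [a, b] := h3.subset (by simpa [or_comm] using hk)
          simp at this ⊢; tauto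
      obtain ⟨t, rfl⟩ := hpp
      have hmem : ∀ k, k ∈ pre ++ [a, b] ++ t ↔ k ∈ pre ++ [b, a] ++ t := by
        intro k; simp; tauto
      have hsuf : suf = t ++ j :: l2 := by simpa using e
      refine ⟨v, v, ⟨_, j, l2, e, hl, hnd, hall⟩, ⟨pre ++ [b, a] ++ t, j, l2, by simp [hsuf], hl.congr hmem, hnd,
        fun w hw hs => hall w hw (hs.mono fun k hk => (hmem k).2 hk)⟩, ?_⟩
      rw [sym_sq' hπ hπp hnd]
      obtain ⟨v1, h1⟩ := lead_exists hL pre a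
      obtain ⟨v2, h2⟩ := lead_exists hL (a :: pre) b
      have h1' : Lead pre a L' v1 := ⟨(had.mem _).2 ⟨h1.mem, hnot _ h1.mem (h1.supp.mono (by
        intro k; simp; tauto))⟩, h1.supp, h1.lam, fun w hw hs => h1.gen w (had.le hw) hs⟩
      have h2' : Lead (a :: pre) b L' v2 := ⟨(had.mem _).2 ⟨h2.mem, hnot _ h2.mem h2.supp⟩,
        h2.supp, h2.lam, fun w hw hs => h2.gen w (had.le hw) hs⟩
      rw [f2_eq hL' h1' h2', ← f2_eq hL h1 h2, f2_mul_self]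
    · exact swap_main had hL hab ha hb hpre hnot
  · refine ⟨w, w, hw.append _, hw.append _, ?_⟩
    obtain ⟨l1, j, l2, e, hl, hnd, hall⟩ := hw
    have hws : supp pre w := hl.supp.mono (by intro k hk; rw [e]; simp at hk ⊢; tauto)
    rw [sym_sq' hπ hπp hnd]
    obtain ⟨v1, h1⟩ := lead_exists hL pre a
    obtain ⟨v2, h2⟩ := lead_exists hL (a :: pre) b
    obtain ⟨n1, hn1⟩ := Adj.solve hπ hnd (lam v1)
    obtain ⟨n2, hn2⟩ := Adj.solve hπ hnd (lam v2)
    have hwa := hws a ha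
    have hwb := hws b hb
    have key : ∀ {v : ι → K} {n : A}, v ∈ L → π ∣ lam v - n * lam w → (v + (-n) • w) ∈ L' := by
      intro v n hv hd
      refine (had.mem _).2 ⟨L.add_mem hv (L.smul_mem _ hl.mem), ?_⟩
      have := had.comb 1 (-n) hv hl.mem
      rw [one_smul] at this
      have := dvd_add this hd
      convert this using 1; ring
    have h1' : Lead pre a L' (v1 + (-n1) • w) := by
      have ea : (v1 + (-n1) • w) a = v1 a := by simp [hwa]
      refine ⟨key h1.mem hn1, h1.supp.add ((hws.mono (by intro k; simp; tauto)).smul _),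
        ea ▸ h1.lam, fun w hw hs => ea ▸ h1.gen w (had.le hw) hs⟩
    have h2' : Lead (a :: pre) b L' (v2 + (-n2) • w) := by
      have ea : (v2 + (-n2) • w) b = v2 b := by simp [hwb]
      refine ⟨key h2.mem hn2, h2.supp.add ((hws.mono (by intro k; simp; tauto)).smul _),
        ea ▸ h2.lam, fun w hw hs => ea ▸ h2.gen w (had.le hw) hs⟩
    rw [f2_eq hL' h1' h2']
    have e1 : (v1 + (-n1) • w) a = v1 a := by simp [hwa]
    have e2 : (v2 + (-n2) • w) a = v2 a := by simp [hwa]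
    rw [e1, e2, ← f2_eq hL h1 h2, f2_mul_self]

end swap

end SKN

set_option linter.unusedSectionVars false

namespace SKN

variable {ι : Type*} [Fintype ι] [DecidableEq ι]

noncomputable def Fmv : List ι → ι → List ι → Submodule A (ι → K) → ℤ
  | _, _, [], _ => 1
  | pre, a, b :: l, L => f2 pre a b L * Fmv (pre ++ [b]) a l L

noncomputable def Frev : List ι → Submodule A (ι → K) → ℤ
  | [], _ => 1
  | a :: l, L => Fmv [] a l L * Frev l L

lemma Fmv_sq (l : List ι) : ∀ (pre : List ι) (a : ι) (L : Submodule A (ι → K)),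
    Fmv pre a l L * Fmv pre a l L = 1 := by
  induction l with
  | nil => intro pre a L; simp [Fmv]
  | cons b l ih =>
    intro pre a L
    have h1 := f2_mul_self pre a b L
    have h2 := ih (pre ++ [b]) a L
    simp only [Fmv]
    linear_combination h2 + (Fmv (pre ++ [b]) a l L) ^ 2 * h1

lemma Frev_sq (l : List ι) (L : Submodule A (ι → K)) : Frev l L * Frev l L = 1 := by
  induction l with
  | nil => simp [Frev]
  | cons b l ih =>
    have h1 := Fmv_sq l [] b L
    simp only [Frev]
    linear_combination ih + (Frev l L) ^ 2 * h1

lemma AdjProp.one (l : List ι) : AdjProp (fun _ => 1) l l := by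
  intro π lam L L' had hL v v' hv hv'
  rw [jump_unique had hv' hv]
  obtain ⟨_, _, _, _, _, h, _⟩ := hv
  rw [sym_sq' had.prime had.prim h]; rfl

lemma Fmv_adj (a : ι) (suf : List ι) (l : List ι) : ∀ (pre : List ι),
    a ∉ pre → a ∉ l → (∀ b ∈ l, b ∉ pre) → l.Nodup → (∀ k, k ∈ pre ++ a :: (l ++ suf)) →
    AdjProp (Fmv pre a l) (pre ++ a :: (l ++ suf)) (pre ++ (l ++ a :: suf)) := by
  induction l with
  | nil => intro pre _ _ _ _ _; exact AdjProp.one _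
  | cons b l ih =>
    intro pre h1 h2 h3 h4 h5
    have hab : a ≠ b := fun h => h2 (by simp [h])
    have hb : b ∉ pre := h3 b (by simp)
    simp only [List.mem_cons, not_or] at h2
    have s1 : AdjProp (f2 pre a b) (pre ++ a :: b :: (l ++ suf)) (pre ++ b :: a :: (l ++ suf)) :=
      swap_adj hab h1 hb
    have s2 := ih (pre ++ [b]) (by simp [h1, hab]) h2.2 (by
      intro c hc; have := h3 c (by simp [hc])
      have : c ≠ b := fun h => (List.nodup_cons.1 h4).1 (h ▸ hc)
      simp_all) (List.nodup_cons.1 h4).2 (by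
      intro k; have := h5 k; simp at this ⊢; tauto)
    simp only [List.append_assoc, List.singleton_append] at s2
    exact AdjProp.trans (by intro k; have := h5 k; simp at this ⊢; tauto) s1 s2

lemma Frev_adj (l : List ι) : ∀ (suf : List ι), l.Nodup → (∀ k, k ∈ l ++ suf) →
    AdjProp (Frev l) (l ++ suf) (l.reverse ++ suf) := by
  induction l with
  | nil => intro suf _ _; exact AdjProp.one _
  | cons a l ih =>
    intro suf h1 h2
    have s1 := Fmv_adj a suf l [] (by simp) (List.nodup_cons.1 h1).1 (by simp)
      (List.nodup_cons.1 h1).2 h2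
    have h3 : ∀ k, k ∈ l ++ a :: suf := by intro k; have := h2 k; simp at this ⊢; tauto
    have s2 := ih (a :: suf) (List.nodup_cons.1 h1).2 h3
    have e : (a :: l).reverse ++ suf = l.reverse ++ a :: suf := by simp
    rw [e]
    exact AdjProp.trans h3 s1 s2

/-! ### connectivity -/

lemma vcc_smul (n : A) (w : ι → A) : vcc (n • w) = n • vcc w := by
  ext k; simp [vcc, smul_cc]

lemma Odd_.between {L L1 L' : Submodule A (ι → K)} (hL : Odd_ L) (hL' : Odd_ L') (h : L' ≤ L1)
    (h' : L1 ≤ L) : Odd_ L1 := by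
  obtain ⟨m, hm, h1, h2⟩ := hL
  obtain ⟨m', hm', h1', h2'⟩ := hL'
  refine ⟨m * m', hm.mul hm', fun w => ?_, fun v hv => ?_⟩
  · rw [mul_smul]; exact L1.smul_mem _ (h (h1' w))
  · obtain ⟨w, hw⟩ := h2 v (h' hv)
    exact ⟨m' • w, by rw [mul_comm, mul_smul, hw, vcc_smul]⟩

lemma exists_step {L L1 : Submodule A (ι → K)} (hL : Odd_ L) (hL1 : Odd_ L1) (h : L1 < L) :
    ∃ w ∈ L, w ∉ L1 ∧ ∃ π, Prime π ∧ prim π ∧ π • w ∈ L1 := by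
  obtain ⟨w0, hw0, hn⟩ := SetLike.exists_of_lt h
  obtain ⟨m, hm, h1, h2⟩ := hL
  obtain ⟨m', hm', h1', h2'⟩ := hL1
  have key : ∀ M, prim M → ∀ w ∈ L, w ∉ L1 → M • w ∈ L1 →
      ∃ w ∈ L, w ∉ L1 ∧ ∃ π, Prime π ∧ prim π ∧ π • w ∈ L1 := by
    apply prim_induction
    · intro w _ h h'; exact absurd (by simpa using h') h
    · intro w _ h h'; exact absurd (by simpa using h') h
    · intro π p hπ hπp hp ih w hw hwn hmem
      by_cases hpw : p • w ∈ L1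
      · exact ih w hw hwn hpw
      · exact ⟨p • w, L.smul_mem _ hw, hpw, π, hπ, hπp, by rwa [← mul_smul]⟩
  refine key (m' * m) (hm'.mul hm) w0 hw0 hn ?_
  obtain ⟨w, hw⟩ := h2 w0 hw0
  rw [mul_smul, hw]; exact h1' w

lemma exists_adj {L L1 : Submodule A (ι → K)} (hL : Odd_ L) (hL1 : Odd_ L1) (h : L1 < L) :
    ∃ π lam L2, Adj π lam L2 L1 ∧ L1 < L2 ∧ L2 ≤ L := by
  obtain ⟨w, hw, hwn, π, hπ, hπp, hπw⟩ := exists_step hL hL1 h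
  let L2 := L1 ⊔ Submodule.span A {w}
  have hmem : ∀ v, v ∈ L2 ↔ ∃ n : A, v - n • w ∈ L1 := by
    intro v
    rw [Submodule.mem_sup]
    constructor
    · rintro ⟨y, hy, z, hz, rfl⟩
      obtain ⟨n, rfl⟩ := Submodule.mem_span_singleton.1 hz
      exact ⟨n, by simpa using hy⟩
    · rintro ⟨n, hn⟩
      exact ⟨_, hn, n • w, Submodule.mem_span_singleton.2 ⟨n, rfl⟩, by abel⟩
  have hdvd : ∀ c : A, c • w ∈ L1 → π ∣ c := by
    intro c hc
    by_contra hnd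
    obtain ⟨a, b, hab⟩ := (hπ.irreducible.coprime_iff_not_dvd).2 hnd
    apply hwn
    have : w = a • π • w + b • c • w := by rw [← mul_smul, ← mul_smul, ← add_smul, hab, one_smul]
    rw [this]
    exact L1.add_mem (L1.smul_mem _ hπw) (L1.smul_mem _ hc)
  have hle : L1 ≤ L2 := le_sup_left
  have hwL2 : w ∈ L2 := (hmem w).2 ⟨1, by simp⟩
  classical
  let lam : (ι → K) → A := fun v => if hv : ∃ n : A, v - n • w ∈ L1 then hv.choose else 0
  have hlam : ∀ v ∈ L2, v - lam v • w ∈ L1 := by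
    intro v hv
    have hv' := (hmem v).1 hv
    simp only [lam, dif_pos hv']
    exact hv'.choose_spec
  refine ⟨π, lam, L2, ⟨hπ, hπp, ?_, ?_, ⟨w, hwL2, ?_⟩, ?_⟩, ?_, ?_⟩
  · intro v hv v' hv'
    apply hdvd
    have := L1.sub_mem (L1.add_mem (hlam v hv) (hlam v' hv')) (hlam _ (L2.add_mem hv hv'))
    convert this using 1
    module
  · intro n v hv
    apply hdvd
    have := L1.sub_mem (L1.smul_mem n (hlam v hv)) (hlam _ (L2.smul_mem n hv))
    convert this using 1
    module
  · rintro ⟨t, ht⟩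
    apply hwn
    have := hlam w hwL2
    rw [ht] at this
    have h3 := L1.add_mem this (L1.smul_mem t hπw)
    convert h3 using 1
    module
  · intro v
    constructor
    · intro hv
      refine ⟨hle hv, hdvd _ ?_⟩
      have := L1.sub_mem hv (hlam v (hle hv))
      convert this using 1; module
    · rintro ⟨hv, t, ht⟩
      have := hlam v hv
      rw [ht] at this
      have h3 := L1.add_mem this (L1.smul_mem t hπw)
      convert h3 using 1
      module
  · exact lt_of_le_of_ne hle fun h => hwn (h ▸ hwL2)
  · refine sup_le h.le ?_
    rw [Submodule.span_singleton_le_iff_mem]; exact hw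

/-- the linear map `w ↦ m⁻¹ w` -/
noncomputable def dvm (m : A) : (ι → A) →ₗ[A] (ι → K) where
  toFun w := (cc m)⁻¹ • vcc w
  map_add' x y := by ext k; simp [vcc, cc]; ring
  map_smul' n x := by ext k; simp [vcc, smul_cc]; ring

lemma Odd_.noeth {L : Submodule A (ι → K)} (hL : Odd_ L) : IsNoetherian A L := by
  obtain ⟨m, hm, h1, h2⟩ := hL
  apply isNoetherian_of_le (t := LinearMap.range (dvm (ι := ι) m))
  intro v hv
  obtain ⟨w, hw⟩ := h2 v hv
  refine ⟨w, ?_⟩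
  have hm0 := cc_ne_zero hm.ne_zero
  ext k
  have := congrFun hw k
  simp only [Pi.smul_apply, smul_cc] at this
  simp only [dvm, LinearMap.coe_mk, AddHom.coe_mk, Pi.smul_apply, smul_eq_mul, ← this]
  field_simp

lemma conn_le {G : Submodule A (ι → K) → ℤ}
    (hG : ∀ π lam L L', Adj π lam L L' → Odd_ L → G L = G L')
    {L L' : Submodule A (ι → K)} (hL : Odd_ L) (hL' : Odd_ L') (h : L' ≤ L) : G L = G L' := by
  have hN := hL.noeth
  have hmax := set_has_maximal_iff_noetherian.2 hN
  obtain ⟨P, ⟨hP1, hP2⟩, hP⟩ := hmax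
    {P : Submodule A L | L' ≤ P.map L.subtype ∧ G (P.map L.subtype) = G L'} (by
      refine ⟨L'.comap L.subtype, ?_⟩
      have : Submodule.map L.subtype (Submodule.comap L.subtype L') = L' := by
        rw [Submodule.map_comap_subtype]; exact inf_eq_right.2 h
      simp only [Set.mem_ofPred_eq, this, le_refl, and_self])
  have hle : P.map L.subtype ≤ L := Submodule.map_subtype_le _ _
  by_cases he : P.map L.subtype = L
  · rw [← hP2, he]
  · exfalso
    have hodd := hL.between hL' hP1 hle
    obtain ⟨π, lam, L2, had, hlt, hle2⟩ := exists_adj hL hodd (lt_of_le_of_ne hle he)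
    have e : Submodule.map L.subtype (Submodule.comap L.subtype L2) = L2 := by
      rw [Submodule.map_comap_subtype]; exact inf_eq_right.2 hle2
    refine hP (L2.comap L.subtype) ⟨?_, ?_⟩ ?_
    · rw [e]; exact hP1.trans hlt.le
    · rw [e, ← hP2]
      exact hG _ _ _ _ had (hL.between hL' (hP1.trans hlt.le) hle2)
    · refine lt_of_le_of_ne (Submodule.map_le_iff_le_comap.1 hlt.le) fun h => ?_
      rw [h, e] at hlt; exact lt_irrefl _ hlt

lemma conn {G : Submodule A (ι → K) → ℤ}
    (hG : ∀ π lam L L', Adj π lam L L' → Odd_ L → G L = G L')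
    {L L' : Submodule A (ι → K)} (hL : Odd_ L) (hL' : Odd_ L') : G L = G L' := by
  obtain ⟨m, hm, h1, h2⟩ := id hL
  obtain ⟨m', hm', h1', h2'⟩ := id hL'
  let L0 : Submodule A (ι → K) := LinearMap.range (((m * m') : A) • (dvm (ι := ι) 1))
  have hL0 : ∀ w : ι → A, (m * m') • vcc w ∈ L0 := fun w => ⟨w, by
    ext k; simp [dvm, cc]⟩
  have hL0' : ∀ v ∈ L0, ∃ w, v = (m * m') • vcc w := by
    rintro v ⟨w, rfl⟩; exact ⟨w, by ext k; simp [dvm, cc]⟩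
  have ho : Odd_ L0 := ⟨m * m', hm.mul hm', hL0, fun v hv => by
    obtain ⟨w, rfl⟩ := hL0' v hv
    exact ⟨(m * m') • (m * m') • w, by rw [vcc_smul, vcc_smul]⟩⟩
  rw [conn_le hG hL ho, conn_le hG hL' ho]
  · intro v hv
    obtain ⟨w, rfl⟩ := hL0' v hv
    rw [mul_smul]; exact L'.smul_mem _ (h1' w)
  · intro v hv
    obtain ⟨w, rfl⟩ := hL0' v hv
    rw [mul_comm, mul_smul]; exact L.smul_mem _ (h1 w)

end SKN

set_option linter.unusedSectionVars false

namespace SKN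

section blk
variable {ι : Type*} [Fintype ι] [DecidableEq ι]

def Blk (t : ι → K) (i i' : ι) (q : K) (L : Submodule A (ι → K)) : Prop :=
  ∀ v, v ∈ L ↔ ∃ c : ι → A, ∀ k, v k = t k * cc (c k) + (if k = i then q * cc (c i') else 0)

variable {t : ι → K} {i i' : ι} {q : K} {L : Submodule A (ι → K)}

lemma Blk.e_mem (h : Blk t i i' q L) (k : ι) (hk : k ≠ i') (n : A) :
    Pi.single k (t k * cc n) ∈ L := by
  refine (h _).2 ⟨Pi.single k n, fun k' => ?_⟩
  have hk' : (Pi.single k n : ι → A) i' = 0 := by simp [hk.symm]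
  rw [hk']
  by_cases e : k' = k
  · subst e; simp [cc]
  · simp [e, cc]

lemma Blk.f2_main (h : Blk t i i' q L) (hL : Odd_ L) (ht : ∀ k, Lam1 (t k)) (hii : i ≠ i')
    {pre : List ι} (h1 : i ∉ pre) (h2 : i' ∉ pre) : f2 pre i i' L = JJ (q / t i) := by
  have l1 : Lead pre i L (Pi.single i (t i)) := by
    refine ⟨by simpa [cc] using h.e_mem i hii 1, fun k hk => ?_, by simpa using ht i, ?_⟩
    · have : k ≠ i := fun e => hk (by simp [e])
      simp [this]
    · intro w hw hs
      obtain ⟨c, hc⟩ := (h w).1 hw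
      have e1 := hc i'
      rw [hs i' (by simp [h2, hii.symm]), if_neg hii.symm, add_zero] at e1
      have e2 : cc (c i') = 0 := by
        rcases mul_eq_zero.1 e1.symm with h | h
        · exact absurd h (ht i').ne_zero
        · exact h
      refine ⟨c i, ?_⟩
      rw [hc i, if_pos rfl, e2]; simp [mul_comm]
  have l2 : Lead (i :: pre) i' L (Pi.single i q + Pi.single i' (t i')) := by
    refine ⟨(h _).2 ⟨Pi.single i' 1, fun k => ?_⟩, fun k hk => ?_, ?_, ?_⟩
    · by_cases e : k = i
      · subst e; simp [cc, hii]
      · by_cases e' : k = i'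
        · subst e'; simp [e, cc]
        · simp [e, e', cc]
    · simp only [List.mem_cons, not_or] at hk
      simp [hk]
    · simpa [hii.symm] using ht i'
    · intro w hw hs
      obtain ⟨c, hc⟩ := (h w).1 hw
      refine ⟨c i', ?_⟩
      rw [hc i', if_neg hii.symm]; simp [mul_comm, hii.symm]
  rw [f2_eq hL l1 l2]; simp [hii]

lemma Blk.f2_one (h : Blk t i i' q L) (hL : Odd_ L) (ht : ∀ k, Lam1 (t k)) (hii : i ≠ i')
    {pre : List ι} {a b : ι} (hab : a ≠ b) (h1 : a ∉ pre) (h2 : b ∉ pre)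
    (hn : ¬ (a = i ∧ b = i')) (hn' : a = i' → i ∉ b :: pre) : f2 pre a b L = 1 := by
  by_cases hai : a = i
  · subst hai
    have hb : b ≠ i' := fun e => hn ⟨rfl, e⟩
    obtain ⟨v1, l1⟩ := lead_exists hL pre a
    have l2 : Lead (a :: pre) b L (Pi.single b (t b)) := by
      refine ⟨by simpa [cc] using h.e_mem b hb 1, fun k hk => ?_, by simpa using ht b, ?_⟩
      · have : k ≠ b := fun e => hk (by simp [e])
        simp [this]
      · intro w hw hs
        obtain ⟨c, hc⟩ := (h w).1 hw
        refine ⟨c b, ?_⟩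
        rw [hc b, if_neg hab.symm]; simp [mul_comm]
    rw [f2_eq hL l1 l2]; simp [hab, JJ_zero]
  · obtain ⟨v1, l1⟩ := lead_exists hL pre a
    obtain ⟨v2, l2⟩ := lead_exists hL (a :: pre) b
    have key : ∃ u ∈ L, supp (a :: pre) u ∧ u a = v2 a := by
      obtain ⟨c, hc⟩ := (h v2).1 l2.mem
      by_cases hai' : a = i'
      · have hi := hn' hai'
        refine ⟨Pi.single a (v2 a), (h _).2 ⟨fun k => if k = i then c i else if k = i' then c i' else 0, fun k => ?_⟩, ?_, by simp⟩
        · have hz : v2 i = 0 := l2.supp i (by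
            simp only [List.mem_cons, not_or] at hi ⊢
            exact ⟨hi.1, fun e => hai e.symm, hi.2⟩)
          by_cases e : k = i
          · subst e
            have := hc k
            rw [hz] at this
            simp only [if_true] at this ⊢
            simp [Ne.symm hai, hii.symm, ← this]
          · by_cases e' : k = i'
            · subst e'
              subst hai'
              have := hc a
              simp [e] at this ⊢
              exact this
            · simp [e, e', hai', cc]
        · intro k hk
          have : k ≠ a := fun e => hk (by simp [e])
          simp [this]
      · refine ⟨Pi.single a (t a * cc (c a)), h.e_mem a hai' _, ?_, ?_⟩
        · intro k hk
          have : k ≠ a := fun e => hk (by simp [e])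
          simp [this]
        · rw [hc a, if_neg hai]; simp
    obtain ⟨u, hu, hs, e⟩ := key
    obtain ⟨n, hn⟩ := l1.gen u hu hs
    rw [f2_eq hL l1 l2, ← e, hn, mul_div_assoc, div_self l1.lam.ne_zero, mul_one, JJ_cc]

lemma Blk.Fmv_one (h : Blk t i i' q L) (hL : Odd_ L) (ht : ∀ k, Lam1 (t k)) (hii : i ≠ i')
    (a : ι) (l : List ι) : ∀ (pre : List ι), a ∉ pre → a ∉ l → (∀ b ∈ l, b ∉ pre) → l.Nodup →
    ¬ (a = i ∧ i' ∈ l) → (a = i' → i ∉ pre ++ l) → Fmv pre a l L = 1 := by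
  induction l with
  | nil => intro pre _ _ _ _ _ _; rfl
  | cons b l ih =>
    intro pre h1 h2 h3 h4 h5 h6
    have hab : a ≠ b := fun h => h2 (by simp [h])
    have hb : b ∉ pre := h3 b (by simp)
    simp only [List.mem_cons, not_or] at h2
    rw [Fmv, ih (pre ++ [b]), h.f2_one hL ht hii hab h1 hb]
    · norm_num
    · rintro ⟨rfl, rfl⟩; exact h5 ⟨rfl, by simp⟩
    · intro e; have := h6 e; simp at this ⊢; tauto
    · simp [h1, hab]
    · exact h2.2
    · intro c hc; have := h3 c (by simp [hc])
      have : c ≠ b := fun h => (List.nodup_cons.1 h4).1 (h ▸ hc)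
      simp_all
    · exact (List.nodup_cons.1 h4).2
    · rintro ⟨e, e'⟩; exact h5 ⟨e, by simp [e']⟩
    · intro e; have := h6 e; simp at this ⊢; tauto

lemma Blk.Fmv_main (h : Blk t i i' q L) (hL : Odd_ L) (ht : ∀ k, Lam1 (t k)) (hii : i ≠ i')
    (l : List ι) : ∀ (pre : List ι), i ∉ pre → i ∉ l → (∀ b ∈ l, b ∉ pre) → l.Nodup →
    i' ∈ l → Fmv pre i l L = JJ (q / t i) := by
  induction l with
  | nil => intro pre _ _ _ _ h; simp at h
  | cons b l ih =>
    intro pre h1 h2 h3 h4 h5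
    have hab : i ≠ b := fun h => h2 (by simp [h])
    have hb : b ∉ pre := h3 b (by simp)
    simp only [List.mem_cons, not_or] at h2
    have n1 : i ∉ pre ++ [b] := by simp [h1, hab]
    have n2 : ∀ c ∈ l, c ∉ pre ++ [b] := by
      intro c hc; have := h3 c (by simp [hc])
      have : c ≠ b := fun h => (List.nodup_cons.1 h4).1 (h ▸ hc)
      simp_all
    by_cases e : b = i'
    · subst e
      rw [Fmv, h.Fmv_one hL ht hii i l _ n1 h2.2 n2 (List.nodup_cons.1 h4).2
        (fun e => (List.nodup_cons.1 h4).1 e.2) (fun e => absurd e hii), mul_one,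
        h.f2_main hL ht hii h1 hb]
    · rw [Fmv, ih _ n1 h2.2 n2 (List.nodup_cons.1 h4).2 (by
        simp only [List.mem_cons] at h5; exact h5.resolve_left (fun h => e h.symm)),
        h.f2_one hL ht hii hab h1 hb (fun h => e h.2) (fun h => absurd h hii), one_mul]

end blk

section fin
variable {N : ℕ} {t : Fin N → K} {i i' : Fin N} {q : K} {L : Submodule A (Fin N → K)}

lemma Blk.Frev_eq (h : Blk t i i' q L) (hL : Odd_ L) (ht : ∀ k, Lam1 (t k)) (hii : i < i')
    (l : List (Fin N)) (hs : l.Pairwise (· < ·)) :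
    Frev l L = if i ∈ l ∧ i' ∈ l then JJ (q / t i) else 1 := by
  induction l with
  | nil => simp [Frev]
  | cons a l ih =>
    obtain ⟨ha, hs'⟩ := List.pairwise_cons.1 hs
    have hal : a ∉ l := fun h => lt_irrefl _ (ha a h)
    have hnd : l.Nodup := hs'.imp ne_of_lt
    rw [Frev, ih hs']
    by_cases hm : a = i ∧ i' ∈ l
    · obtain ⟨rfl, hm⟩ := hm
      rw [h.Fmv_main hL ht hii.ne l [] (by simp) hal (by simp) hnd hm]
      simp [hal, hm]
    · rw [h.Fmv_one hL ht hii.ne a l [] (by simp) hal (by simp) hnd hm]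
      · rw [one_mul]
        congr 1
        simp only [List.mem_cons, eq_iff_iff]
        constructor
        · tauto
        · rintro ⟨h1 | h1, h2 | h2⟩
          · rw [h1, h2] at hii; exact absurd hii (lt_irrefl _)
          · exact absurd ⟨h1.symm, h2⟩ hm
          · have := ha i h1; rw [← h2] at this; exact absurd (this.trans hii) (lt_irrefl _)
          · exact ⟨h1, h2⟩
      · rintro rfl hmem
        exact absurd ((ha i (by simpa using hmem)).trans hii) (lt_irrefl _)

noncomputable def ff (L : Submodule A (Fin N → K)) : ℤ := Frev (List.finRange N) L

lemma ff_sq (L : Submodule A (Fin N → K)) : ff L * ff L = 1 := Frev_sq _ _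

lemma ff_adj : AdjProp (ff (N := N)) (List.finRange N) (List.finRange N).reverse := by
  have := Frev_adj (List.finRange N) [] (List.nodup_finRange N) (by simp)
  simp only [List.append_nil] at this
  exact this

lemma Blk.ff_eq (h : Blk t i i' q L) (hL : Odd_ L) (ht : ∀ k, Lam1 (t k)) (hii : i < i') :
    ff L = JJ (q / t i) := by
  rw [ff, h.Frev_eq hL ht hii _ (List.sortedLT_finRange N).pairwise]
  simp

end fin

end SKN

set_option linter.unusedSectionVars false

namespace SKN

def Lam4 (z : K) : Prop := ∃ c, Lam c ∧ z = 4 * c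

lemma Lam_four : Lam (4 : K) := by
  have := Lam_cc 4; rwa [cc, map_ofNat] at this
lemma Lam4.lam {z : K} (h : Lam4 z) : Lam z := by
  obtain ⟨c, hc, rfl⟩ := h; exact Lam_four.mul hc
lemma Lam4_zero : Lam4 0 := ⟨0, Lam_zero, by simp⟩
lemma Lam4.add {x y : K} (hx : Lam4 x) (hy : Lam4 y) : Lam4 (x + y) := by
  obtain ⟨c, hc, rfl⟩ := hx; obtain ⟨d, hd, rfl⟩ := hy
  exact ⟨c + d, hc.add hd, by ring⟩
lemma Lam4.neg {x : K} (hx : Lam4 x) : Lam4 (-x) := by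
  obtain ⟨c, hc, rfl⟩ := hx
  exact ⟨-c, hc.neg, by ring⟩
lemma Lam4.mul {x y : K} (hx : Lam4 x) (hy : Lam y) : Lam4 (x * y) := by
  obtain ⟨c, hc, rfl⟩ := hx
  exact ⟨c * y, hc.mul hy, by ring⟩
lemma Lam4.mul' {x y : K} (hx : Lam x) (hy : Lam4 y) : Lam4 (x * y) := by
  rw [mul_comm]; exact hy.mul hx
lemma Lam4.sum {α : Type*} (s : Finset α) (f : α → K) (h : ∀ a ∈ s, Lam4 (f a)) :
    Lam4 (∑ a ∈ s, f a) := by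
  classical
  induction s using Finset.induction_on with
  | empty => simpa using Lam4_zero
  | insert a s ha ih =>
    rw [Finset.sum_insert ha]
    exact (h a (by simp)).add (ih fun b hb => h b (by simp [hb]))
lemma Lam1.add4 {x y : K} (hx : Lam1 x) (hy : Lam4 y) : Lam1 (x + y) := by
  obtain ⟨c, hc, rfl⟩ := hy; exact hx.add_four hc

lemma exists_denom {α : Type*} [Finite α] (z : α → K) (h : ∀ a, Lam (z a)) :
    ∃ D, prim D ∧ ∀ a, ∃ c, cc D * z a = cc c := by
  classical
  have := Fintype.ofFinite α
  have key : ∀ s : Finset α, ∃ D, prim D ∧ ∀ a ∈ s, ∃ c, cc D * z a = cc c := by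
    intro s
    induction s using Finset.induction_on with
    | empty => exact ⟨1, prim_one, by simp⟩
    | insert a s ha ih =>
      obtain ⟨D, hD, hs⟩ := ih
      obtain ⟨p, q, hp, e⟩ := h a
      refine ⟨D * p, hD.mul hp, fun b hb => ?_⟩
      rcases Finset.mem_insert.1 hb with rfl | hb
      · exact ⟨D * q, by simp only [cc, map_mul] at *; rw [mul_assoc, e]⟩
      · obtain ⟨c, hc⟩ := hs b hb
        exact ⟨p * c, by simp only [cc, map_mul] at *; rw [← hc]; ring⟩
  obtain ⟨D, hD, h⟩ := key Finset.univ
  exact ⟨D, hD, fun a => h a (by simp)⟩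

section act
variable {N : ℕ}

abbrev MK (N : ℕ) := Matrix (Fin N) (Fin N) K

noncomputable def act (g : MK N) (L : Submodule A (Fin N → K)) : Submodule A (Fin N → K) :=
  L.map ((Matrix.mulVecLin g).restrictScalars A)

lemma mem_act {g : MK N} {L : Submodule A (Fin N → K)} {v : Fin N → K} :
    v ∈ act g L ↔ ∃ x ∈ L, g.mulVec x = v := by
  simp [act, Submodule.mem_map]

lemma act_mul (g h : MK N) (L : Submodule A (Fin N → K)) : act (g * h) L = act g (act h L) := by
  ext v
  simp only [mem_act]
  constructor
  · rintro ⟨x, hx, rfl⟩; exact ⟨_, ⟨x, hx, rfl⟩, by simp⟩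
  · rintro ⟨_, ⟨x, hx, rfl⟩, rfl⟩; exact ⟨x, hx, by simp⟩

lemma act_one (L : Submodule A (Fin N → K)) : act (1 : MK N) L = L := by
  ext v; simp [mem_act]

def LamM (g : MK N) : Prop := ∀ i j, Lam (g i j)

lemma LamM.mul {g h : MK N} (hg : LamM g) (hh : LamM h) : LamM (g * h) := fun i j => by
  rw [Matrix.mul_apply]; exact Lam.sum fun k _ => (hg i k).mul (hh k j)

lemma mulVec_vcc (D : A) {g : MK N} {c : Matrix (Fin N) (Fin N) A}
    (h : ∀ i j, cc D * g i j = cc (c i j)) (w : Fin N → A) :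
    D • g.mulVec (vcc w) = vcc (c.mulVec w) := by
  ext k
  simp only [Pi.smul_apply, smul_cc, Matrix.mulVec, dotProduct, vcc, Finset.mul_sum]
  simp only [cc, map_sum, map_mul] at *
  refine Finset.sum_congr rfl fun j _ => ?_
  rw [← mul_assoc, h]

lemma Odd_.act {g : (MK N)ˣ} (hg : LamM g.1) (hg' : LamM g⁻¹.1) {L : Submodule A (Fin N → K)}
    (hL : Odd_ L) : Odd_ (act g.1 L) := by
  obtain ⟨m, hm, h1, h2⟩ := hL
  obtain ⟨D, hD, hc⟩ := exists_denom (fun p : Fin N × Fin N => g.1 p.1 p.2) (fun p => hg _ _)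
  obtain ⟨D', hD', hc'⟩ := exists_denom (fun p : Fin N × Fin N => g⁻¹.1 p.1 p.2) (fun p => hg' _ _)
  choose c hc using hc
  choose c' hc' using hc'
  have e := mulVec_vcc D (g := g.1) (c := fun i j => c (i, j)) (fun i j => hc (i, j))
  have e' := mulVec_vcc D' (g := g⁻¹.1) (c := fun i j => c' (i, j)) (fun i j => hc' (i, j))
  refine ⟨m * D * D', (hm.mul hD).mul hD', fun w => ?_, fun v hv => ?_⟩
  · refine mem_act.2 ⟨(m * D * D') • g⁻¹.1.mulVec (vcc w), ?_, ?_⟩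
    · rw [mul_smul, e', mul_comm, mul_smul]
      exact L.smul_mem _ (h1 _)
    · rw [Matrix.mulVec_smul, Matrix.mulVec_mulVec, ← Units.val_mul]; simp
  · obtain ⟨x, hx, rfl⟩ := mem_act.1 hv
    obtain ⟨w, hw⟩ := h2 x hx
    refine ⟨D' • (Matrix.mulVec (fun i j => c (i, j)) w), ?_⟩
    rw [vcc_smul, ← e, ← hw, Matrix.mulVec_smul, ← mul_smul, ← mul_smul]
    congr 1; ring

lemma Adj.act {π : A} {lam : (Fin N → K) → A} {L L' : Submodule A (Fin N → K)}
    (h : Adj π lam L L') (g : (MK N)ˣ) :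
    Adj π (fun v => lam (g⁻¹.1.mulVec v)) (act g.1 L) (SKN.act g.1 L') := by
  have key : ∀ x, g⁻¹.1.mulVec (g.1.mulVec x) = x := by
    intro x; rw [Matrix.mulVec_mulVec, ← Units.val_mul]; simp
  have key' : ∀ x, g.1.mulVec (g⁻¹.1.mulVec x) = x := by
    intro x; rw [Matrix.mulVec_mulVec, ← Units.val_mul]; simp
  have hm : ∀ L : Submodule A (Fin N → K), ∀ v, v ∈ SKN.act g.1 L ↔ g⁻¹.1.mulVec v ∈ L := by
    intro L v
    rw [mem_act]
    constructor
    · rintro ⟨x, hx, rfl⟩; rwa [key]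
    · intro h; exact ⟨_, h, key' v⟩
  refine ⟨h.prime, h.prim, ?_, ?_, ?_, ?_⟩
  · intro v hv w hw
    rw [Matrix.mulVec_add]
    exact h.add _ ((hm L v).1 hv) _ ((hm L w).1 hw)
  · intro n v hv
    rw [Matrix.mulVec_smul]
    exact h.smul n _ ((hm L v).1 hv)
  · obtain ⟨v, hv, hn⟩ := h.nz
    exact ⟨g.1.mulVec v, mem_act.2 ⟨v, hv, rfl⟩, by rwa [key]⟩
  · intro v
    rw [hm, hm, h.mem]

lemma Jump.act (r : Fin N → Fin N → Prop) [IsTrans (Fin N) r] [Std.Irrefl r] {l : List (Fin N)}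
    (hr : l.Pairwise r) (hl : ∀ k, k ∈ l) {g : (MK N)ˣ}
    (h1 : ∀ k k', g.1 k k' ≠ 0 → k = k' ∨ r k k') (h2 : ∀ k k', g⁻¹.1 k k' ≠ 0 → k = k' ∨ r k k')
    (h3 : ∀ k, Lam1 (g.1 k k)) {π : A} {lam : (Fin N → K) → A} {L : Submodule A (Fin N → K)}
    {v : Fin N → K} (hv : Jump l π lam L v) :
    Jump l π (fun v => lam (g⁻¹.1.mulVec v)) (act g.1 L) (g.1.mulVec v) := by
  have key : ∀ x, g⁻¹.1.mulVec (g.1.mulVec x) = x := by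
    intro x; rw [Matrix.mulVec_mulVec, ← Units.val_mul]; simp
  obtain ⟨l1, j, l2, e, hlead, hnd, hall⟩ := hv
  rw [e] at hr
  have hl1 : ∀ k, k ∈ l1 ↔ r k j := by
    intro k
    have hk := hl k
    rw [List.pairwise_append] at hr
    obtain ⟨_, p2, p3⟩ := hr
    rw [List.pairwise_cons] at p2
    constructor
    · intro h; exact p3 k h j (by simp)
    · intro h
      rw [e] at hk
      simp only [List.mem_append, List.mem_cons] at hk
      rcases hk with hk | rfl | hk
      · exact hk
      · exact absurd h (irrefl_of r k)
      · exact absurd (_root_.trans h (p2.1 k hk)) (irrefl_of r k)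
  have sup1 : ∀ G : MK N, (∀ k k', G k k' ≠ 0 → k = k' ∨ r k k') → ∀ x, supp l1 x →
      supp l1 (G.mulVec x) := by
    intro G hG x hx k hk
    rw [Matrix.mulVec, dotProduct]
    refine Finset.sum_eq_zero fun k' _ => ?_
    by_contra hne
    have h5 : k' ∈ l1 := by
      by_contra hn; rw [hx k' hn] at hne; simp at hne
    rcases hG k k' (left_ne_zero_of_mul hne) with rfl | h6
    · exact hk h5
    · exact hk ((hl1 k).2 (_root_.trans h6 ((hl1 k').1 h5)))
  have sup2 : ∀ G : MK N, (∀ k k', G k k' ≠ 0 → k = k' ∨ r k k') → ∀ x, supp (j :: l1) x →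
      supp (j :: l1) (G.mulVec x) := by
    intro G hG x hx k hk
    rw [Matrix.mulVec, dotProduct]
    refine Finset.sum_eq_zero fun k' _ => ?_
    by_contra hne
    have h5 : k' ∈ j :: l1 := by
      by_contra hn; rw [hx k' hn] at hne; simp at hne
    rcases hG k k' (left_ne_zero_of_mul hne) with rfl | h6
    · exact hk h5
    · apply hk
      simp only [List.mem_cons, hl1] at h5 ⊢
      rcases h5 with rfl | h5
      · exact Or.inr h6
      · exact Or.inr (_root_.trans h6 h5)
  have hj : ∀ x, supp (j :: l1) x → (g.1.mulVec x) j = g.1 j j * x j := by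
    intro x hx
    rw [Matrix.mulVec, dotProduct]
    apply Finset.sum_eq_single j
    · intro k _ hkj
      by_contra hne
      have h5 : k ∈ j :: l1 := by
        by_contra hn; rw [hx k hn] at hne; simp at hne
      simp only [List.mem_cons, hl1] at h5
      rcases h1 j k (left_ne_zero_of_mul hne) with h6 | h6
      · exact hkj h6.symm
      · rcases h5 with h5 | h5
        · exact hkj h5
        · exact absurd (_root_.trans h5 h6) (irrefl_of r k)
    · simp
  refine ⟨l1, j, l2, e, ⟨mem_act.2 ⟨v, hlead.mem, rfl⟩, sup2 _ h1 _ hlead.supp, ?_, ?_⟩, ?_, ?_⟩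
  · rw [hj _ hlead.supp]; exact (h3 j).mul hlead.lam
  · intro w hw hs
    obtain ⟨x, hx, rfl⟩ := mem_act.1 hw
    have hxs : supp (j :: l1) x := by
      have := sup2 _ h2 _ hs; rwa [key] at this
    obtain ⟨n, hn⟩ := hlead.gen x hx hxs
    exact ⟨n, by rw [hj _ hxs, hj _ hlead.supp, hn]; ring⟩
  · simp only [key]; exact hnd
  · intro w hw hs
    obtain ⟨x, hx, rfl⟩ := mem_act.1 hw
    have := sup1 _ h2 _ hs
    rw [key] at this
    simp only [key]
    exact hall x hx this

end act

end SKN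

set_option linter.unusedSectionVars false

namespace SKN

variable {N : ℕ}

structure LP (g : MK N) : Prop where
  up : ∀ i j, i < j → g i j = 0
  dg : ∀ i, g i i = 1
  lo : ∀ i j, j < i → Lam4 (g i j)

structure UP (g : MK N) : Prop where
  lo : ∀ i j, j < i → g i j = 0
  dg : ∀ i, Lam1 (g i i)
  lam : LamM g

lemma LP.lam {g : MK N} (h : LP g) : LamM g := by
  intro i j
  rcases lt_trichotomy i j with hij | rfl | hij
  · rw [h.up i j hij]; exact Lam_zero
  · rw [h.dg]; exact Lam_one
  · exact (h.lo i j hij).lam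

lemma LP.mul {g h : MK N} (hg : LP g) (hh : LP h) : LP (g * h) := by
  refine ⟨fun i j hij => ?_, fun i => ?_, fun i j hij => ?_⟩
  · rw [Matrix.mul_apply]
    refine Finset.sum_eq_zero fun k _ => ?_
    rcases lt_or_ge i k with h1 | h1
    · rw [hg.up _ _ h1, zero_mul]
    · rw [hh.up _ _ (lt_of_le_of_lt h1 hij), mul_zero]
  · rw [Matrix.mul_apply, Finset.sum_eq_single i]
    · rw [hg.dg, hh.dg, one_mul]
    · intro k _ hk
      rcases lt_or_gt_of_ne hk with h1 | h1
      · rw [hh.up _ _ h1, mul_zero]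
      · rw [hg.up _ _ h1, zero_mul]
    · simp
  · rw [Matrix.mul_apply]
    refine Lam4.sum _ _ fun k _ => ?_
    rcases lt_trichotomy i k with h1 | rfl | h1
    · rw [hg.up _ _ h1, zero_mul]; exact Lam4_zero
    · exact Lam4.mul' (hg.lam _ _) (hh.lo _ _ hij)
    · exact (hg.lo _ _ h1).mul (hh.lam _ _)

lemma UP.mul {g h : MK N} (hg : UP g) (hh : UP h) : UP (g * h) := by
  refine ⟨fun i j hij => ?_, fun i => ?_, hg.lam.mul hh.lam⟩
  · rw [Matrix.mul_apply]
    refine Finset.sum_eq_zero fun k _ => ?_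
    rcases lt_or_ge k i with h1 | h1
    · rw [hg.lo _ _ h1, zero_mul]
    · rw [hh.lo _ _ (lt_of_lt_of_le hij h1), mul_zero]
  · rw [Matrix.mul_apply, Finset.sum_eq_single i]
    · exact (hg.dg i).mul (hh.dg i)
    · intro k _ hk
      rcases lt_or_gt_of_ne hk with h1 | h1
      · rw [hg.lo _ _ h1, zero_mul]
      · rw [hh.lo _ _ h1, mul_zero]
    · simp

lemma LP.one : LP (1 : MK N) :=
  ⟨fun i j h => Matrix.one_apply_ne h.ne, fun i => Matrix.one_apply_eq i,
    fun i j h => by rw [Matrix.one_apply_ne h.ne']; exact Lam4_zero⟩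

lemma UP.one : UP (1 : MK N) :=
  ⟨fun i j h => Matrix.one_apply_ne h.ne', fun i => by rw [Matrix.one_apply_eq]; exact Lam1_one,
    LP.one.lam⟩

def UmG (N : ℕ) : Subgroup (MK N)ˣ where
  carrier := {g | LP g.1 ∧ LP g⁻¹.1}
  mul_mem' := by
    rintro a b ⟨h1, h2⟩ ⟨h3, h4⟩
    exact ⟨h1.mul h3, by rw [mul_inv_rev]; exact h4.mul h2⟩
  one_mem' := ⟨LP.one, by simpa using LP.one⟩
  inv_mem' := by rintro a ⟨h1, h2⟩; exact ⟨h2, by simpa using h1⟩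

def BpG (N : ℕ) : Subgroup (MK N)ˣ where
  carrier := {g | UP g.1 ∧ UP g⁻¹.1}
  mul_mem' := by
    rintro a b ⟨h1, h2⟩ ⟨h3, h4⟩
    exact ⟨h1.mul h3, by rw [mul_inv_rev]; exact h4.mul h2⟩
  one_mem' := ⟨UP.one, by simpa using UP.one⟩
  inv_mem' := by rintro a ⟨h1, h2⟩; exact ⟨h2, by simpa using h1⟩

lemma UmG.odd {u : (MK N)ˣ} (hu : u ∈ UmG N) {L : Submodule A (Fin N → K)} (hL : Odd_ L) :
    Odd_ (act u.1 L) := hL.act hu.1.lam hu.2.lam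

lemma BpG.odd {u : (MK N)ˣ} (hu : u ∈ BpG N) {L : Submodule A (Fin N → K)} (hL : Odd_ L) :
    Odd_ (act u.1 L) := hL.act hu.1.lam hu.2.lam

lemma inter_trivial {g : (MK N)ˣ} (h1 : g ∈ UmG N) (h2 : g ∈ BpG N) : g = 1 := by
  ext i j
  rcases lt_trichotomy i j with hij | rfl | hij
  · rw [h1.1.up i j hij]; simp [Matrix.one_apply_ne hij.ne]
  · rw [h1.1.dg]; simp
  · rw [h2.1.lo i j hij]; simp [Matrix.one_apply_ne hij.ne']

lemma jump_B {b : (MK N)ˣ} (hb : b ∈ BpG N) {π : A} {lam : (Fin N → K) → A}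
    {L : Submodule A (Fin N → K)} {v : Fin N → K} (hv : Jump (List.finRange N) π lam L v) :
    Jump (List.finRange N) π (fun v => lam (b⁻¹.1.mulVec v)) (act b.1 L) (b.1.mulVec v) := by
  refine Jump.act (· < ·) (List.sortedLT_finRange N).pairwise (by simp) ?_ ?_ hb.1.dg hv
  · intro k k' h
    by_contra hc
    push Not at hc
    exact h (hb.1.lo _ _ (lt_of_le_of_ne hc.2 hc.1.symm))
  · intro k k' h
    by_contra hc
    push Not at hc
    exact h (hb.2.lo _ _ (lt_of_le_of_ne hc.2 hc.1.symm))

lemma jump_U {u : (MK N)ˣ} (hu : u ∈ UmG N) {π : A} {lam : (Fin N → K) → A}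
    {L : Submodule A (Fin N → K)} {v : Fin N → K} (hv : Jump (List.finRange N).reverse π lam L v) :
    Jump (List.finRange N).reverse π (fun v => lam (u⁻¹.1.mulVec v)) (act u.1 L)
      (u.1.mulVec v) := by
  refine Jump.act (· > ·) ?_ (by simp) ?_ ?_ ?_ hv
  · rw [List.pairwise_reverse]; exact (List.sortedLT_finRange N).pairwise
  · intro k k' h
    by_contra hc
    push Not at hc
    exact h (hu.1.up _ _ (lt_of_le_of_ne hc.2 hc.1))
  · intro k k' h
    by_contra hc
    push Not at hc
    exact h (hu.2.up _ _ (lt_of_le_of_ne hc.2 hc.1))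
  · intro k; rw [hu.1.dg]; exact Lam1_one

noncomputable def PP (b'' u bu : (MK N)ˣ) (M : Submodule A (Fin N → K)) : ℤ :=
  ff M * ff (act b''.1 M) * ff (act u.1 M) * ff (act bu.1 M)

lemma PP_sq (b'' u bu : (MK N)ˣ) (M : Submodule A (Fin N → K)) :
    PP b'' u bu M * PP b'' u bu M = 1 := by
  have h1 := ff_sq M
  have h2 := ff_sq (act b''.1 M)
  have h3 := ff_sq (act u.1 M)
  have h4 := ff_sq (act bu.1 M)
  calc _ = (ff M * ff M) * (ff (act b''.1 M) * ff (act b''.1 M)) *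
    (ff (act u.1 M) * ff (act u.1 M)) * (ff (act bu.1 M) * ff (act bu.1 M)) := by
        unfold PP; ring
    _ = 1 := by rw [h1, h2, h3, h4]; norm_num

lemma mulVec_inv_cancel (g : (MK N)ˣ) (x : Fin N → K) : g⁻¹.1.mulVec (g.1.mulVec x) = x := by
  rw [Matrix.mulVec_mulVec, ← Units.val_mul]; simp

lemma star_const {b u b'' u'' : (MK N)ˣ} (hb : b ∈ BpG N) (hu : u ∈ UmG N) (hb'' : b'' ∈ BpG N)
    (hu'' : u'' ∈ UmG N) (e : b * u = u'' * b'') {M M' : Submodule A (Fin N → K)}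
    (hM : Odd_ M) (hM' : Odd_ M') : PP b'' u (b * u) M = PP b'' u (b * u) M' := by
  refine conn ?_ hM hM'
  clear hM hM' M M'
  intro π lam L L' had hL
  suffices h : PP b'' u (b * u) L * PP b'' u (b * u) L' = 1 by
    have h2 := PP_sq b'' u (b * u) L'
    linear_combination (-PP b'' u (b * u) L) * h2 + (PP b'' u (b * u) L') * h
  have full : ∀ k, k ∈ List.finRange N := by simp
  have full' : ∀ k, k ∈ (List.finRange N).reverse := by simp
  obtain ⟨vp, hvp⟩ := jump_exists had hL full
  obtain ⟨vm, hvm⟩ := jump_exists had hL full'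
  have hbv := jump_B hb'' hvp
  have hadb := had.act b''
  have hLb := BpG.odd hb'' hL
  obtain ⟨wm, hwm⟩ := jump_exists hadb hLb full'
  have huv := jump_U hu hvm
  have hadu := had.act u
  have hLu := UmG.odd hu hL
  obtain ⟨wp, hwp⟩ := jump_exists hadu hLu full
  -- jumps for bu
  have hadbu := had.act (b * u)
  have hLbu : Odd_ (act (b * u).1 L) := by
    rw [Units.val_mul, act_mul]; exact BpG.odd hb hLu
  have j1 := jump_B hb hwp
  have j2 := jump_U hu'' hwm
  have e1 : act b.1 (act u.1 L) = act (b * u).1 L := by rw [Units.val_mul, act_mul]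
  have e2 : act u''.1 (act b''.1 L) = act (b * u).1 L := by rw [e, Units.val_mul, act_mul]
  have l1 : (fun v => (fun v => lam (u⁻¹.1.mulVec v)) (b⁻¹.1.mulVec v)) =
      fun v => lam ((b * u)⁻¹.1.mulVec v) := by
    funext v; simp only [mul_inv_rev, Units.val_mul, Matrix.mulVec_mulVec]
  have l2 : (fun v => (fun v => lam (b''⁻¹.1.mulVec v)) (u''⁻¹.1.mulVec v)) =
      fun v => lam ((b * u)⁻¹.1.mulVec v) := by
    funext v; simp only [e, mul_inv_rev, Units.val_mul, Matrix.mulVec_mulVec]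
  rw [e1, l1] at j1
  rw [e2, l2] at j2
  have r0 := ff_adj π _ _ _ had hL _ _ hvp hvm
  have r1 := ff_adj π _ _ _ hadb hLb _ _ hbv hwm
  have r2 := ff_adj π _ _ _ hadu hLu _ _ hwp huv
  have r3 := ff_adj π _ _ _ hadbu hLbu _ _ j1 j2
  have c1 : (b * u)⁻¹.1.mulVec (b.1.mulVec wp) = u⁻¹.1.mulVec wp := by
    rw [mul_inv_rev, Units.val_mul, ← Matrix.mulVec_mulVec, mulVec_inv_cancel]
  have c2 : (b * u)⁻¹.1.mulVec (u''.1.mulVec wm) = b''⁻¹.1.mulVec wm := by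
    rw [e, mul_inv_rev, Units.val_mul, ← Matrix.mulVec_mulVec, mulVec_inv_cancel]
  simp only [mulVec_inv_cancel, c1, c2] at r0 r1 r2 r3
  have nd : ∀ {l : List (Fin N)} {lam : (Fin N → K) → A} {L : Submodule A (Fin N → K)}
      {v : Fin N → K}, Jump l π lam L v → sym (lam v) π * sym (lam v) π = 1 := by
    rintro l lam L v ⟨_, _, _, _, _, h, _⟩
    exact sym_sq' had.prime had.prim h
  have n1 := nd hvp
  have n2 := nd hvm
  have n3 := nd hwp
  have n4 := nd hwm
  calc _ = (ff L * ff L') * (ff (act b''.1 L) * ff (act b''.1 L')) *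
        (ff (act u.1 L) * ff (act u.1 L')) * (ff (act (b * u).1 L) * ff (act (b * u).1 L')) := by
        unfold PP; ring
    _ = _ := by
      rw [r0, r1, r2, r3]
      generalize sym (lam vp) π = x1 at *
      generalize sym (lam vm) π = x2 at *
      generalize sym (lam (u⁻¹.1.mulVec wp)) π = x3 at *
      generalize sym (lam (b''⁻¹.1.mulVec wm)) π = x4 at *
      calc _ = (x1 * x1) * (x2 * x2) * (x3 * x3) * (x4 * x4) := by ring
        _ = 1 := by rw [n1, n2, n3, n4]; norm_num

def Star (b : (MK N)ˣ) : Prop :=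
  ∀ u ∈ UmG N, ∃ u'' ∈ UmG N, ∃ b'' ∈ BpG N, b * u = u'' * b'' ∧
    ∀ M, Odd_ M → PP b'' u (b * u) M = 1

lemma Star.mul {b1 b2 : (MK N)ˣ} (h1 : Star b1) (h2 : Star b2) : Star (b1 * b2) := by
  intro u hu
  obtain ⟨u2, hu2, b2', hb2', e2, H2⟩ := h2 u hu
  obtain ⟨u1, hu1, b1', hb1', e1, H1⟩ := h1 u2 hu2
  have e : b1 * b2 * u = u1 * (b1' * b2') := by
    rw [mul_assoc, e2, ← mul_assoc, e1, mul_assoc]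
  refine ⟨u1, hu1, b1' * b2', mul_mem hb1' hb2', e, fun M hM => ?_⟩
  have k1 := H1 (act b2'.1 M) (BpG.odd hb2' hM)
  have k2 := H2 M hM
  have a1 : act (b1 * b2 * u).1 M = act (b1 * u2).1 (act b2'.1 M) := by
    rw [← act_mul, ← Units.val_mul, mul_assoc b1 u2, ← e2, mul_assoc]
  have a2 : act u2.1 (act b2'.1 M) = act (b2 * u).1 M := by
    rw [← act_mul, ← Units.val_mul, ← e2]
  have a3 : act (b1' * b2').1 M = act b1'.1 (act b2'.1 M) := by rw [Units.val_mul, act_mul]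
  unfold PP at *
  rw [a1, a3]
  rw [a2] at k1
  have s1 := ff_sq (act b2'.1 M)
  have s2 := ff_sq (act (b2 * u).1 M)
  generalize ff M = x0 at *
  generalize ff (act b2'.1 M) = x1 at *
  generalize ff (act (b2 * u).1 M) = x2 at *
  generalize ff (act u.1 M) = x3 at *
  generalize ff (act b1'.1 (act b2'.1 M)) = x4 at *
  generalize ff (act (b1 * u2).1 (act b2'.1 M)) = x5 at *
  calc x0 * x4 * x3 * x5 = x0 * x4 * x3 * x5 * (x1 * x1) * (x2 * x2) := by rw [s1, s2]; ring
    _ = (x1 * x4 * x2 * x5) * (x0 * x1 * x3 * x2) := by ring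
    _ = 1 := by rw [k1, k2]; norm_num

end SKN

set_option linter.unusedSectionVars false

namespace SKN

variable {N : ℕ}

def LamR : Subring K where
  carrier := {z | Lam z}
  mul_mem' := Lam.mul
  one_mem' := Lam_one
  add_mem' := Lam.add
  zero_mem' := Lam_zero
  neg_mem' := Lam.neg

lemma LamM.det {g : MK N} (h : LamM g) : Lam g.det := by
  change g.det ∈ LamR
  rw [Matrix.det_apply]
  exact sum_mem fun σ _ => by
    rw [Units.smul_def]
    exact zsmul_mem (prod_mem fun i _ => h _ _) _

lemma LamM.adj {g : MK N} (h : LamM g) : LamM g.adjugate := by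
  intro i j
  rw [Matrix.adjugate_apply]
  apply LamM.det
  intro a b
  rw [Matrix.updateRow_apply]
  split_ifs with hc
  · by_cases hb : b = i
    · subst hb; rw [Pi.single_eq_same]; exact Lam_one
    · rw [Pi.single_eq_of_ne hb]; exact Lam_zero
  · exact h a b

lemma unit_inv_lam {g : (MK N)ˣ} (h : LamM g.1) (hd : Lam1 g.1.det) : LamM g⁻¹.1 := by
  have e : g⁻¹.1 = g.1.det⁻¹ • g.1.adjugate := by
    rw [Matrix.coe_units_inv, Matrix.inv_def, Ring.inverse_eq_inv']
  intro i j
  rw [e, Matrix.smul_apply, smul_eq_mul]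
  exact hd.inv.lam.mul (h.adj i j)

lemma UP.mem {g : (MK N)ˣ} (h : UP g.1) : g ∈ BpG N := by
  have ht : g.1.BlockTriangular id := fun i j hij => h.lo i j hij
  have hd : Lam1 g.1.det := by
    rw [Matrix.det_of_isUpperTriangular ht]; exact Lam1.prod fun i _ => h.dg i
  let _ : Invertible g.1 := g.invertible
  have hi : g⁻¹.1.BlockTriangular id := by
    have := Matrix.blockTriangular_inv_of_blockTriangular ht
    rwa [← Matrix.coe_units_inv] at this
  refine ⟨h, fun i j hij => hi hij, fun i => ?_, unit_inv_lam h.lam hd⟩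
  have e : (g.1 * g⁻¹.1) i i = 1 := by rw [← Units.val_mul]; simp
  rw [Matrix.mul_apply, Finset.sum_eq_single i] at e
  · have : g⁻¹.1 i i = (g.1 i i)⁻¹ := eq_inv_of_mul_eq_one_right e
    rw [this]; exact (h.dg i).inv
  · intro k _ hk
    rcases lt_or_gt_of_ne hk with h1 | h1
    · rw [h.lo _ _ h1, zero_mul]
    · rw [hi (show id i < id k from h1), mul_zero]
  · simp

lemma LP.mem {g : (MK N)ˣ} (h : LP g.1) : g ∈ UmG N := by
  have ht : g.1.BlockTriangular OrderDual.toDual := fun i j hij => h.up i j hij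
  have hd : g.1.det = 1 := by
    rw [Matrix.det_of_isLowerTriangular _ ht]; exact Finset.prod_eq_one fun i _ => h.dg i
  let _ : Invertible g.1 := g.invertible
  have hi : g⁻¹.1.BlockTriangular OrderDual.toDual := by
    have := Matrix.blockTriangular_inv_of_blockTriangular ht
    rwa [← Matrix.coe_units_inv] at this
  have hl : LamM g⁻¹.1 := unit_inv_lam h.lam (by rw [hd]; exact Lam1_one)
  refine ⟨h, fun i j hij => hi (show OrderDual.toDual j < OrderDual.toDual i from hij), fun i => ?_, fun i j hij => ?_⟩
  · have e : (g.1 * g⁻¹.1) i i = 1 := by rw [← Units.val_mul]; simp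
    rw [Matrix.mul_apply, Finset.sum_eq_single i] at e
    · rwa [h.dg, one_mul] at e
    · intro k _ hk
      rcases lt_or_gt_of_ne hk with h1 | h1
      · rw [hi (show OrderDual.toDual i < OrderDual.toDual k from h1), mul_zero]
      · rw [h.up _ _ h1, zero_mul]
    · simp
  · have e : (g.1 * g⁻¹.1) i j = 0 := by
      rw [← Units.val_mul]; simp [Matrix.one_apply_ne hij.ne']
    rw [Matrix.mul_apply, ← Finset.add_sum_erase _ _ (Finset.mem_univ i), h.dg, one_mul] at e
    rw [eq_neg_of_add_eq_zero_left e]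
    refine (Lam4.sum _ _ fun k hk => ?_).neg
    have hk := Finset.ne_of_mem_erase hk
    rcases lt_or_gt_of_ne hk with h1 | h1
    · exact (h.lo _ _ h1).mul (hl _ _)
    · rw [h.up _ _ h1, zero_mul]; exact Lam4_zero

/-! generators -/

noncomputable def dgU (t : Fin N → K) (ht : ∀ k, t k ≠ 0) : (MK N)ˣ :=
  ⟨Matrix.diagonal t, Matrix.diagonal fun k => (t k)⁻¹, by
    rw [Matrix.diagonal_mul_diagonal, ← Matrix.diagonal_one]; congr 1; funext k
    exact mul_inv_cancel₀ (ht k), by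
    rw [Matrix.diagonal_mul_diagonal, ← Matrix.diagonal_one]; congr 1; funext k
    exact inv_mul_cancel₀ (ht k)⟩

noncomputable def tvU (i j : Fin N) (h : i ≠ j) (s : K) : (MK N)ˣ :=
  ⟨Matrix.transvection i j s, Matrix.transvection i j (-s), by
    rw [Matrix.transvection_mul_transvection_same _ _ h]; simp, by
    rw [Matrix.transvection_mul_transvection_same _ _ h]; simp⟩

lemma tv_mul_apply (i j : Fin N) (s : K) (y : MK N) (a b : Fin N) :
    (Matrix.transvection i j s * y) a b = y a b + if a = i then s * y j b else 0 := by
  split_ifs with h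
  · subst h; simp
  · simp [h]

lemma tv_apply (i j : Fin N) (s : K) (a b : Fin N) :
    (Matrix.transvection i j s : MK N) a b =
      (if a = b then 1 else 0) + if a = i ∧ b = j then s else 0 := by
  have := tv_mul_apply i j s 1 a b
  rw [mul_one] at this
  rw [this]
  by_cases h : a = i <;> by_cases h' : b = j <;> simp [h, h', Matrix.one_apply, Ne.symm]

noncomputable def L0 (N : ℕ) : Submodule A (Fin N → K) := LinearMap.range (dvm (ι := Fin N) 1)

lemma mem_L0 {v : Fin N → K} : v ∈ L0 N ↔ ∃ w : Fin N → A, v = vcc w := by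
  constructor
  · rintro ⟨w, rfl⟩; exact ⟨w, by ext k; simp [dvm, cc]⟩
  · rintro ⟨w, rfl⟩; exact ⟨w, by ext k; simp [dvm, cc]⟩

lemma L0_odd : Odd_ (L0 N) :=
  ⟨1, prim_one, fun w => by rw [one_smul]; exact mem_L0.2 ⟨w, rfl⟩, fun v hv => by
    rw [one_smul]; exact mem_L0.1 hv⟩

lemma dgU_mem {t : Fin N → K} (h : ∀ k, Lam1 (t k)) : dgU t (fun k => (h k).ne_zero) ∈ BpG N := by
  apply UP.mem
  refine ⟨fun i j hij => Matrix.diagonal_apply_ne _ hij.ne', fun i => ?_, fun i j => ?_⟩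
  · simpa [dgU] using h i
  · simp only [dgU, Matrix.diagonal_apply]; split_ifs
    · exact (h i).lam
    · exact Lam_zero

noncomputable def lat (t : Fin N → K) : Submodule A (Fin N → K) := act (Matrix.diagonal t) (L0 N)

lemma mem_lat {t : Fin N → K} {v : Fin N → K} :
    v ∈ lat t ↔ ∃ c : Fin N → A, ∀ k, v k = t k * cc (c k) := by
  rw [lat, mem_act]
  constructor
  · rintro ⟨x, hx, rfl⟩
    obtain ⟨w, rfl⟩ := mem_L0.1 hx
    exact ⟨w, fun k => by simp [Matrix.mulVec_diagonal, vcc]⟩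
  · rintro ⟨c, hc⟩
    exact ⟨vcc c, mem_L0.2 ⟨c, rfl⟩, by ext k; simp [Matrix.mulVec_diagonal, vcc, hc]⟩

lemma lat_odd {t : Fin N → K} (h : ∀ k, Lam1 (t k)) : Odd_ (lat t) :=
  BpG.odd (dgU_mem h) L0_odd

lemma ff_lat {t : Fin N → K} (h : ∀ k, Lam1 (t k)) (p q : Fin N) (hpq : p < q) :
    ff (lat t) = 1 := by
  have : Blk t p q 0 (lat t) := by
    intro v; rw [mem_lat]; simp
  rw [this.ff_eq (lat_odd h) h hpq, zero_div, JJ_zero]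

lemma exists_lat {u : (MK N)ˣ} (hu : u ∈ UmG N) : ∃ D, prim D ∧
    (∀ i j, j < i → ∃ c, cc D * u.1 i j = 4 * cc c) ∧
    act u.1 (lat fun k => cc D ^ (N - (k : ℕ))) = lat fun k => cc D ^ (N - (k : ℕ)) := by
  have key : ∀ g : MK N, LP g → ∃ D, prim D ∧ (∀ i j, j < i → ∃ c, cc D * g i j = 4 * cc c) := by
    intro g hg
    have h : ∀ p : Fin N × Fin N, ∃ c, Lam c ∧ (p.2 < p.1 → g p.1 p.2 = 4 * c) := by
      intro p
      by_cases hp : p.2 < p.1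
      · obtain ⟨c, hc, e⟩ := hg.lo _ _ hp; exact ⟨c, hc, fun _ => e⟩
      · exact ⟨0, Lam_zero, fun h => absurd h hp⟩
    choose z hz he using h
    obtain ⟨D, hD, hc⟩ := exists_denom z hz
    refine ⟨D, hD, fun i j hij => ?_⟩
    obtain ⟨c, hc⟩ := hc (i, j)
    exact ⟨c, by rw [he (i, j) hij, ← hc]; ring⟩
  obtain ⟨D1, hD1, h1⟩ := key _ hu.1
  obtain ⟨D2, hD2, h2⟩ := key _ hu.2
  have ccm : ∀ a b : A, cc (a * b) = cc a * cc b := fun a b => by simp [cc]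
  refine ⟨D1 * D2, hD1.mul hD2, fun i j hij => ?_, ?_⟩
  · obtain ⟨c, hc⟩ := h1 i j hij
    exact ⟨c * D2, by rw [ccm, ccm]; linear_combination cc D2 * hc⟩
  · have sub : ∀ g : MK N, LP g → (∀ i j, j < i → ∃ c, cc (D1 * D2) * g i j = 4 * cc c) →
      act g (lat fun k => cc (D1 * D2) ^ (N - (k : ℕ))) ≤
        lat fun k => cc (D1 * D2) ^ (N - (k : ℕ)) := by
      intro g hg hc v hv
      obtain ⟨x, hx, rfl⟩ := mem_act.1 hv
      obtain ⟨c, hx⟩ := mem_lat.1 hx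
      have : ∀ i j, ∃ e, g i j * cc (D1 * D2) ^ (N - (j : ℕ)) =
          cc (D1 * D2) ^ (N - (i : ℕ)) * cc e := by
        intro i j
        rcases lt_trichotomy i j with hij | rfl | hij
        · exact ⟨0, by rw [hg.up _ _ hij]; simp [cc]⟩
        · exact ⟨1, by rw [hg.dg]; simp [cc]⟩
        · obtain ⟨e, he⟩ := hc i j hij
          have hn : N - (j : ℕ) = (N - (i : ℕ)) + (i - j - 1 : ℕ) + 1 := by
            have := i.2; have : (j : ℕ) < i := hij; omega
          refine ⟨4 * e * (D1 * D2) ^ (i - j - 1 : ℕ), ?_⟩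
          rw [hn, pow_add, pow_one, pow_add]
          have : cc (4 * e * (D1 * D2) ^ (i - j - 1 : ℕ)) =
              4 * cc e * cc (D1 * D2) ^ (i - j - 1 : ℕ) := by
            simp only [cc, map_mul, map_pow]
            rw [show algebraMap A K 4 = 4 from map_ofNat _ 4]
          rw [this]
          linear_combination (cc (D1 * D2) ^ (N - (i : ℕ)) * cc (D1 * D2) ^ (i - j - 1 : ℕ)) * he
      choose e he using this
      refine mem_lat.2 ⟨fun i => ∑ j, e i j * c j, fun i => ?_⟩
      simp only [Matrix.mulVec, dotProduct, hx]
      have : cc (∑ j, e i j * c j) = ∑ j, cc (e i j) * cc (c j) := by simp [cc]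
      rw [this, Finset.mul_sum]
      refine Finset.sum_congr rfl fun j _ => ?_
      rw [← mul_assoc, he]; ring
    apply le_antisymm
    · refine sub _ hu.1 fun i j hij => ?_
      obtain ⟨c, hc⟩ := h1 i j hij
      exact ⟨c * D2, by rw [ccm, ccm]; linear_combination cc D2 * hc⟩
    · have := sub _ hu.2 fun i j hij => by
        obtain ⟨c, hc⟩ := h2 i j hij
        exact ⟨c * D1, by rw [ccm, ccm]; linear_combination cc D1 * hc⟩
      have h3 : ∀ M M' : Submodule A (Fin N → K), M ≤ M' → act u.1 M ≤ act u.1 M' :=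
        fun M M' h => Submodule.map_mono h
      have := h3 _ _ this
      rwa [← act_mul, ← Units.val_mul, mul_inv_cancel, Units.val_one, act_one] at this

lemma Lam1_pow {D : A} (hD : prim D) (n : ℕ) : Lam1 (cc D ^ n) := by
  have := Lam1_cc (hD.pow n); simpa [cc] using this

lemma star_dg {t : Fin N → K} (h : ∀ k, Lam1 (t k)) : Star (dgU t (fun k => (h k).ne_zero)) := by
  intro u hu
  set b := dgU t (fun k => (h k).ne_zero) with hb
  have hbm : b ∈ BpG N := dgU_mem h
  have e : b * u = b * u * b⁻¹ * b := by group
  have hv : ∀ i j, (b * u * b⁻¹).1 i j = t i * u.1 i j * (t j)⁻¹ := by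
    intro i j
    change (Matrix.diagonal t * u.1 * Matrix.diagonal (fun k => (t k)⁻¹)) i j = _
    rw [Matrix.mul_diagonal, Matrix.diagonal_mul]
  have hu'' : b * u * b⁻¹ ∈ UmG N := by
    apply LP.mem
    refine ⟨fun i j hij => ?_, fun i => ?_, fun i j hij => ?_⟩
    · rw [hv, hu.1.up _ _ hij]; simp
    · rw [hv, hu.1.dg, mul_one, mul_inv_cancel₀ (h i).ne_zero]
    · rw [hv]; exact (Lam4.mul' (h i).lam (hu.1.lo _ _ hij)).mul (h j).inv.lam
  refine ⟨_, hu'', b, hbm, e, fun M hM => ?_⟩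
  obtain ⟨D, hD, _, hl⟩ := exists_lat hu
  rw [star_const hbm hu hbm hu'' e hM (lat_odd fun k => Lam1_pow hD _)]
  unfold PP
  rw [Units.val_mul, act_mul, hl]
  have h1 := ff_sq (lat fun k : Fin N => cc D ^ (N - (k : ℕ)))
  have h2 := ff_sq (act b.1 (lat fun k : Fin N => cc D ^ (N - (k : ℕ))))
  linear_combination (ff (act b.1 (lat fun k : Fin N => cc D ^ (N - (k : ℕ)))))^2 * h1 + h2

end SKN

set_option linter.unusedSectionVars false

namespace SKN

variable {N : ℕ}

lemma mul_tv_apply (i j : Fin N) (s : K) (y : MK N) (a b : Fin N) :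
    (y * Matrix.transvection i j s) a b = y a b + if b = j then s * y a i else 0 := by
  split_ifs with h
  · subst h; simp
  · simp [h]

lemma tvU_mem {p q : Fin N} (h : p < q) {s : K} (hs : Lam s) : tvU p q h.ne s ∈ BpG N := by
  apply UP.mem
  refine ⟨fun i j hij => ?_, fun i => ?_, fun i j => ?_⟩
  · change Matrix.transvection p q s i j = 0
    rw [tv_apply, if_neg hij.ne', if_neg, add_zero]
    rintro ⟨rfl, rfl⟩; exact absurd h hij.asymm
  · change Lam1 (Matrix.transvection p q s i i)
    rw [tv_apply, if_pos rfl, if_neg, add_zero]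
    · exact Lam1_one
    · rintro ⟨rfl, rfl⟩; exact h.ne rfl
  · change Lam (Matrix.transvection p q s i j)
    rw [tv_apply]
    refine Lam.add ?_ ?_ <;> split_ifs <;> first | exact hs | exact Lam_one | exact Lam_zero

lemma tv_mulVec (i j : Fin N) (s : K) (x : Fin N → K) (a : Fin N) :
    (Matrix.transvection i j s).mulVec x a = x a + if a = i then s * x j else 0 := by
  simp only [Matrix.mulVec, dotProduct, tv_apply, add_mul, Finset.sum_add_distrib]
  congr 1
  · simp
  · by_cases h : a = i <;> simp [h]

lemma blk_act {t t' : Fin N → K} {p q : Fin N} (s : K) :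
    Blk (fun k => t' k * t k) p q (t' p * (s * t q))
      (act (Matrix.diagonal t' * Matrix.transvection p q s) (lat t)) := by
  intro v
  rw [mem_act]
  constructor
  · rintro ⟨x, hx, rfl⟩
    obtain ⟨c, hc⟩ := mem_lat.1 hx
    refine ⟨c, fun k => ?_⟩
    rw [← Matrix.mulVec_mulVec, Matrix.mulVec_diagonal, tv_mulVec]
    split_ifs with h
    · subst h; rw [hc, hc]; ring
    · rw [hc]; ring
  · rintro ⟨c, hc⟩
    refine ⟨fun k => t k * cc (c k), mem_lat.2 ⟨c, fun k => rfl⟩, ?_⟩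
    ext k
    rw [← Matrix.mulVec_mulVec, Matrix.mulVec_diagonal, tv_mulVec, hc]
    split_ifs with h
    · subst h; ring
    · ring

noncomputable def bt (p q : Fin N) (α : K) (k : Fin N) : K := if k = p then α else if k = q then α⁻¹ else 1

lemma bt_lam {p q : Fin N} {α : K} (h : Lam1 α) (k : Fin N) : Lam1 (bt p q α k) := by
  unfold bt; split_ifs
  · exact h
  · exact h.inv
  · exact Lam1_one

lemma star_adj {p q : Fin N} (hpq : p < q) (hadj : (q : ℕ) = p + 1) {s : K} (hs : Lam s) :
    Star (tvU p q hpq.ne s) := by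
  intro u hu
  set b := tvU p q hpq.ne s with hb
  have hbm : b ∈ BpG N := tvU_mem hpq hs
  have hx4 : Lam4 (u.1 q p) := hu.1.lo _ _ hpq
  set α : K := 1 + s * u.1 q p with hα
  have hα1 : Lam1 α := Lam1_one.add4 (Lam4.mul' hs hx4)
  have hα0 := hα1.ne_zero
  have hs' : Lam (s / α) := hs.div hα1
  have hbt := fun k => bt_lam (p := p) (q := q) hα1 k
  set b'' := dgU (bt p q α) (fun k => (hbt k).ne_zero) * tvU p q hpq.ne (s / α) with hb''
  have hbm'' : b'' ∈ BpG N := mul_mem (dgU_mem hbt) (tvU_mem hpq hs')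
  have e : b * u = b * u * b''⁻¹ * b'' := by group
  have hbu : ∀ i j, (b * u).1 i j = u.1 i j + if i = p then s * u.1 q j else 0 := by
    intro i j; exact tv_mul_apply p q s u.1 i j
  have hv : ∀ i j, (b * u * b''⁻¹).1 i j = ((b * u).1 i j +
      if j = q then -(s / α) * (b * u).1 i p else 0) * (bt p q α j)⁻¹ := by
    intro i j
    rw [hb'', mul_inv_rev, ← mul_assoc]
    change ((b * u).1 * Matrix.transvection p q (-(s / α)) *
      Matrix.diagonal (fun k => (bt p q α k)⁻¹)) i j = _
    rw [Matrix.mul_diagonal, mul_tv_apply]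
  have hl4 : ∀ i, p < i → Lam4 ((b * u).1 i p) := by
    intro i hi; rw [hbu, if_neg hi.ne', add_zero]; exact hu.1.lo _ _ hi
  have hpp : (b * u).1 p p = α := by rw [hbu, if_pos rfl, hu.1.dg]
  have hu'' : b * u * b''⁻¹ ∈ UmG N := by
    apply LP.mem
    refine ⟨fun i j hij => ?_, fun i => ?_, fun i j hij => ?_⟩
    · rw [hv]
      by_cases hj : j = q
      · subst hj
        rw [if_pos rfl]
        rcases eq_or_ne i p with rfl | hi
        · rw [hpp, hbu, if_pos rfl, hu.1.up _ _ hpq, hu.1.dg]; field_simp; ring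
        · have hip : i < p := by
            have : (i : ℕ) ≠ p := fun h => hi (Fin.ext h)
            have : (i : ℕ) < j := hij
            exact Fin.lt_def.2 (by omega)
          rw [hbu, hbu, if_neg hi, if_neg hi, hu.1.up _ _ hij, hu.1.up _ _ hip]; simp
      · rw [if_neg hj, hbu, hu.1.up _ _ hij]
        split_ifs with hi
        · subst hi
          have : q < j := by
            have : (j : ℕ) ≠ q := fun h => hj (Fin.ext h)
            have : (i : ℕ) < j := hij
            exact Fin.lt_def.2 (by omega)
          rw [hu.1.up _ _ this]; simp
        · simp
    · rw [hv]
      by_cases hiq : i = q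
      · subst hiq
        rw [if_pos rfl, hbu, if_neg hpq.ne', hbu, if_neg hpq.ne', hu.1.dg, bt, if_neg hpq.ne',
          if_pos rfl, inv_inv]
        field_simp
        rw [hα]; ring
      · rw [if_neg hiq, add_zero]
        by_cases hip : i = p
        · subst hip; rw [hpp, bt, if_pos rfl, mul_inv_cancel₀ hα0]
        · rw [hbu, if_neg hip, hu.1.dg, bt, if_neg hip, if_neg hiq]; simp
    · rw [hv]
      refine Lam4.mul (Lam4.add ?_ ?_) (hbt j).inv.lam
      · rw [hbu]
        refine (hu.1.lo _ _ hij).add ?_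
        split_ifs with hi
        · subst hi; exact Lam4.mul' hs (hu.1.lo _ _ (hij.trans hpq))
        · exact Lam4_zero
      · split_ifs with hj
        · subst hj; exact Lam4.mul' hs'.neg (hl4 _ (hpq.trans hij))
        · exact Lam4_zero
  refine ⟨_, hu'', b'', hbm'', e, fun M hM => ?_⟩
  obtain ⟨D, hD, hc, hl⟩ := exists_lat hu
  have ht : ∀ k : Fin N, Lam1 (cc D ^ (N - (k : ℕ))) := fun k => Lam1_pow hD _
  have hlo := lat_odd ht
  rw [star_const hbm hu hbm'' hu'' e hM hlo]
  unfold PP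
  rw [show (b * u).1 = b.1 * u.1 from rfl, act_mul, hl, ff_lat ht p q hpq]
  have hD0 : cc D ≠ 0 := (Lam1_cc hD).ne_zero
  have htq : cc D ^ (N - (q : ℕ)) ≠ 0 := pow_ne_zero _ hD0
  have hpow : cc D ^ (N - (p : ℕ)) = cc D * cc D ^ (N - (q : ℕ)) := by
    have : N - (p : ℕ) = (N - q) + 1 := by have := q.2; omega
    rw [this, pow_succ]; ring
  have B1 := blk_act (t := fun k : Fin N => cc D ^ (N - (k : ℕ))) (t' := fun _ => 1) (p := p)
    (q := q) s
  have hdiag1 : Matrix.diagonal (fun _ : Fin N => (1 : K)) = 1 := Matrix.diagonal_one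
  rw [hdiag1, one_mul (Matrix.transvection p q s)] at B1
  have f1 : ff (act b.1 (lat fun k : Fin N => cc D ^ (N - (k : ℕ)))) = JJ (s / cc D) := by
    have := B1.ff_eq (BpG.odd hbm hlo) (fun k => by rw [one_mul]; exact ht k) hpq
    refine this.trans ?_
    congr 1
    simp only [one_mul, hpow]
    field_simp
  have B2 := blk_act (t := fun k : Fin N => cc D ^ (N - (k : ℕ))) (t' := bt p q α) (p := p)
    (q := q) (s / α)
  have f2 : ff (act b''.1 (lat fun k : Fin N => cc D ^ (N - (k : ℕ)))) =
      JJ (s / cc D / α) := by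
    have := B2.ff_eq (BpG.odd hbm'' hlo) (fun k => (hbt k).mul (ht k)) hpq
    refine this.trans ?_
    congr 1
    simp only [hpow, bt, if_true]
    field_simp
  obtain ⟨C, hC⟩ := hc q p hpq
  have f3 : JJ (s / cc D / α) = JJ (s / cc D) := by
    rw [← JJ_shift (hs.div (Lam1_cc hD)) C, ← hC, hα]
    congr 2
    field_simp
  have f4 := ff_sq (act b.1 (lat fun k : Fin N => cc D ^ (N - (k : ℕ))))
  rw [f2, f3, ← f1, one_mul, mul_one, f4]

lemma star_tv : ∀ (n : ℕ) (p q : Fin N) (hpq : p < q) (_ : (q : ℕ) = p + 1 + n) {s : K}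
    (_ : Lam s), Star (tvU p q hpq.ne s) := by
  intro n
  induction n with
  | zero => intro p q hpq h s hs; exact star_adj hpq h hs
  | succ n ih =>
    intro p q hpq h s hs
    let r : Fin N := ⟨p + 1, by have := q.2; omega⟩
    have hpr : p < r := Fin.lt_def.2 (by simp [r])
    have hrq : r < q := Fin.lt_def.2 (by simp [r]; omega)
    have e : tvU p q hpq.ne s = tvU p r hpr.ne s * tvU r q hrq.ne 1 * tvU p r hpr.ne (-s) *
        tvU r q hrq.ne (-1) := by
      ext1
      change Matrix.transvection p q s = Matrix.transvection p r s * Matrix.transvection r q 1 *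
        Matrix.transvection p r (-s) * Matrix.transvection r q (-1)
      ext i j
      simp only [mul_tv_apply, tv_apply]
      have h1 := hpr.ne; have h2 := hrq.ne; have h3 := hpq.ne
      have h1' := h1.symm; have h2' := h2.symm; have h3' := h3.symm
      generalize r = r at *
      by_cases a1 : i = p <;> by_cases a2 : j = q <;> by_cases a3 : i = r <;>
        by_cases a4 : j = r <;> by_cases a5 : j = p <;> by_cases a6 : i = q <;>
        simp_all
    rw [e]
    have hrq' : (q : ℕ) = r + 1 + n := by simp [r]; omega
    have s1 := star_adj hpr rfl hs
    have s2 := star_adj hpr rfl hs.neg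
    have s3 := ih r q hrq hrq' Lam_one
    have s4 := ih r q hrq hrq' Lam_one.neg
    exact ((s1.mul s3).mul s2).mul s4

lemma star_all : ∀ (n : ℕ) (b : (MK N)ˣ), b ∈ BpG N →
    (Finset.univ.filter fun x : Fin N × Fin N => x.1 ≠ x.2 ∧ b.1 x.1 x.2 ≠ 0).card ≤ n →
    Star b := by
  intro n
  induction n with
  | zero =>
    intro b hb hc
    have hc := Finset.card_eq_zero.1 (Nat.le_zero.1 hc)
    have : b = dgU (fun k => b.1 k k) (fun k => (hb.1.dg k).ne_zero) := by
      ext i j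
      change _ = Matrix.diagonal (fun k => b.1 k k) i j
      rw [Matrix.diagonal_apply]
      split_ifs with h
      · rw [h]
      · by_contra h0
        have : (i, j) ∈ (∅ : Finset (Fin N × Fin N)) := by
          rw [← hc]; simp [h, h0]
        simp at this
    rw [this]; exact star_dg hb.1.dg
  | succ n ih =>
    intro b hb hc
    set S := (Finset.univ.filter fun x : Fin N × Fin N => x.1 ≠ x.2 ∧ b.1 x.1 x.2 ≠ 0) with hS
    rcases S.eq_empty_or_nonempty with h0 | h0
    · exact ih b hb (by rw [← hS, h0]; simp)
    obtain ⟨⟨k, l⟩, hkl, hmax⟩ := S.exists_max_image (fun x => x.2) h0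
    rw [hS, Finset.mem_filter] at hkl
    obtain ⟨_, hne, hnz⟩ := hkl
    have hlt : k < l := by
      rcases lt_or_gt_of_ne hne with h | h
      · exact h
      · exact absurd (hb.1.lo _ _ h) hnz
    have hrow : ∀ j, j ≠ l → b.1 l j = 0 := by
      intro j hj
      by_contra h
      have := hmax (l, j) (by rw [hS]; simp [h, hj.symm])
      exact h (hb.1.lo _ _ (lt_of_le_of_ne this hj))
    have hll := (hb.1.dg l)
    have hs : Lam (b.1 k l / b.1 l l) := (hb.1.lam _ _).div hll
    set b' := tvU k l hlt.ne (-(b.1 k l / b.1 l l)) * b with hb'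
    have hv : ∀ i j, b'.1 i j = b.1 i j +
        if i = k then (-(b.1 k l / b.1 l l)) * b.1 l j else 0 := fun i j => tv_mul_apply _ _ _ _ _ _
    have hst : Star b' := by
      apply ih b' (mul_mem (tvU_mem hlt hs.neg) hb)
      apply Nat.le_of_lt_succ
      refine lt_of_lt_of_le (Finset.card_lt_card ?_) hc
      rw [Finset.ssubset_iff_of_subset]
      · refine ⟨(k, l), by rw [hS]; simp [hne, hnz], ?_⟩
        simp only [Finset.mem_filter, Finset.mem_univ, true_and, not_and, not_not]
        intro _
        rw [hv, if_pos rfl]; have := hll.ne_zero; field_simp; ring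
      · intro x hx
        rw [Finset.mem_filter] at hx
        rw [hS, Finset.mem_filter]
        refine ⟨hx.1, hx.2.1, fun h => hx.2.2 ?_⟩
        rw [hv, h]
        split_ifs with hxk
        · rw [hrow x.2, mul_zero, add_zero]
          rintro h2; apply hnz; rw [← hxk, ← h2]; exact h
        · simp
    have e : b = tvU k l hlt.ne (b.1 k l / b.1 l l) * b' := by
      rw [hb', ← mul_assoc]
      have : tvU k l hlt.ne (b.1 k l / b.1 l l) * tvU k l hlt.ne (-(b.1 k l / b.1 l l)) = 1 := by
        ext1; exact (tvU k l hlt.ne (b.1 k l / b.1 l l)).3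
      rw [this, one_mul]
    rw [e]
    have hl : (l : ℕ) = k + 1 + (l - k - 1 : ℕ) := by
      have : (k : ℕ) < l := hlt
      omega
    exact (star_tv _ k l hlt hl hs).mul hst

lemma star_B {b : (MK N)ˣ} (hb : b ∈ BpG N) : Star b := star_all _ b hb le_rfl

/-! lower elimination -/

structure XP (g : MK N) : Prop where
  lo : ∀ i j, j < i → Lam4 (g i j)
  dg : ∀ i, Lam1 (g i i)
  lam : LamM g

def cm (k : Fin N) (c : Fin N → K) : MK N := 1 + Matrix.vecMulVec c (Pi.single k 1)

lemma cm_mul (k : Fin N) (c : Fin N → K) (y : MK N) (i j : Fin N) :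
    (cm k c * y) i j = y i j + c i * y k j := by
  rw [cm, add_mul, one_mul, Matrix.add_apply]
  congr 1
  rw [Matrix.mul_apply, Finset.sum_eq_single k]
  · simp [Matrix.vecMulVec_apply]
  · intro b _ hb; simp [Matrix.vecMulVec_apply, hb]
  · simp

lemma cm_apply (k : Fin N) (c : Fin N → K) (i j : Fin N) :
    (cm k c) i j = (1 : MK N) i j + c i * (1 : MK N) k j := by
  rw [← cm_mul, mul_one]

noncomputable def cmU (k : Fin N) (c : Fin N → K) (hc : c k = 0) : (MK N)ˣ :=
  ⟨cm k c, cm k (-c), by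
    ext i j; rw [cm_mul, cm_apply, cm_apply]; simp [hc], by
    ext i j; rw [cm_mul, cm_apply, cm_apply]; simp [hc]⟩

lemma LU_aux (n : ℕ) : ∀ y : (MK N)ˣ, XP y.1 → ∃ u ∈ UmG N, XP (u * y).1 ∧
    ∀ i j : Fin N, (j : ℕ) < n → j < i → (u * y).1 i j = 0 := by
  induction n with
  | zero => intro y hy; exact ⟨1, one_mem _, by simpa using hy, by simp⟩
  | succ n ih =>
    intro y hy
    obtain ⟨u, hu, h1, h2⟩ := ih y hy
    by_cases hn : n < N
    swap
    · exact ⟨u, hu, h1, fun i j hj hij => h2 i j (by have := j.2; omega) hij⟩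
    let k : Fin N := ⟨n, hn⟩
    set z := u * y with hz
    let c : Fin N → K := fun i => if k < i then -(z.1 i k / z.1 k k) else 0
    have hck : c k = 0 := by simp [c]
    have hc4 : ∀ i, Lam4 (c i) := by
      intro i
      by_cases hi : k < i
      · simp only [c, if_pos hi]
        rw [div_eq_mul_inv]
        exact ((h1.lo _ _ hi).mul (h1.dg k).inv.lam).neg
      · simp only [c, if_neg hi]; exact Lam4_zero
    have hm : cmU k c hck ∈ UmG N := by
      apply LP.mem
      have hv : ∀ i j, (cmU k c hck).1 i j = (1 : MK N) i j + c i * (1 : MK N) k j :=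
        fun i j => cm_apply k c i j
      refine ⟨fun i j hij => ?_, fun i => ?_, fun i j hij => ?_⟩
      · rw [hv, Matrix.one_apply_ne hij.ne, zero_add]
        by_cases hkj : k = j
        · subst hkj; simp [c, hij.le]
        · rw [Matrix.one_apply_ne hkj, mul_zero]
      · rw [hv, Matrix.one_apply_eq]
        by_cases hkj : k = i
        · subst hkj; simp [c]
        · rw [Matrix.one_apply_ne hkj, mul_zero, add_zero]
      · rw [hv, Matrix.one_apply_ne hij.ne', zero_add]
        exact (hc4 i).mul (LP.one.lam _ _)
    have hv : ∀ i j, (cmU k c hck * u * y).1 i j = z.1 i j + c i * z.1 k j := by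
      intro i j; rw [mul_assoc]; exact cm_mul k c _ i j
    refine ⟨cmU k c hck * u, mul_mem hm hu, ⟨fun i j hij => ?_, fun i => ?_, fun i j => ?_⟩, ?_⟩
    · rw [hv]; exact (h1.lo _ _ hij).add ((hc4 i).mul (h1.lam _ _))
    · rw [hv]; exact (h1.dg i).add4 ((hc4 i).mul (h1.lam _ _))
    · rw [hv]; exact (h1.lam i j).add ((hc4 i).mul (h1.lam _ _)).lam
    · intro i j hj hij
      rw [hv]
      rcases Nat.lt_succ_iff_lt_or_eq.1 hj with hj | hj
      · rw [h2 i j hj hij, h2 k j hj (Fin.lt_def.2 hj)]; simp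
      · have : j = k := Fin.ext hj
        subst this
        have := (h1.dg k).ne_zero
        simp only [c, if_pos hij]; field_simp; ring

lemma LU {y : (MK N)ˣ} (hy : XP y.1) : ∃ u ∈ UmG N, ∃ b ∈ BpG N, y = u * b := by
  obtain ⟨u, hu, h1, h2⟩ := LU_aux N y hy
  exact ⟨u⁻¹, inv_mem hu, u * y, UP.mem ⟨fun i j hij => h2 i j j.2 hij, h1.dg, h1.lam⟩, by group⟩

end SKN

set_option linter.unusedSectionVars false

namespace SKN

variable {N : ℕ}

lemma XP.mul {g h : MK N} (hg : XP g) (hh : XP h) : XP (g * h) := by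
  refine ⟨fun i j hij => ?_, fun i => ?_, hg.lam.mul hh.lam⟩
  · rw [Matrix.mul_apply]
    refine Lam4.sum _ _ fun k _ => ?_
    rcases lt_or_ge k i with h1 | h1
    · exact (hg.lo _ _ h1).mul (hh.lam _ _)
    · exact Lam4.mul' (hg.lam _ _) (hh.lo _ _ (lt_of_lt_of_le hij h1))
  · rw [Matrix.mul_apply, ← Finset.add_sum_erase _ _ (Finset.mem_univ i)]
    refine ((hg.dg i).mul (hh.dg i)).add4 (Lam4.sum _ _ fun k hk => ?_)
    rcases lt_or_gt_of_ne (Finset.ne_of_mem_erase hk) with h1 | h1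
    · exact (hg.lo _ _ h1).mul (hh.lam _ _)
    · exact Lam4.mul' (hg.lam _ _) (hh.lo _ _ h1)

lemma UP.xp {g : MK N} (h : UP g) : XP g :=
  ⟨fun i j hij => by rw [h.lo _ _ hij]; exact Lam4_zero, h.dg, h.lam⟩

lemma LP.xp {g : MK N} (h : LP g) : XP g :=
  ⟨h.lo, fun i => by rw [h.dg]; exact Lam1_one, h.lam⟩

/-- the group on which `phi` is defined -/
noncomputable def G1 (N : ℕ) : Subgroup (MK N)ˣ where
  carrier := {y | XP y.1 ∧ act y.1 (L0 N) = L0 N}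
  mul_mem' := by
    rintro a b ⟨h1, h2⟩ ⟨h3, h4⟩
    exact ⟨h1.mul h3, by rw [Units.val_mul, act_mul, h4, h2]⟩
  one_mem' := ⟨LP.one.xp, by rw [Units.val_one, act_one]⟩
  inv_mem' := by
    rintro a ⟨h1, h2⟩
    constructor
    · obtain ⟨u, hu, b, hb, rfl⟩ := LU h1
      rw [mul_inv_rev]
      exact hb.2.xp.mul hu.2.xp
    · nth_rewrite 1 [← h2]
      rw [← act_mul, ← Units.val_mul, inv_mul_cancel, Units.val_one, act_one]

lemma ff_L0 (hN : 2 ≤ N) : ff (L0 N) = 1 := by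
  have := ff_lat (N := N) (t := fun _ => 1) (fun _ => Lam1_one) ⟨0, by omega⟩ ⟨1, by omega⟩
    (Fin.lt_def.2 (by simp))
  rwa [lat, show Matrix.diagonal (fun _ : Fin N => (1 : K)) = 1 from Matrix.diagonal_one,
    act_one] at this

open Classical in
noncomputable def phi (y : (MK N)ˣ) : ℤ :=
  if h : ∃ b ∈ BpG N, ∃ u ∈ UmG N, y = u * b then ff (act h.choose.1 (L0 N)) else 1

lemma phi_eq {y u b : (MK N)ˣ} (hu : u ∈ UmG N) (hb : b ∈ BpG N) (e : y = u * b) :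
    phi y = ff (act b.1 (L0 N)) := by
  have h : ∃ b ∈ BpG N, ∃ u ∈ UmG N, y = u * b := ⟨b, hb, u, hu, e⟩
  rw [phi, dif_pos h]
  obtain ⟨hb', u', hu', e'⟩ := h.choose_spec
  set b' := h.choose
  have e2 : u'⁻¹ * u = b' * b⁻¹ := by
    rw [inv_mul_eq_iff_eq_mul, ← mul_assoc, eq_mul_inv_iff_mul_eq, ← e, e']
  have h1 : u'⁻¹ * u ∈ UmG N := mul_mem (inv_mem hu') hu
  have h2 : u'⁻¹ * u ∈ BpG N := by rw [e2]; exact mul_mem hb' (inv_mem hb)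
  have h3 := inter_trivial h1 h2
  rw [e2, mul_inv_eq_one] at h3
  rw [h3]

lemma phi_sq (y : (MK N)ˣ) : phi y * phi y = 1 := by
  unfold phi; split_ifs
  · exact ff_sq _
  · rfl

lemma phi_mul (hN : 2 ≤ N) {y z : (MK N)ˣ} (hy : y ∈ G1 N) (hz : z ∈ G1 N) :
    phi (y * z) = phi y * phi z := by
  obtain ⟨u1, hu1, b1, hb1, e1⟩ := LU hy.1
  obtain ⟨u2, hu2, b2, hb2, e2⟩ := LU hz.1
  obtain ⟨u'', hu'', b'', hb'', e, H⟩ := star_B hb1 u2 hu2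
  have e3 : y * z = (u1 * u'') * (b'' * b2) := by
    calc y * z = u1 * (b1 * u2) * b2 := by rw [e1, e2]; group
      _ = _ := by rw [e]; group
  rw [phi_eq (mul_mem hu1 hu'') (mul_mem hb'' hb2) e3, phi_eq hu1 hb1 e1, phi_eq hu2 hb2 e2]
  have h := H (act b2.1 (L0 N)) (BpG.odd hb2 L0_odd)
  unfold PP at h
  have r1 : act u2.1 (act b2.1 (L0 N)) = L0 N := by
    rw [← act_mul, ← Units.val_mul, ← e2]; exact hz.2
  rw [Units.val_mul b1, act_mul b1.1, r1, ff_L0 hN] at h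
  rw [Units.val_mul, act_mul]
  have s1 := ff_sq (act b1.1 (L0 N))
  have s2 := ff_sq (act b2.1 (L0 N))
  generalize ff (act b1.1 (L0 N)) = x at *
  generalize ff (act b2.1 (L0 N)) = y at *
  generalize ff (act b''.1 (act b2.1 (L0 N))) = z at *
  calc z = (y * y) * z * (x * x) := by rw [s1, s2]; ring
    _ = (y * z * 1 * x) * (x * y) := by ring
    _ = _ := by rw [h, one_mul]

noncomputable def phiH (hN : 2 ≤ N) : G1 N →* ℤˣ where
  toFun y := ⟨phi y.1, phi y.1, phi_sq _, phi_sq _⟩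
  map_one' := by
    ext
    change phi (1 : (MK N)ˣ) = 1
    rw [phi_eq (one_mem _) (one_mem _) (by simp : (1 : (MK N)ˣ) = 1 * 1), Units.val_one, act_one,
      ff_L0 hN]
  map_mul' y z := by
    ext; exact phi_mul hN y.2 z.2

def isInt (g : MK N) : Prop := ∀ i j, ∃ a, g i j = cc a

lemma act_L0_le {g : MK N} (h : isInt g) : act g (L0 N) ≤ L0 N := by
  intro v hv
  obtain ⟨x, hx, rfl⟩ := mem_act.1 hv
  obtain ⟨w, rfl⟩ := mem_L0.1 hx
  choose a ha using h
  refine mem_L0.2 ⟨Matrix.mulVec (fun i j => a i j) w, ?_⟩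
  have := mulVec_vcc 1 (g := g) (c := fun i j => a i j) (fun i j => by simp [ha, cc]) w
  rwa [one_smul] at this

lemma act_L0 {g : (MK N)ˣ} (h : isInt g.1) (h' : isInt g⁻¹.1) : act g.1 (L0 N) = L0 N := by
  apply le_antisymm (act_L0_le h)
  have h3 : ∀ M M' : Submodule A (Fin N → K), M ≤ M' → act g.1 M ≤ act g.1 M' :=
    fun M M' h => Submodule.map_mono h
  have := h3 _ _ (act_L0_le h')
  rwa [← act_mul, ← Units.val_mul, mul_inv_cancel, Units.val_one, act_one] at this

lemma phi_LP (hN : 2 ≤ N) {g : (MK N)ˣ} (h : LP g.1) : phi g = 1 := by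
  rw [phi_eq h.mem (one_mem _) (mul_one g).symm, Units.val_one, act_one, ff_L0 hN]

lemma phi_UP (hN : 2 ≤ N) {g : (MK N)ˣ} (h : UP g.1) (hg : act g.1 (L0 N) = L0 N) :
    phi g = 1 := by
  rw [phi_eq (one_mem _) h.mem (one_mul g).symm, hg, ff_L0 hN]

/-- `SL_2` pair -/
lemma phi_pair {p q : Fin N} (hpq : p < q) {a b c d : A} (ha : prim a) (hc : 4 ∣ c)
    (hdet : a * d - b * c = 1) {y : (MK N)ˣ}
    (hy : ∀ i j, y.1 i j = if i = p ∧ j = p then cc a else if i = p ∧ j = q then cc b else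
      if i = q ∧ j = p then cc c else if i = q ∧ j = q then cc d else if i = j then 1 else 0) :
    phi y = sym b a := by
  have ha1 := Lam1_cc ha
  have ha0 := ha1.ne_zero
  have hdet' : cc a * cc d - cc b * cc c = 1 := by
    have := congrArg cc hdet; simpa [cc] using this
  have hbt := fun k => bt_lam (p := p) (q := q) ha1 k
  set b' := dgU (bt p q (cc a)) (fun k => (hbt k).ne_zero) * tvU p q hpq.ne (cc b / cc a) with hb'
  have hbm : b' ∈ BpG N := mul_mem (dgU_mem hbt) (tvU_mem hpq ((Lam_cc b).div ha1))
  set u := tvU q p hpq.ne' (cc c / cc a) with hu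
  have hum : u ∈ UmG N := by
    apply LP.mem
    have hv : ∀ i j, u.1 i j = (if i = j then 1 else 0) + if i = q ∧ j = p then cc c / cc a else 0 :=
      fun i j => tv_apply _ _ _ _ _
    refine ⟨fun i j hij => ?_, fun i => ?_, fun i j hij => ?_⟩
    · rw [hv, if_neg hij.ne, if_neg, add_zero]
      rintro ⟨rfl, rfl⟩; exact absurd hij hpq.asymm
    · rw [hv, if_pos rfl, if_neg, add_zero]
      rintro ⟨rfl, rfl⟩; exact hpq.ne rfl
    · rw [hv, if_neg hij.ne', zero_add]
      split_ifs
      · obtain ⟨c', rfl⟩ := hc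
        refine ⟨cc c' / cc a, (Lam_cc _).div ha1, ?_⟩
        rw [show cc (4 * c') = 4 * cc c' by
          simp only [cc, map_mul]; rw [show algebraMap A K 4 = 4 from map_ofNat _ 4]]
        ring
      · exact Lam4_zero
  have e : y = u * b' := by
    ext i j
    have h1 : (u * b').1 i j = b'.1 i j + if i = q then (cc c / cc a) * b'.1 p j else 0 :=
      tv_mul_apply _ _ _ _ _ _
    have h2 : ∀ i j, b'.1 i j = bt p q (cc a) i *
        ((if i = j then 1 else 0) + if i = p ∧ j = q then cc b / cc a else 0) := by
      intro i j
      change (Matrix.diagonal (bt p q (cc a)) * Matrix.transvection p q (cc b / cc a)) i j = _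
      rw [Matrix.diagonal_mul, tv_apply]
    rw [h1, hy, h2, h2]
    have hne := hpq.ne
    have hne' := hpq.ne'
    unfold bt
    by_cases i1 : i = p
    · by_cases j1 : j = p
      · simp_all
      · by_cases j2 : j = q
        · simp_all; have ha2 := ha1.ne_zero; field_simp
        · have : p ≠ j := fun h => j1 h.symm
          simp_all
    · by_cases i2 : i = q
      · by_cases j1 : j = p
        · simp_all
        · by_cases j2 : j = q
          · simp_all; have ha2 := ha1.ne_zero; field_simp; linear_combination hdet'
          · have : p ≠ j := fun h => j1 h.symm
            have : q ≠ j := fun h => j2 h.symm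
            simp_all
      · simp_all
  rw [phi_eq hum hbm e]
  have B := blk_act (t := fun _ : Fin N => 1) (t' := bt p q (cc a)) (p := p)
    (q := q) (cc b / cc a)
  rw [lat, show Matrix.diagonal (fun _ : Fin N => (1 : K)) = 1 from Matrix.diagonal_one,
    act_one] at B
  have := B.ff_eq (BpG.odd hbm L0_odd) (fun k => by rw [mul_one]; exact hbt k) hpq
  refine this.trans ?_
  refine JJ_eq (p := a) (q := b) ⟨ha, ⟨d, -c, by linear_combination hdet⟩, ?_⟩
  simp only [bt, if_true, mul_one]
  field_simp

end SKN

set_option linter.unusedSectionVars false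

namespace SKN

abbrev SS (n : ℕ) := Matrix (Fin n) (Fin n) A
abbrev BM (d n : ℕ) := Matrix (Fin d) (Fin d) (SS n)

variable {d n : ℕ}

noncomputable def tau (d n : ℕ) : BM d n →+* MK (d * n) :=
  ((algebraMap A K).mapMatrix).comp
    (((Matrix.reindexAlgEquiv A A (finProdFinEquiv (m := d) (n := n))).toRingEquiv.toRingHom).comp
      (Matrix.compRingEquiv (Fin d) (Fin n) A).toRingHom)

lemma tau_apply (Y : BM d n) (i j : Fin d) (a b : Fin n) :
    tau d n Y (finProdFinEquiv (i, a)) (finProdFinEquiv (j, b)) = cc (Y i j a b) := by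
  simp [tau, cc]

lemma fin_lt (i j : Fin d) (a b : Fin n) :
    finProdFinEquiv (i, a) < finProdFinEquiv (j, b) ↔ i < j ∨ (i = j ∧ a < b) := by
  rw [Fin.lt_def, Fin.lt_def, Fin.lt_def, Fin.ext_iff]
  simp only [finProdFinEquiv_apply_val]
  have ha := a.2
  have hb := b.2
  constructor
  · intro h
    rcases lt_trichotomy (i : ℕ) j with h1 | h1 | h1
    · exact Or.inl h1
    · right; refine ⟨h1, ?_⟩; rw [h1] at h; omega
    · exfalso
      have : n * ((j : ℕ) + 1) ≤ n * i := Nat.mul_le_mul_left _ h1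
      rw [mul_add, mul_one] at this; omega
  · rintro (h1 | ⟨h1, h2⟩)
    · have : n * ((i : ℕ) + 1) ≤ n * j := Nat.mul_le_mul_left _ h1
      rw [mul_add, mul_one] at this; omega
    · rw [h1]; omega

noncomputable def tauU (d n : ℕ) : (BM d n)ˣ →* (MK (d * n))ˣ := Units.map (tau d n : _ →* _)

lemma tau_int (Y : BM d n) : isInt (tau d n Y) := by
  intro x y
  obtain ⟨⟨i, a⟩, rfl⟩ := finProdFinEquiv.surjective x
  obtain ⟨⟨j, b⟩, rfl⟩ := finProdFinEquiv.surjective y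
  exact ⟨_, tau_apply _ _ _ _ _⟩

lemma tauU_act (Y : (BM d n)ˣ) : act (tauU d n Y).1 (L0 (d * n)) = L0 (d * n) :=
  act_L0 (tau_int Y.1) (tau_int Y⁻¹.1)

lemma tau_lam (Y : BM d n) : LamM (tau d n Y) := by
  intro x y
  obtain ⟨a, ha⟩ := tau_int Y x y
  rw [ha]; exact Lam_cc a

lemma Lam4_cc {a : A} (h : 4 ∣ a) : Lam4 (cc a) := by
  obtain ⟨c', rfl⟩ := h
  refine ⟨cc c', (Lam_cc _), ?_⟩
  simp only [cc, map_mul]; rw [show algebraMap A K 4 = 4 from map_ofNat _ 4]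

noncomputable def G2 (d n : ℕ) : Subgroup (BM d n)ˣ := (G1 (d * n)).comap (tauU d n)

noncomputable def psi (Y : (BM d n)ˣ) : ℤ := phi (tauU d n Y)

lemma psi_sq (Y : (BM d n)ˣ) : psi Y * psi Y = 1 := phi_sq _

lemma psi_mul (hN : 2 ≤ d * n) {Y Z : (BM d n)ˣ} (hY : Y ∈ G2 d n) (hZ : Z ∈ G2 d n) :
    psi (Y * Z) = psi Y * psi Z := by
  unfold psi; rw [map_mul]; exact phi_mul hN hY hZ

lemma psi_one (hN : 2 ≤ d * n) : psi (1 : (BM d n)ˣ) = 1 := by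
  have h1 := psi_mul hN (one_mem (G2 d n)) (one_mem (G2 d n))
  have h2 := psi_sq (1 : (BM d n)ˣ)
  rw [one_mul, h2] at h1; exact h1

noncomputable def K2 (hN : 2 ≤ d * n) : Subgroup (BM d n)ˣ where
  carrier := {Y | Y ∈ G2 d n ∧ psi Y = 1}
  mul_mem' := by
    rintro a b ⟨h1, h2⟩ ⟨h3, h4⟩
    exact ⟨mul_mem h1 h3, by rw [psi_mul hN h1 h3, h2, h4, one_mul]⟩
  one_mem' := ⟨one_mem _, psi_one hN⟩
  inv_mem' := by
    rintro a ⟨h1, h2⟩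
    refine ⟨inv_mem h1, ?_⟩
    have := psi_mul hN (inv_mem h1) h1
    rw [inv_mul_cancel, psi_one hN, h2, mul_one] at this
    exact this.symm

lemma mem_G2 {Y : (BM d n)ˣ}
    (h1 : ∀ i j a b, (j < i ∨ (j = i ∧ b < a)) → (4 : A) ∣ Y.1 i j a b)
    (h2 : ∀ i a, prim (Y.1 i i a a)) : Y ∈ G2 d n := by
  refine ⟨⟨fun x y hxy => ?_, fun x => ?_, tau_lam _⟩, tauU_act Y⟩
  · obtain ⟨⟨i, a⟩, rfl⟩ := finProdFinEquiv.surjective x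
    obtain ⟨⟨j, b⟩, rfl⟩ := finProdFinEquiv.surjective y
    change Lam4 (tau d n Y.1 _ _)
    rw [tau_apply]
    exact Lam4_cc (h1 _ _ _ _ ((fin_lt _ _ _ _).1 hxy))
  · obtain ⟨⟨i, a⟩, rfl⟩ := finProdFinEquiv.surjective x
    change Lam1 (tau d n Y.1 _ _)
    rw [tau_apply]
    exact Lam1_cc (h2 _ _)

lemma mem_K2_lo (hN : 2 ≤ d * n) {Y : (BM d n)ˣ}
    (h0 : ∀ i j a b, (i < j ∨ (i = j ∧ a < b)) → Y.1 i j a b = 0)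
    (h1 : ∀ i j a b, (j < i ∨ (j = i ∧ b < a)) → (4 : A) ∣ Y.1 i j a b)
    (h2 : ∀ i a, Y.1 i i a a = 1) : Y ∈ K2 hN := by
  refine ⟨mem_G2 h1 fun i a => by rw [h2]; exact prim_one, phi_LP hN ?_⟩
  refine ⟨fun x y hxy => ?_, fun x => ?_, fun x y hxy => ?_⟩
  · obtain ⟨⟨i, a⟩, rfl⟩ := finProdFinEquiv.surjective x
    obtain ⟨⟨j, b⟩, rfl⟩ := finProdFinEquiv.surjective y
    change tau d n Y.1 _ _ = 0
    rw [tau_apply, h0 _ _ _ _ ((fin_lt _ _ _ _).1 hxy)]; simp [cc]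
  · obtain ⟨⟨i, a⟩, rfl⟩ := finProdFinEquiv.surjective x
    change tau d n Y.1 _ _ = 1
    rw [tau_apply, h2]; simp [cc]
  · obtain ⟨⟨i, a⟩, rfl⟩ := finProdFinEquiv.surjective x
    obtain ⟨⟨j, b⟩, rfl⟩ := finProdFinEquiv.surjective y
    change Lam4 (tau d n Y.1 _ _)
    rw [tau_apply]
    exact Lam4_cc (h1 _ _ _ _ ((fin_lt _ _ _ _).1 hxy))

lemma mem_K2_up (hN : 2 ≤ d * n) {Y : (BM d n)ˣ}
    (h1 : ∀ i j a b, (j < i ∨ (j = i ∧ b < a)) → Y.1 i j a b = 0)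
    (h2 : ∀ i a, prim (Y.1 i i a a)) : Y ∈ K2 hN := by
  have hG : Y ∈ G2 d n := mem_G2 (fun i j a b h => by rw [h1 _ _ _ _ h]; exact dvd_zero _) h2
  refine ⟨hG, phi_UP hN ?_ (tauU_act Y)⟩
  refine ⟨fun x y hxy => ?_, hG.1.dg, hG.1.lam⟩
  · obtain ⟨⟨i, a⟩, rfl⟩ := finProdFinEquiv.surjective x
    obtain ⟨⟨j, b⟩, rfl⟩ := finProdFinEquiv.surjective y
    change tau d n Y.1 _ _ = 0
    rw [tau_apply, h1 _ _ _ _ ((fin_lt _ _ _ _).1 hxy)]; simp [cc]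

/-- squares of matrices congruent to `1` mod `4` -/
lemma mem_G2_of_cong {Y : (BM d n)ˣ} {T : BM d n} (h : Y.1 = 1 + (4 : A) • T) : Y ∈ G2 d n := by
  have hv : ∀ i j a b, Y.1 i j a b = (if i = j ∧ a = b then 1 else 0) + 4 * T i j a b := by
    intro i j a b
    rw [h]
    simp only [Matrix.add_apply, Matrix.smul_apply, smul_eq_mul]
    congr 1
    by_cases hij : i = j
    · subst hij; simp [Matrix.one_apply]
    · simp [hij]
  refine mem_G2 (fun i j a b hh => ?_) (fun i a => ?_)
  · rw [hv, if_neg, zero_add]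
    · exact dvd_mul_right _ _
    · rintro ⟨rfl, rfl⟩; simp at hh
  · rw [hv, if_pos ⟨rfl, rfl⟩]
    exact prim_iff_exists.2 ⟨2 * T i i a a, by ring⟩

lemma sq_mem_K2 (hN : 2 ≤ d * n) {Y : (BM d n)ˣ} (h : Y ∈ G2 d n) : Y * Y ∈ K2 hN :=
  ⟨mul_mem h h, by rw [psi_mul hN h h, psi_sq]⟩

end SKN

set_option linter.unusedSectionVars false

namespace SKN

section jj
variable {S : Type*} [Ring S] {r : ℕ}

def jj (r : ℕ) : Matrix (Fin 2) (Fin 2) S →* Matrix (Fin (2 + r)) (Fin (2 + r)) S where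
  toFun m := (Matrix.fromBlocks m 0 0 1).submatrix finSumFinEquiv.symm finSumFinEquiv.symm
  map_one' := by rw [Matrix.fromBlocks_one, Matrix.submatrix_one_equiv]
  map_mul' m m' := by rw [Matrix.submatrix_mul_equiv, Matrix.fromBlocks_multiply]; simp

@[simp] lemma jj_cc (m : Matrix (Fin 2) (Fin 2) S) (a b : Fin 2) :
    jj r m (Fin.castAdd r a) (Fin.castAdd r b) = m a b := by
  simp [jj]
@[simp] lemma jj_cn (m : Matrix (Fin 2) (Fin 2) S) (a : Fin 2) (b : Fin r) :
    jj r m (Fin.castAdd r a) (Fin.natAdd 2 b) = 0 := by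
  simp [jj]
@[simp] lemma jj_nc (m : Matrix (Fin 2) (Fin 2) S) (a : Fin r) (b : Fin 2) :
    jj r m (Fin.natAdd 2 a) (Fin.castAdd r b) = 0 := by
  simp [jj]
@[simp] lemma jj_nn (m : Matrix (Fin 2) (Fin 2) S) (a b : Fin r) :
    jj r m (Fin.natAdd 2 a) (Fin.natAdd 2 b) = (1 : Matrix (Fin r) (Fin r) S) a b := by
  simp [jj]

lemma jj_map {S' : Type*} [Ring S'] (f : S →+* S') (m : Matrix (Fin 2) (Fin 2) S) :
    (jj r m).map f = jj r (m.map f) := by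
  ext i j
  rw [Matrix.map_apply]
  refine Fin.addCases (fun a => ?_) (fun a => ?_) i <;>
    refine Fin.addCases (fun b => ?_) (fun b => ?_) j
  · simp
  · simp
  · simp
  · simp [Matrix.one_apply, apply_ite f]

lemma jj_det {S : Type*} [CommRing S] (m : Matrix (Fin 2) (Fin 2) S) : (jj r m).det = m.det := by
  change ((Matrix.fromBlocks m 0 0 1).submatrix finSumFinEquiv.symm finSumFinEquiv.symm).det = _
  rw [Matrix.det_submatrix_equiv_self, Matrix.det_fromBlocks_zero₂₁, Matrix.det_one, mul_one]

def e12 (s : S) : (Matrix (Fin 2) (Fin 2) S)ˣ :=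
  ⟨!![1, s; 0, 1], !![1, -s; 0, 1], by simp [Matrix.one_fin_two], by simp [Matrix.one_fin_two]⟩
def e21 (s : S) : (Matrix (Fin 2) (Fin 2) S)ˣ :=
  ⟨!![1, 0; s, 1], !![1, 0; -s, 1], by simp [Matrix.one_fin_two], by simp [Matrix.one_fin_two]⟩
def d1 (p : Sˣ) : (Matrix (Fin 2) (Fin 2) S)ˣ :=
  ⟨!![p.1, 0; 0, 1], !![p⁻¹.1, 0; 0, 1], by simp [Matrix.one_fin_two], by
    simp [Matrix.one_fin_two]⟩
def d2 (p : Sˣ) : (Matrix (Fin 2) (Fin 2) S)ˣ :=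
  ⟨!![1, 0; 0, p.1], !![1, 0; 0, p⁻¹.1], by simp [Matrix.one_fin_two], by
    simp [Matrix.one_fin_two]⟩

def J (r : ℕ) : (Matrix (Fin 2) (Fin 2) S)ˣ →* (Matrix (Fin (2 + r)) (Fin (2 + r)) S)ˣ :=
  Units.map (jj r)

end jj

variable {n r : ℕ}

abbrev M2 (n : ℕ) := Matrix (Fin 2) (Fin 2) (SS n)

lemma castAdd_lt (a b : Fin 2) : Fin.castAdd r a < Fin.castAdd r b ↔ a < b := Iff.rfl

lemma castAdd_inj (a b : Fin 2) : Fin.castAdd r a = Fin.castAdd r b ↔ a = b := by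
  simp [Fin.ext_iff]

lemma J_gen (P : A → Prop) (hP : P 0) (R : ∀ m : ℕ, Fin m → Fin m → Prop)
    (hR : ∀ a b, R _ (Fin.castAdd r a) (Fin.castAdd r b) → R 2 a b)
    (hR' : ∀ m a, ¬ R m a a)
    (y : (M2 n)ˣ)
    (h : ∀ i j a b, (R _ i j ∨ (i = j ∧ R _ a b)) → P (y.1 i j a b)) (i j : Fin (2 + r))
    (a b : Fin n) (hh : R _ i j ∨ (i = j ∧ R _ a b)) : P ((J r y).1 i j a b) := by
  change P (jj r y.1 i j a b)
  revert hh
  refine Fin.addCases (fun i => ?_) (fun i => ?_) i <;>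
    refine Fin.addCases (fun j => ?_) (fun j => ?_) j <;> intro hh
  · rw [jj_cc]; apply h
    rcases hh with hh | ⟨h1, h2⟩
    · exact Or.inl (hR _ _ hh)
    · exact Or.inr ⟨(castAdd_inj _ _).1 h1, h2⟩
  · rw [jj_cn]; exact hP
  · rw [jj_nc]; exact hP
  · rw [jj_nn]
    by_cases hij : i = j
    · subst hij
      rcases hh with hh | ⟨h1, h2⟩
      · exact absurd hh (hR' _ _)
      · rw [Matrix.one_apply_eq, Matrix.one_apply_ne]
        · exact hP
        · rintro rfl; exact hR' _ _ h2
    · rw [Matrix.one_apply_ne hij]; exact hP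

lemma J_dg (P : A → Prop) (hP : P 1) (y : (M2 n)ˣ) (h : ∀ i a, P (y.1 i i a a)) (i : Fin (2 + r))
    (a : Fin n) : P ((J r y).1 i i a a) := by
  change P (jj r y.1 i i a a)
  refine Fin.addCases (fun i => ?_) (fun i => ?_) i
  · rw [jj_cc]; exact h _ _
  · rw [jj_nn]; simpa using hP

lemma or_swap {d n : ℕ} {i j : Fin d} {a b : Fin n} (h : j < i ∨ (j = i ∧ b < a)) :
    i > j ∨ (i = j ∧ a > b) := by
  rcases h with h | ⟨h, h'⟩
  · exact Or.inl h
  · exact Or.inr ⟨h.symm, h'⟩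

lemma or_swap' {d n : ℕ} {i j : Fin d} {a b : Fin n} (h : i > j ∨ (i = j ∧ a > b)) :
    j < i ∨ (j = i ∧ b < a) := by
  rcases h with h | ⟨h, h'⟩
  · exact Or.inl h
  · exact Or.inr ⟨h.symm, h'⟩

lemma J_lower (P : A → Prop) (hP : P 0) (y : (M2 n)ˣ)
    (h : ∀ i j a b, (j < i ∨ (j = i ∧ b < a)) → P (y.1 i j a b)) (i j : Fin (2 + r))
    (a b : Fin n) (hh : j < i ∨ (j = i ∧ b < a)) : P ((J r y).1 i j a b) :=
  J_gen P hP (fun _ i j => i > j) (fun a b h => (castAdd_lt _ _).1 h) (fun m a => lt_irrefl a) y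
    (fun i j a b hh => h i j a b (or_swap' hh)) i j a b (or_swap hh)

lemma J_upper (P : A → Prop) (hP : P 0) (y : (M2 n)ˣ)
    (h : ∀ i j a b, (i < j ∨ (i = j ∧ a < b)) → P (y.1 i j a b)) (i j : Fin (2 + r))
    (a b : Fin n) (hh : i < j ∨ (i = j ∧ a < b)) : P ((J r y).1 i j a b) :=
  J_gen P hP (fun _ i j => i < j) (fun a b h => (castAdd_lt _ _).1 h) (fun m a => lt_irrefl a) y
    h i j a b hh

lemma J_mem_G2 {y : (M2 n)ˣ}
    (h1 : ∀ i j a b, (j < i ∨ (j = i ∧ b < a)) → (4 : A) ∣ y.1 i j a b)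
    (h2 : ∀ i a, prim (y.1 i i a a)) : J r y ∈ G2 (2 + r) n :=
  mem_G2 (J_lower _ (dvd_zero _) y h1) (J_dg _ prim_one y h2)

lemma J_mem_lo (hN : 2 ≤ (2 + r) * n) {y : (M2 n)ˣ}
    (h0 : ∀ i j a b, (i < j ∨ (i = j ∧ a < b)) → y.1 i j a b = 0)
    (h1 : ∀ i j a b, (j < i ∨ (j = i ∧ b < a)) → (4 : A) ∣ y.1 i j a b)
    (h2 : ∀ i a, y.1 i i a a = 1) : J r y ∈ K2 hN :=
  mem_K2_lo hN (J_upper (· = 0) rfl y h0) (J_lower _ (dvd_zero _) y h1) (J_dg (· = 1) rfl y h2)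

lemma J_mem_up (hN : 2 ≤ (2 + r) * n) {y : (M2 n)ˣ}
    (h1 : ∀ i j a b, (j < i ∨ (j = i ∧ b < a)) → y.1 i j a b = 0)
    (h2 : ∀ i a, prim (y.1 i i a a)) : J r y ∈ K2 hN :=
  mem_K2_up hN (J_lower (· = 0) rfl y h1) (J_dg _ prim_one y h2)

lemma e12_mem (hN : 2 ≤ (2 + r) * n) (s : SS n) : J r (e12 s) ∈ K2 hN := by
  apply J_mem_up
  · intro i j a b h
    fin_cases i <;> fin_cases j <;> simp_all [e12, Matrix.one_apply] 
    intro h'; subst h'; simp at h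
    intro h'; subst h'; simp at h
  · intro i a
    fin_cases i <;> simp [e12, prim_one]

lemma e21_mem (hN : 2 ≤ (2 + r) * n) {s : SS n} (hs : ∀ a b, 4 ∣ s a b) :
    J r (e21 s) ∈ K2 hN := by
  apply J_mem_lo
  · intro i j a b h
    fin_cases i <;> fin_cases j <;> simp_all [e21, Matrix.one_apply] 
    intro h'; subst h'; simp at h
    intro h'; subst h'; simp at h
  · intro i j a b h
    fin_cases i <;> fin_cases j <;> simp_all [e21, Matrix.one_apply] 
    rw [if_neg h.ne']; exact dvd_zero _
    rw [if_neg h.ne']; exact dvd_zero _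
  · intro i a
    fin_cases i <;> simp [e21]

structure LA (p : SS n) : Prop where
  up : ∀ a b, a < b → p a b = 0
  lo : ∀ a b, b < a → 4 ∣ p a b
  dg : ∀ a, p a a = 1

structure UA (p : SS n) : Prop where
  lo : ∀ a b, b < a → p a b = 0
  dg : ∀ a, p a a = 1

lemma one_lo {a b : Fin n} (h : b < a) : (1 : SS n) a b = 0 := Matrix.one_apply_ne h.ne'
lemma one_up {a b : Fin n} (h : a < b) : (1 : SS n) a b = 0 := Matrix.one_apply_ne h.ne

lemma d1_lo (hN : 2 ≤ (2 + r) * n) {p : (SS n)ˣ} (h : LA p.1) : J r (d1 p) ∈ K2 hN := by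
  apply J_mem_lo
  · intro i j a b hh
    fin_cases i <;> fin_cases j <;> simp_all [d1, h.up, one_up]
  · intro i j a b hh
    fin_cases i <;> fin_cases j <;> simp_all [d1, h.lo, one_lo]
  · intro i a
    fin_cases i <;> simp [d1, h.dg]

lemma d2_lo (hN : 2 ≤ (2 + r) * n) {p : (SS n)ˣ} (h : LA p.1) : J r (d2 p) ∈ K2 hN := by
  apply J_mem_lo
  · intro i j a b hh
    fin_cases i <;> fin_cases j <;> simp_all [d2, h.up, one_up]
  · intro i j a b hh
    fin_cases i <;> fin_cases j <;> simp_all [d2, h.lo, one_lo]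
  · intro i a
    fin_cases i <;> simp [d2, h.dg]

lemma d1_up (hN : 2 ≤ (2 + r) * n) {p : (SS n)ˣ} (h : UA p.1) : J r (d1 p) ∈ K2 hN := by
  apply J_mem_up
  · intro i j a b hh
    fin_cases i <;> fin_cases j <;> simp_all [d1, h.lo, one_lo]
  · intro i a
    fin_cases i <;> simp [d1, h.dg, prim_one]

lemma d2_up (hN : 2 ≤ (2 + r) * n) {p : (SS n)ˣ} (h : UA p.1) : J r (d2 p) ∈ K2 hN := by
  apply J_mem_up
  · intro i j a b hh
    fin_cases i <;> fin_cases j <;> simp_all [d2, h.lo, one_lo]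
  · intro i a
    fin_cases i <;> simp [d2, h.dg, prim_one]

lemma LA.unit {p : SS n} (h : LA p) : ∃ u : (SS n)ˣ, u.1 = p := by
  have ht : p.BlockTriangular OrderDual.toDual := fun i j hij => h.up i j hij
  have hd : p.det = 1 := by
    rw [Matrix.det_of_isLowerTriangular _ ht]; exact Finset.prod_eq_one fun i _ => h.dg i
  exact (Matrix.isUnit_iff_isUnit_det p).2 (by rw [hd]; exact isUnit_one)

lemma UA.unit {p : SS n} (h : UA p) : ∃ u : (SS n)ˣ, u.1 = p := by
  have ht : p.BlockTriangular id := fun i j hij => h.lo i j hij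
  have hd : p.det = 1 := by
    rw [Matrix.det_of_isUpperTriangular ht]; exact Finset.prod_eq_one fun i _ => h.dg i
  exact (Matrix.isUnit_iff_isUnit_det p).2 (by rw [hd]; exact isUnit_one)

end SKN

set_option linter.unusedSectionVars false

namespace SKN

variable {n r : ℕ}

def cI : A := (1 + iA) ^ 7

lemma iA_sq : iA ^ 2 = -1 := by rw [sq]; exact iA_mul

lemma cI_eq : cI = 8 - 8 * iA := by
  have h := iA_sq
  unfold cI
  linear_combination (iA^5 + 7 * iA^4 + 20 * iA^3 + 28 * iA^2 + 15 * iA - 7) * h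

lemma cI_mul : (1 + iA) * cI = 16 := by
  rw [cI_eq]
  linear_combination (-8) * iA_sq

theorem test_ne (hN : 2 ≤ (2 + r) * n) {H B E : SS n} (hH : ∀ a, H a a = 0) (y : (M2 n)ˣ)
    (hy : y.1 = !![1 - 4 * H, B; algebraMap A (SS n) cI, E])
    (hdet : (1 - 4 * H) * E = algebraMap A (SS n) cI * B + 1) : J r y ∈ K2 hN := by
  set C := algebraMap A (SS n) cI with hC
  let L : SS n := Matrix.of fun a b => if b < a then H a b else 0
  let U : SS n := Matrix.of fun a b => if a < b then H a b else 0
  have hLU : H = L + U := by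
    ext1 a b
    rcases lt_trichotomy a b with h | h | h
    · simp [L, U, h, h.not_gt]
    · subst h; simp [L, U, hH]
    · simp [L, U, h, h.not_gt]
  have h4 : ∀ (M : SS n) a b, (4 * M) a b = 4 * M a b := by
    intro M a b
    rw [show (4 : SS n) * M = (4 : A) • M by
      rw [Algebra.smul_def]; rfl]
    simp
  have hl : LA (1 + 4 * L) := by
    refine ⟨fun a b h => ?_, fun a b h => ?_, fun a => ?_⟩
    · rw [Matrix.add_apply, one_up h, h4]; simp [L, h.not_gt]
    · rw [Matrix.add_apply, one_lo h, h4, zero_add]; exact dvd_mul_right _ _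
    · rw [Matrix.add_apply, h4]; simp [L]
  have hu : UA (1 + 4 * U) := by
    refine ⟨fun a b h => ?_, fun a => ?_⟩
    · rw [Matrix.add_apply, one_lo h, h4]; simp [U, h.not_gt]
    · rw [Matrix.add_apply, h4]; simp [U]
  obtain ⟨Xl, hXl⟩ := hl.unit
  obtain ⟨Xr, hXr⟩ := hu.unit
  let S' : SS n := -(U * U) - L * L - 4 * (L * L * U) - L * U - 4 * (L * U * U)
  have hS : Xl.1 * (1 - 4 * H) * Xr.1 = 1 + 16 * S' := by
    rw [hXl, hXr, hLU]; simp only [S']; noncomm_ring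
  let σ : SS n := algebraMap A (SS n) (1 + iA) * S'
  have hCc : ∀ M : SS n, C * M = M * C := fun M => Algebra.commutes _ _
  have hCs : C * σ = 16 * S' := by
    simp only [σ]
    rw [← mul_assoc, hC, ← map_mul, mul_comm cI, cI_mul, map_ofNat]
  have hsC : σ * C = 16 * S' := by rw [← hCc, hCs]
  let W : SS n := Xr⁻¹.1
  have hW : Xr.1 * W = 1 := Xr.mul_inv
  let B3 : SS n := Xl.1 * B - σ * (W * E)
  have hXa : Xl.1 * (1 - 4 * H) = (1 + 16 * S') * W := by
    rw [← hS, mul_assoc, hW, mul_one]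
  have key : C * B3 + Xl.1 = W * E := by
    have e1 : C * (Xl.1 * B) + Xl.1 = (1 + 16 * S') * W * E := by
      rw [← hXa, mul_assoc, hdet, mul_add, mul_one, ← mul_assoc, hCc, mul_assoc]
    have e2 : C * (σ * (W * E)) = 16 * S' * (W * E) := by rw [← mul_assoc, hCs]
    simp only [B3]
    rw [mul_sub, e2, sub_add_eq_add_sub, e1]; noncomm_ring
  have hun : d1 Xl * y * d1 Xr = d2 Xr * e12 σ * e21 C * d2 Xl * e12 B3 := by
    apply Units.ext
    have k2 : Xr.1 * (C * B3 + Xl.1) = E := by rw [key, ← mul_assoc, hW, one_mul]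
    have k3 : B3 + σ * (C * B3 + Xl.1) = Xl.1 * B := by rw [key]; simp only [B3]; abel
    simp only [Units.val_mul, hy]
    simp only [d1, d2, e12, e21, Matrix.mul_fin_two]
    congr 1
    simp only [mul_one, mul_zero, zero_mul, one_mul, add_zero, zero_add]
    rw [hS, hsC, hCc Xr.1, ← k2, ← k3, ← hsC]
    congr 2
    · congr 1
      noncomm_ring
    · congr 2
      noncomm_ring
  have h8 : ∀ a b, 4 ∣ C a b := by
    intro a b
    rw [hC, Matrix.algebraMap_matrix_apply]
    split_ifs
    · exact ⟨2 - 2 * iA, by simp only [Algebra.algebraMap_self, RingHom.id_apply]; rw [cI_eq]; ring⟩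
    · exact dvd_zero _
  have hl' : LA Xl.1 := hXl ▸ hl
  have hu' : UA Xr.1 := hXr ▸ hu
  have hy' : y = (d1 Xl)⁻¹ * (d2 Xr * e12 σ * e21 C * d2 Xl * e12 B3) * (d1 Xr)⁻¹ := by
    rw [← hun]; group
  rw [hy']
  simp only [map_mul, map_inv]
  exact mul_mem (mul_mem (inv_mem (d1_lo hN hl')) (mul_mem (mul_mem (mul_mem (mul_mem
    (d2_up hN hu') (e12_mem hN _)) (e21_mem hN h8)) (d2_lo hN hl')) (e12_mem hN _)))
    (inv_mem (d1_up hN hu'))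

def Del (n : ℕ) : (Fin n → Matrix (Fin 2) (Fin 2) A) →* M2 n where
  toFun f := Matrix.of fun i j => Matrix.diagonal fun k => f k i j
  map_one' := by
    refine Matrix.ext fun i j => Matrix.ext fun a b => ?_
    by_cases hij : i = j
    · subst hij; by_cases hab : a = b
      · subst hab; simp
      · simp [hab]
    · simp [hij]
  map_mul' f g := by
    ext1 i j
    simp only [Matrix.of_apply, Matrix.mul_apply, Fin.sum_univ_two, Pi.mul_apply,
      Matrix.diagonal_mul_diagonal, Matrix.diagonal_add]

lemma Del_apply (f) (i j : Fin 2) (a b : Fin n) :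
    Del n f i j a b = if a = b then f a i j else 0 := by
  simp [Del, Matrix.diagonal_apply]

def DelU (n : ℕ) (f : Fin n → (Matrix (Fin 2) (Fin 2) A)ˣ) : (M2 n)ˣ :=
  Units.map (Del n) (MulEquiv.piUnits.symm f)

lemma DelU_mul (f g : Fin n → (Matrix (Fin 2) (Fin 2) A)ˣ) : DelU n (f * g) = DelU n f * DelU n g := by
  simp [DelU]

lemma DelU_apply (f : Fin n → (Matrix (Fin 2) (Fin 2) A)ˣ) (i j : Fin 2) (a b : Fin n) :
    (DelU n f).1 i j a b = if a = b then (f a).1 i j else 0 := Del_apply _ _ _ _ _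

theorem test_eq (hN : 2 ≤ (2 + r) * n) {a b c d : A} (ha : prim a) (hd : prim d) (hc : 4 ∣ c)
    (hdet : a * d - b * c = 1) (y : (M2 n)ˣ)
    (hy : y.1 = !![algebraMap A (SS n) a, algebraMap A (SS n) b; algebraMap A (SS n) c,
      algebraMap A (SS n) d]) : psi (J r y) = (sym b a) ^ n := by
  have hu : IsUnit (!![a, b; c, d] : Matrix (Fin 2) (Fin 2) A) := by
    rw [Matrix.isUnit_iff_isUnit_det, Matrix.det_fin_two_of, hdet]; exact isUnit_one
  obtain ⟨g, hg⟩ := hu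
  let F : Finset (Fin n) → Fin n → (Matrix (Fin 2) (Fin 2) A)ˣ := fun T k => if k ∈ T then g else 1
  have hmem : ∀ T, J r (DelU n (F T)) ∈ G2 (2 + r) n := by
    intro T
    apply J_mem_G2
    · intro i j a' b' h
      rw [DelU_apply]
      split_ifs with hab
      · subst hab
        have hji : j < i := by simpa using h
        have : i = 1 ∧ j = 0 := by omega
        obtain ⟨rfl, rfl⟩ := this
        simp only [F]
        split_ifs
        · rw [hg]; simpa using hc
        · simp
      · exact dvd_zero _
    · intro i a'
      rw [DelU_apply, if_pos rfl]
      simp only [F]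
      split_ifs
      · rw [hg]; fin_cases i
        · simpa using ha
        · simpa using hd
      · simp [prim_one]
  have hsing : ∀ k : Fin n, psi (J r (DelU n (F {k}))) = sym b a := by
    intro k
    have h01 : finProdFinEquiv (Fin.castAdd r (0 : Fin 2), k) <
        finProdFinEquiv (Fin.castAdd r (1 : Fin 2), k) := by
      rw [fin_lt]; left; rw [castAdd_lt]; decide
    refine phi_pair h01 ha hc hdet ?_
    intro x y
    obtain ⟨⟨i, s⟩, rfl⟩ := finProdFinEquiv.surjective x
    obtain ⟨⟨j, t⟩, rfl⟩ := finProdFinEquiv.surjective y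
    change tau (2 + r) n (jj r (DelU n (F {k})).1) _ _ = _
    rw [tau_apply]
    simp only [finProdFinEquiv.injective.eq_iff, Prod.mk.injEq]
    refine Fin.addCases (fun i => ?_) (fun i => ?_) i <;>
      refine Fin.addCases (fun j => ?_) (fun j => ?_) j
    · rw [jj_cc, DelU_apply]
      simp only [castAdd_inj, F, Finset.mem_singleton]
      by_cases hs : s = k
      · subst hs
        by_cases ht : s = t
        · subst ht
          rw [if_pos rfl, if_pos rfl, hg]
          fin_cases i <;> fin_cases j <;> simp
        · have ht' : t ≠ s := fun h => ht h.symm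
          simp [ht, ht', cc]
      · by_cases ht : s = t
        · subst ht
          fin_cases i <;> fin_cases j <;> simp [hs, cc]
        · simp [hs, ht, cc]
    · rw [jj_cn]
      have h1 : ∀ u : Fin 2, Fin.natAdd 2 j ≠ Fin.castAdd r u := by
        intro u h; rw [Fin.ext_iff] at h; simp at h; omega
      have h2 : ∀ u : Fin 2, Fin.castAdd r u ≠ Fin.natAdd 2 j := fun u h => h1 u h.symm
      simp [h1, h2, cc]
    · rw [jj_nc]
      have h1 : ∀ u : Fin 2, Fin.natAdd 2 i ≠ Fin.castAdd r u := by
        intro u h; rw [Fin.ext_iff] at h; simp at h; omega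
      simp [h1, cc]
    · rw [jj_nn]
      have h1 : ∀ u : Fin 2, Fin.natAdd 2 i ≠ Fin.castAdd r u := by
        intro u h; rw [Fin.ext_iff] at h; simp at h; omega
      simp only [h1, false_and, if_false]
      by_cases hij : i = j
      · subst hij
        by_cases hst : s = t
        · subst hst; simp [cc]
        · simp [hst, cc]
      · have : Fin.natAdd 2 i ≠ Fin.natAdd 2 j := fun h => hij (by simpa using h)
        simp [this, hij, cc]
  have hall : ∀ T : Finset (Fin n), psi (J r (DelU n (F T))) = (sym b a) ^ T.card := by
    intro T
    induction T using Finset.induction_on with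
    | empty =>
      have : DelU n (F ∅) = 1 := by
        have : F ∅ = 1 := by funext k; simp [F]
        rw [this]; simp [DelU]
      rw [this, map_one, psi_one hN]; simp
    | insert k T hk ih =>
      have : F (insert k T) = F {k} * F T := by
        funext l
        simp only [F, Pi.mul_apply, Finset.mem_insert, Finset.mem_singleton]
        by_cases hl : l = k
        · subst hl; simp [hk]
        · simp [hl]
      rw [this, DelU_mul, map_mul, psi_mul hN (hmem _) (hmem _), ih, hsing,
        Finset.card_insert_of_notMem hk, pow_succ']
  have : y = DelU n (F Finset.univ) := by
    apply Units.ext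
    refine Matrix.ext fun i j => Matrix.ext fun s t => ?_
    rw [DelU_apply, hy]
    simp only [F, Finset.mem_univ, if_true, hg]
    fin_cases i <;> fin_cases j <;> simp [Matrix.algebraMap_matrix_apply]
  rw [this, hall]; simp

/-- the value needed -/
lemma sym_special {ε : A} (h : ε = iA ∨ ε = -iA) : sym (-(1 + iA) ^ 9 * ε ^ 4) (1 - 4 * ε) = -1 := by
  have hp : prim (1 - 4 * ε) := prim_iff_exists.2 ⟨-2 * ε, by ring⟩
  have h4 : ε ^ 4 = 1 := by
    rcases h with rfl | rfl
    · linear_combination (iA ^ 2 - 1) * iA_sq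
    · linear_combination (iA ^ 2 - 1) * iA_sq
  have hpow : ∀ k : ℕ, sym ((1 + iA) ^ k) (1 - 4 * ε) = (-1) ^ k := by
    intro k
    induction k with
    | zero => simp [sym_one_left hp]
    | succ k ih => rw [pow_succ, sym_mul _ _ hp, ih, sym_one_add_iA_special ε h, pow_succ]
  rw [h4, mul_one, sym_neg _ hp, hpow]; norm_num

end SKN

set_option linter.unusedSectionVars false

namespace SKN

open Polynomial

def Cn (n : ℕ) : SS n := Matrix.of fun a b => if (a.1 + 1) % n = b.1 then iA else 0

lemma Cn_pow (n l : ℕ) (a b : Fin n) :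
    (Cn n ^ l) a b = if (a.1 + l) % n = b.1 then iA ^ l else 0 := by
  induction l generalizing b with
  | zero =>
    rw [pow_zero, pow_zero, add_zero, Nat.mod_eq_of_lt a.2, Matrix.one_apply]
    simp [Fin.ext_iff]
  | succ l ih =>
    rw [pow_succ, Matrix.mul_apply]
    have hn : 0 < n := a.pos
    rw [Finset.sum_eq_single (⟨(a.1 + l) % n, Nat.mod_lt _ hn⟩ : Fin n)]
    · rw [ih, if_pos rfl]
      simp only [Cn, Matrix.of_apply, Nat.mod_add_mod]
      rw [← add_assoc]
      split_ifs
      · rw [pow_succ]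
      · simp
    · intro c _ hc
      rw [ih, if_neg, zero_mul]
      intro h; apply hc; exact Fin.ext h.symm
    · simp

lemma Cn_pow_dvd {n l : ℕ} (h : n ∣ l) : Cn n ^ l = algebraMap A (SS n) (iA ^ l) := by
  refine Matrix.ext fun a b => ?_
  obtain ⟨q, rfl⟩ := h
  rw [Cn_pow, Matrix.algebraMap_matrix_apply, Nat.add_mul_mod_self_left, Nat.mod_eq_of_lt a.2]
  simp [Fin.ext_iff]

lemma Cn_pow_diag {n l : ℕ} (h : ¬ n ∣ l) (a : Fin n) : (Cn n ^ l) a a = 0 := by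
  rw [Cn_pow, if_neg]
  intro h'
  apply h
  have h2 : (a.1 + l) ≡ a.1 + 0 [MOD n] := by
    unfold Nat.ModEq; rw [h', add_zero, Nat.mod_eq_of_lt a.2]
  exact (Nat.modEq_zero_iff_dvd).1 (Nat.ModEq.add_left_cancel' _ h2)

noncomputable def ev (n : ℕ) : ℤ[X] →+* SS n := (aeval (Cn n)).toRingHom

lemma ev_X (n : ℕ) : ev n X = Cn n := by simp [ev]

noncomputable def rho (d n : ℕ) : Matrix.SpecialLinearGroup (Fin d) ℤ[X] →* (BM d n)ˣ :=
  MonoidHom.toHomUnits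
    { toFun := fun g => g.1.map (ev n)
      map_one' := by
        change ((ev n).mapMatrix (1 : Matrix (Fin d) (Fin d) ℤ[X])) = 1
        exact map_one _
      map_mul' := fun g h => by
        change (ev n).mapMatrix (g.1 * h.1) = (ev n).mapMatrix g.1 * (ev n).mapMatrix h.1
        exact map_mul _ _ _ }

lemma rho_val (d n : ℕ) (g : Matrix.SpecialLinearGroup (Fin d) ℤ[X]) :
    (rho d n g).1 = g.1.map (ev n) := rfl

noncomputable def I8 (n : ℕ) : Ideal ℤ[X] where
  carrier := {u | ∃ M : SS n, ev n u = (8 : A) • M}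
  zero_mem' := ⟨0, by simp⟩
  add_mem' := by
    rintro u v ⟨M, hM⟩ ⟨N, hN⟩
    exact ⟨M + N, by rw [map_add, hM, hN, smul_add]⟩
  smul_mem' := by
    rintro c u ⟨M, hM⟩
    exact ⟨ev n c * M, by rw [smul_eq_mul, map_mul, hM, mul_smul_comm]⟩

lemma mem_I8 {n : ℕ} {u : ℤ[X]} : u ∈ I8 n ↔ ∃ M : SS n, ev n u = (8 : A) • M := Iff.rfl

lemma finite_quot {ι : Type*} [Finite ι] (N : ι → ℕ) : Finite (ℤ[X] ⧸ ⨅ j, I8 (N j)) := by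
  let F : ℤ[X] → ((j : ι) → Fin (N j) → Fin (N j) → ZMod 8 × ZMod 8) := fun u j a b =>
    (((ev (N j) u a b).re : ZMod 8), ((ev (N j) u a b).im : ZMod 8))
  refine Finite.of_injective (fun q : ℤ[X] ⧸ ⨅ j, I8 (N j) => F (Quotient.out q)) ?_
  intro p q h
  have h1 : Quotient.out p - Quotient.out q ∈ ⨅ j, I8 (N j) := by
    rw [Ideal.mem_iInf]
    intro j
    rw [mem_I8]
    have h2 : ∀ a b, ∃ c : A, ev (N j) (Quotient.out p - Quotient.out q) a b = 8 * c := by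
      intro a b
      have h3 := congrFun (congrFun (congrFun h j) a) b
      simp only [F, Prod.mk.injEq] at h3
      obtain ⟨h4, h5⟩ := h3
      rw [ZMod.intCast_eq_intCast_iff_dvd_sub] at h4 h5
      obtain ⟨s, hs⟩ := h4
      obtain ⟨t, ht⟩ := h5
      refine ⟨⟨-s, -t⟩, ?_⟩
      rw [map_sub, Matrix.sub_apply]
      rw [show (8 : A) = ⟨8, 0⟩ from rfl]
      apply Zsqrtd.ext
      · simp only [Zsqrtd.re_sub, Zsqrtd.re_mul]; push_cast at hs; linarith
      · simp only [Zsqrtd.im_sub, Zsqrtd.im_mul]; push_cast at ht; linarith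
    choose c hc using h2
    exact ⟨Matrix.of c, Matrix.ext fun a b => by rw [hc]; simp⟩
  have h2 := Ideal.Quotient.eq.2 h1
  have e : ∀ x : ℤ[X] ⧸ ⨅ j, I8 (N j), Ideal.Quotient.mk _ (Quotient.out x) = x := fun x =>
    Quotient.out_eq x
  rwa [e, e] at h2

lemma rho_EL {d n : ℕ} (hN : 2 ≤ d * n) {U : Ideal ℤ[X]} (hU : U ≤ I8 n) :
    EL d U ≤ (K2 hN).comap (rho d n) := by
  unfold EL Subgroup.normalClosure
  rw [Subgroup.closure_le]
  intro g hg
  obtain ⟨e, ⟨i, j, hij, u, hu, rfl⟩, hc⟩ := Group.mem_conjugatesOfSet_iff.1 hg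
  obtain ⟨h, rfl⟩ := isConj_iff.1 hc
  obtain ⟨M, hM⟩ := mem_I8.1 (hU hu)
  have this : (Matrix.single i j M : BM d n) * Matrix.single i j M = 0 := by
    simp [hij.symm]
  let V : (BM d n)ˣ := ⟨1 + (4 : A) • Matrix.single i j M, 1 - (4 : A) • Matrix.single i j M, by
    simp only [mul_sub, add_mul, mul_one, one_mul, smul_mul_assoc, mul_smul_comm, this,
      smul_zero, add_zero, add_sub_cancel_right], by
    simp only [mul_add, sub_mul, mul_one, one_mul, smul_mul_assoc, mul_smul_comm, this,
      smul_zero, sub_zero, sub_add_cancel]⟩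
  have hV : rho d n (elem i j hij u) = V * V := by
    apply Units.ext
    rw [rho_val, Units.val_mul]
    simp only [elem, Matrix.transvection, V]
    have h1 : (1 + Matrix.single i j u).map (ev n) = 1 + Matrix.single i j (ev n u) := by
      change (ev n).mapMatrix _ = _
      rw [map_add, map_one]
      congr 1
      ext1 a b
      simp only [RingHom.mapMatrix_apply, Matrix.map_apply, Matrix.single_apply, apply_ite (ev n), map_zero]
    rw [h1, hM]
    simp only [mul_add, add_mul, mul_one, one_mul, smul_mul_assoc, mul_smul_comm, this, smul_zero,
      add_zero]
    rw [add_assoc, ← add_smul]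
    congr 1
    rw [Matrix.smul_single]; norm_num
  change rho d n (h * elem i j hij u * h⁻¹) ∈ K2 hN
  rw [map_mul, map_mul, map_inv, hV]
  have : rho d n h * (V * V) * (rho d n h)⁻¹ = (rho d n h * V * (rho d n h)⁻¹) *
      (rho d n h * V * (rho d n h)⁻¹) := by group
  rw [this]
  apply sq_mem_K2
  refine mem_G2_of_cong (T := (rho d n h).1 * Matrix.single i j M * (rho d n h)⁻¹.1) ?_
  rw [Units.val_mul, Units.val_mul]
  simp only [V, mul_add, add_mul, mul_one, mul_smul_comm, smul_mul_assoc]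
  rw [Units.mul_inv]

lemma rho_cong {d n : ℕ} {U : Ideal ℤ[X]} (hU : U ≤ I8 n)
    {g : Matrix.SpecialLinearGroup (Fin d) ℤ[X]} (hg : g ∈ congSubgroup d U) :
    rho d n g ∈ G2 d n := by
  have h1 : ∀ i j, g.1 i j - (1 : Matrix (Fin d) (Fin d) ℤ[X]) i j ∈ I8 n := by
    intro i j
    apply hU
    rw [← Ideal.Quotient.eq]
    have h2 := congrArg (fun m => m.1 i j) (MonoidHom.mem_ker.1 hg)
    refine (Eq.trans h2 ?_)
    by_cases hij : i = j
    · subst hij; simp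
    · simp [hij]
  choose M hM using fun i j => mem_I8.1 (h1 i j)
  refine mem_G2_of_cong (T := Matrix.of fun i j => (2 : A) • M i j) ?_
  rw [rho_val]
  ext1 i j
  have h3 := hM i j
  rw [map_sub, sub_eq_iff_eq_add] at h3
  rw [Matrix.map_apply, h3, Matrix.add_apply, Matrix.smul_apply, Matrix.of_apply, smul_smul,
    add_comm]
  congr 1
  · by_cases hij : i = j
    · subst hij; simp
    · simp [hij]

end SKN

set_option linter.unusedSectionVars false

namespace SKN

open Polynomial

abbrev SL2 := Matrix.SpecialLinearGroup (Fin 2) ℤ[X]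

def SLJ {S : Type*} [CommRing S] (r : ℕ) :
    Matrix.SpecialLinearGroup (Fin 2) S →* Matrix.SpecialLinearGroup (Fin (2 + r)) S where
  toFun g := ⟨jj r g.1, by rw [jj_det]; exact g.2⟩
  map_one' := Subtype.ext (map_one (jj r))
  map_mul' g h := Subtype.ext (map_mul (jj r) g.1 h.1)

lemma rho_SLJ (r n : ℕ) (g : SL2) : rho (2 + r) n (SLJ r g) = J r (rho 2 n g) := by
  apply Units.ext
  exact jj_map (ev n) g.1

def f12 {S : Type*} [CommRing S] (s : S) : Matrix.SpecialLinearGroup (Fin 2) S :=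
  ⟨!![1, s; 0, 1], by simp⟩
def f21 {S : Type*} [CommRing S] (s : S) : Matrix.SpecialLinearGroup (Fin 2) S :=
  ⟨!![1, 0; s, 1], by simp⟩

lemma rho_f12 (n : ℕ) (s : ℤ[X]) : rho 2 n (f12 s) = e12 (ev n s) := by
  apply Units.ext
  rw [rho_val]
  ext1 i j
  fin_cases i <;> fin_cases j <;> simp [f12, e12]

lemma rho_f21 (n : ℕ) (s : ℤ[X]) : rho 2 n (f21 s) = e21 (ev n s) := by
  apply Units.ext
  rw [rho_val]
  ext1 i j
  fin_cases i <;> fin_cases j <;> simp [f21, e21]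

variable {S : Type*} [CommRing S]

def gt (z h : S) : Matrix.SpecialLinearGroup (Fin 2) S :=
  ⟨!![1 + z ^ 4 * h, -z ^ 9 * h ^ 4; z ^ 7, (1 - z ^ 4 * h) * (1 + (z ^ 4 * h) ^ 2)], by
    rw [Matrix.det_fin_two_of]; ring⟩

def wt (z h : S) : Matrix.SpecialLinearGroup (Fin 2) S :=
  f21 (-(z ^ 4 * h) * ((1 - z ^ 4 * h) * (1 + (z ^ 4 * h) ^ 2))) * f12 1 * f21 (z ^ 4 * h) *
    f12 (-((1 - z ^ 4 * h) * (1 + (z ^ 4 * h) ^ 2)))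

lemma gt_wt {z : S} (h : S) (hz : z ^ 7 = 0) : gt z h = wt z h := by
  apply Subtype.ext
  change !![1 + z ^ 4 * h, -z ^ 9 * h ^ 4; z ^ 7, (1 - z ^ 4 * h) * (1 + (z ^ 4 * h) ^ 2)] =
    !![1, 0; -(z ^ 4 * h) * ((1 - z ^ 4 * h) * (1 + (z ^ 4 * h) ^ 2)), 1] * !![1, 1; 0, 1] *
      !![1, 0; z ^ 4 * h, 1] * !![1, -((1 - z ^ 4 * h) * (1 + (z ^ 4 * h) ^ 2)); 0, 1]
  rw [Matrix.mul_fin_two, Matrix.mul_fin_two, Matrix.mul_fin_two]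
  ext1 i j
  fin_cases i <;> fin_cases j <;> simp only [Fin.zero_eta, Fin.mk_one, Matrix.of_apply,
    Matrix.cons_val', Matrix.cons_val_zero, Matrix.cons_val_one, Matrix.cons_val_fin_one]
  · ring
  · linear_combination (-z ^ 2 * h ^ 4 - z ^ 9 * h ^ 4) * hz
  · linear_combination (1 - z ^ 13 * h ^ 5) * hz
  · linear_combination (-z ^ 9 * h ^ 4 + z ^ 13 * h ^ 5 *
      ((1 - z ^ 4 * h) * (1 + (z ^ 4 * h) ^ 2))) * hz

lemma map_gt {S' : Type*} [CommRing S'] (f : S →+* S') (z h : S) :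
    Matrix.SpecialLinearGroup.map f (gt z h) = gt (f z) (f h) := by
  apply Subtype.ext
  change (gt z h).1.map f = (gt (f z) (f h)).1
  ext1 i j
  fin_cases i <;> fin_cases j <;> simp [gt]

lemma map_f12 {S' : Type*} [CommRing S'] (f : S →+* S') (s : S) :
    Matrix.SpecialLinearGroup.map f (f12 s) = f12 (f s) := by
  apply Subtype.ext
  change (f12 s).1.map f = (f12 (f s)).1
  ext1 i j
  fin_cases i <;> fin_cases j <;> simp [f12]

lemma map_f21 {S' : Type*} [CommRing S'] (f : S →+* S') (s : S) :
    Matrix.SpecialLinearGroup.map f (f21 s) = f21 (f s) := by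
  apply Subtype.ext
  change (f21 s).1.map f = (f21 (f s)).1
  ext1 i j
  fin_cases i <;> fin_cases j <;> simp [f21]

lemma map_wt {S' : Type*} [CommRing S'] (f : S →+* S') (z h : S) :
    Matrix.SpecialLinearGroup.map f (wt z h) = wt (f z) (f h) := by
  simp [wt, map_f12, map_f21]

lemma map_SLJ {S' : Type*} [CommRing S'] (f : S →+* S') (r : ℕ)
    (g : Matrix.SpecialLinearGroup (Fin 2) S) :
    Matrix.SpecialLinearGroup.map f (SLJ r g) = SLJ r (Matrix.SpecialLinearGroup.map f g) := by
  apply Subtype.ext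
  exact jj_map f g.1

def test (r : ℕ) (z h : S) : Matrix.SpecialLinearGroup (Fin (2 + r)) S :=
  SLJ r (gt z h) * (SLJ r (wt z h))⁻¹

lemma test_mem {z : S} (h : S) (r : ℕ) {U : Ideal S} (hz : z ^ 7 ∈ U) :
    test r z h ∈ congSubgroup (2 + r) U := by
  refine MonoidHom.mem_ker.2 ?_
  have : (Ideal.Quotient.mk U z) ^ 7 = 0 := by
    rw [← map_pow]; exact Ideal.Quotient.eq_zero_iff_mem.2 hz
  rw [test, map_mul, map_inv, map_SLJ, map_SLJ, map_gt, map_wt, gt_wt _ this, mul_inv_cancel]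

variable {r n : ℕ}

lemma wt_mem (hN : 2 ≤ (2 + r) * n) {z : ℤ[X]} (h : ℤ[X])
    (hz : ev n z = algebraMap A (SS n) (1 + iA)) : rho (2 + r) n (SLJ r (wt z h)) ∈ K2 hN := by
  have h4 : ∀ u : ℤ[X], ∀ a b, 4 ∣ ev n (z ^ 4 * u) a b := by
    intro u a b
    rw [map_mul, map_pow, hz, ← map_pow, show (1 + iA) ^ 4 = -4 by
      linear_combination (iA ^ 2 + 4 * iA + 5) * iA_sq, ← Algebra.smul_def, Matrix.smul_apply,
      smul_eq_mul]
    exact ⟨-(ev n u a b), by ring⟩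
  have e : rho (2 + r) n (SLJ r (wt z h)) =
      J r (e21 (ev n (-(z ^ 4 * h) * ((1 - z ^ 4 * h) * (1 + (z ^ 4 * h) ^ 2))))) *
      J r (e12 (ev n 1)) * J r (e21 (ev n (z ^ 4 * h))) *
      J r (e12 (ev n (-((1 - z ^ 4 * h) * (1 + (z ^ 4 * h) ^ 2))))) := by
    rw [rho_SLJ, wt]
    simp only [map_mul (rho 2 n), map_mul (J r), rho_f21, rho_f12]
  rw [e]
  refine mul_mem (mul_mem (mul_mem (e21_mem hN ?_) (e12_mem hN _)) (e21_mem hN (h4 _)))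
    (e12_mem hN _)
  intro a b
  have := h4 (-h * ((1 - z ^ 4 * h) * (1 + (z ^ 4 * h) ^ 2))) a b
  rwa [show z ^ 4 * (-h * ((1 - z ^ 4 * h) * (1 + (z ^ 4 * h) ^ 2))) =
    (-(z ^ 4 * h) * ((1 - z ^ 4 * h) * (1 + (z ^ 4 * h) ^ 2))) by ring] at this

lemma z4 : (1 + iA) ^ 4 = -4 := by linear_combination (iA ^ 2 + 4 * iA + 5) * iA_sq

lemma psi_test (hN : 2 ≤ (2 + r) * n) {z : ℤ[X]} (h : ℤ[X])
    (hz : ev n z = algebraMap A (SS n) (1 + iA)) {U : Ideal ℤ[X]} (hU : U ≤ I8 n)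
    (hz7 : z ^ 7 ∈ U) :
    psi (rho (2 + r) n (test r z h)) = psi (J r (rho 2 n (gt z h))) := by
  have h1 := rho_cong hU (test_mem h r hz7)
  have h2 := wt_mem hN h hz
  have h3 : J r (rho 2 n (gt z h)) =
      rho (2 + r) n (test r z h) * rho (2 + r) n (SLJ r (wt z h)) := by
    rw [← map_mul, test, inv_mul_cancel_right, rho_SLJ]
  rw [h3, psi_mul hN h1 h2.1, h2.2, mul_one]

lemma rho_gt_val (n : ℕ) {z : ℤ[X]} (h : ℤ[X]) (hz : ev n z = algebraMap A (SS n) (1 + iA)) :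
    (rho 2 n (gt z h)).1 = !![1 - 4 * ev n h, ev n (-z ^ 9 * h ^ 4); algebraMap A (SS n) cI,
      ev n ((1 - z ^ 4 * h) * (1 + (z ^ 4 * h) ^ 2))] := by
  rw [rho_val]
  have h1 : ev n (1 + z ^ 4 * h) = 1 - 4 * ev n h := by
    rw [map_add, map_mul, map_pow, hz, ← map_pow, z4, map_neg, map_one,
      show algebraMap A (SS n) 4 = 4 from map_ofNat _ 4, neg_mul, sub_eq_add_neg]
  have h2 : ev n (z ^ 7) = algebraMap A (SS n) cI := by rw [map_pow, hz, ← map_pow, cI]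
  rw [← h1, ← h2]
  ext1 i j
  fin_cases i <;> fin_cases j <;> rfl

lemma psi_ne (hN : 2 ≤ (2 + r) * n) {z : ℤ[X]} (h : ℤ[X])
    (hz : ev n z = algebraMap A (SS n) (1 + iA)) (hh : ∀ a, ev n h a a = 0) :
    psi (J r (rho 2 n (gt z h))) = 1 := by
  refine (test_ne hN hh _ (rho_gt_val n h hz) ?_).2
  have h1 : ev n (1 + z ^ 4 * h) = 1 - 4 * ev n h := by
    rw [map_add, map_mul, map_pow, hz, ← map_pow, z4, map_neg, map_one,
      show algebraMap A (SS n) 4 = 4 from map_ofNat _ 4, neg_mul, sub_eq_add_neg]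
  have h2 : ev n (z ^ 7) = algebraMap A (SS n) cI := by rw [map_pow, hz, ← map_pow, cI]
  rw [← h1, ← h2, ← map_mul, ← map_mul, ← map_one (ev n), ← map_add]
  congr 1; ring

lemma psi_eq (hN : 2 ≤ (2 + r) * n) (hn : Odd n) {z : ℤ[X]} (h : ℤ[X])
    (hz : ev n z = algebraMap A (SS n) (1 + iA)) {ε : A} (hε : ε = iA ∨ ε = -iA)
    (hh : ev n h = algebraMap A (SS n) ε) :
    psi (J r (rho 2 n (gt z h))) = -1 := by
  have hy := rho_gt_val n h hz
  have := test_eq (r := r) hN (a := 1 - 4 * ε) (b := -(1 + iA) ^ 9 * ε ^ 4) (c := cI)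
    (d := (1 + 4 * ε) * (1 + (4 * ε) ^ 2)) (prim_iff_exists.2 ⟨-2 * ε, by ring⟩)
    (prim_iff_exists.2 ⟨2 * ε + 8 * ε ^ 2 + 32 * ε ^ 3, by ring⟩)
    ⟨2 - 2 * iA, by rw [cI_eq]; ring⟩ ?_ (rho 2 n (gt z h)) ?_
  · rw [this, sym_special hε, hn.neg_one_pow]
  · unfold cI
    have : (1 + iA) ^ 16 = 256 := by
      rw [show 16 = 4 * 4 from rfl, pow_mul, z4]; norm_num
    linear_combination ε ^ 4 * this
  · rw [hy, hh]
    have h4 : (4 : SS n) = algebraMap A (SS n) 4 := (map_ofNat _ 4).symm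
    have hX : ev n (z ^ 4 * h) = algebraMap A (SS n) (-(4 * ε)) := by
      rw [map_mul, map_pow, hz, hh, ← map_pow, z4, ← map_mul, neg_mul]
    have e1 : 1 - 4 * algebraMap A (SS n) ε = algebraMap A (SS n) (1 - 4 * ε) := by
      rw [map_sub, map_one, map_mul, h4]
    have e2 : ev n (-z ^ 9 * h ^ 4) = algebraMap A (SS n) (-(1 + iA) ^ 9 * ε ^ 4) := by
      simp only [map_mul, map_neg, map_pow, hz, hh]
    have e3 : ev n ((1 - z ^ 4 * h) * (1 + (z ^ 4 * h) ^ 2)) =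
        algebraMap A (SS n) ((1 + 4 * ε) * (1 + (4 * ε) ^ 2)) := by
      rw [map_mul, map_sub, map_add, map_pow, map_one, hX, ← map_one (algebraMap A (SS n)),
        ← map_pow, ← map_sub, ← map_add, ← map_mul]
      congr 1; ring
    rw [e1, e2, e3]

end SKN

set_option linter.unusedSectionVars false

namespace SKN

open Polynomial

noncomputable def psiU {d n : ℕ} (Y : (BM d n)ˣ) : ℤˣ := ⟨psi Y, psi Y, psi_sq Y, psi_sq Y⟩

noncomputable def Phi {d n : ℕ} (hN : 2 ≤ d * n) {U : Ideal ℤ[X]} (hU : U ≤ I8 n) :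
    congSubgroup d U →* ℤˣ where
  toFun g := psiU (rho d n g.1)
  map_one' := Units.ext (by
    change psi (rho d n 1) = 1
    rw [map_one, psi_one hN])
  map_mul' g h := Units.ext (by
    change psi (rho d n (g.1 * h.1)) = psi (rho d n g.1) * psi (rho d n h.1)
    rw [map_mul, psi_mul hN (rho_cong hU g.2) (rho_cong hU h.2)])

abbrev Qt (d : ℕ) (U : Ideal ℤ[X]) := ↥(congSubgroup d U) ⧸ (EL d U).subgroupOf (congSubgroup d U)

noncomputable def PhiQ {d n : ℕ} (hN : 2 ≤ d * n) {U : Ideal ℤ[X]} (hU : U ≤ I8 n) :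
    Qt d U →* ℤˣ :=
  QuotientGroup.lift _ (Phi hN hU) (fun _ hg => Units.ext (rho_EL hN hU hg).2)

/-- counting -/
lemma count {Q : Type*} [Group Q] {m : ℕ} (F : Fin (m + 1) → Q →* ℤˣ) (t : Fin (m + 1) → Q)
    (h1 : ∀ j, F j (t j) = -1) (h2 : ∀ i j, i ≠ j → F i (t j) = 1) (s : Finset Q)
    (hs : s.card ≤ m) : Subgroup.closure (s : Set Q) ≠ ⊤ := by
  intro hcl
  let χ : Finset (Fin (m + 1)) → Q →* ℤˣ := fun T => ∏ j ∈ T, F j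
  have hχ : ∀ T j, χ T (t j) = if j ∈ T then -1 else 1 := by
    intro T j
    simp only [χ, MonoidHom.finsetProd_apply]
    split_ifs with hj
    · rw [Finset.prod_eq_single_of_mem j hj, h1]
      intro i _ hi; exact h2 i j hi
    · exact Finset.prod_eq_one fun i hi => h2 i j (by rintro rfl; exact hj hi)
  let ev' : Finset (Fin (m + 1)) → (s → ℤˣ) := fun T q => χ T q.1
  have hinj : Function.Injective ev' := by
    intro T T' h
    have h3 : χ T = χ T' := by
      apply MonoidHom.eq_of_eqOn_dense hcl
      intro q hq
      exact congrFun h ⟨q, hq⟩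
    ext j
    have h4 := hχ T j
    rw [h3, hχ] at h4
    split_ifs at h4 with h5 h6 h6
    · simp [h5, h6]
    · exact absurd h4 (by decide)
    · exact absurd h4 (by decide)
    · simp [h5, h6]
  classical
  have h5 := Fintype.card_le_of_injective _ hinj
  rw [Fintype.card_finset, Fintype.card_fun, Fintype.card_fin, Fintype.card_coe,
    Fintype.card_units_int] at h5
  have := (Nat.pow_le_pow_iff_right (by norm_num : 1 < 2)).1 h5
  omega

def NN (m : ℕ) (j : Fin (m + 1)) : ℕ := 2 * m + 3 + 2 * j

lemma NN_odd (m) (j) : Odd (NN m j) := ⟨m + 1 + j, by unfold NN; ring⟩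

lemma NN_dvd {m} {i j} (h : NN m i ∣ NN m j) : i = j := by
  obtain ⟨q, hq⟩ := h
  have hi := i.2
  have hj := j.2
  unfold NN at hq
  have hq1 : q = 1 := by
    have h0 : q ≠ 0 := by rintro rfl; omega
    have h2 : q < 2 := by
      by_contra hlt
      have : (2 * m + 3 + 2 * i.1) * 2 ≤ (2 * m + 3 + 2 * i.1) * q :=
        Nat.mul_le_mul_left _ (by omega)
      omega
    omega
  subst hq1
  exact Fin.ext (by omega)

def KK (m : ℕ) : ℕ := (∏ j, NN m j) ^ 2

lemma NN_dvd_KK (m) (j) : NN m j ∣ KK m :=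
  (Finset.dvd_prod_of_mem _ (Finset.mem_univ j)).trans (dvd_pow_self _ two_ne_zero)

lemma iA_four (q : ℕ) : iA ^ (4 * q) = 1 := by
  rw [pow_mul, show iA ^ 4 = 1 by linear_combination (iA ^ 2 - 1) * iA_sq, one_pow]

lemma iA_KK (m : ℕ) : iA ^ KK m = iA := by
  have h : Odd (∏ j, NN m j) :=
    Finset.prod_induction _ Odd (fun _ _ => Odd.mul) odd_one fun j _ => NN_odd m j
  obtain ⟨q, hq⟩ := h
  have : KK m = 4 * (q ^ 2 + q) + 1 := by unfold KK; rw [hq]; ring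
  rw [this, pow_succ, iA_four, one_mul]

lemma iA_odd {l : ℕ} (h : Odd l) : iA ^ l = iA ∨ iA ^ l = -iA := by
  obtain ⟨q, rfl⟩ := h
  rw [pow_succ, pow_mul, iA_sq]
  rcases neg_one_pow_eq_or A q with h | h <;> rw [h] <;> simp

theorem main (r m : ℕ) :
    ∃ U : Ideal (Polynomial ℤ), Finite (Polynomial ℤ ⧸ U) ∧
      ¬ ∃ s : Finset (Qt (2 + r) U), s.card ≤ m ∧
            Subgroup.closure (s : Set (Qt (2 + r) U)) = ⊤ := by
  let U : Ideal ℤ[X] := ⨅ j, I8 (NN m j)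
  have hU : ∀ j, U ≤ I8 (NN m j) := fun j => iInf_le _ j
  refine ⟨U, finite_quot (NN m), ?_⟩
  rintro ⟨s, hs, hcl⟩
  have hN : ∀ j, 2 ≤ (2 + r) * NN m j := by
    intro j; unfold NN; nlinarith
  let z : ℤ[X] := 1 + X ^ KK m
  have hz : ∀ j, ev (NN m j) z = algebraMap A (SS (NN m j)) (1 + iA) := by
    intro j
    rw [map_add, map_pow, map_one, ev_X, Cn_pow_dvd (NN_dvd_KK m j), iA_KK, map_add, map_one]
  have hz7 : z ^ 7 ∈ U := by
    rw [Ideal.mem_iInf]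
    intro j
    refine mem_I8.2 ⟨algebraMap A (SS (NN m j)) (1 - iA), ?_⟩
    rw [map_pow, hz, ← map_pow, Algebra.smul_def, ← map_mul]
    congr 1
  let t : Fin (m + 1) → Qt (2 + r) U := fun j =>
    QuotientGroup.mk (⟨test r z (X ^ NN m j), test_mem _ r hz7⟩ : congSubgroup (2 + r) U)
  refine count (fun i => PhiQ (hN i) (hU i)) t ?_ ?_ s hs hcl
  · intro j
    refine Units.ext ?_
    change psi (rho (2 + r) (NN m j) (test r z (X ^ NN m j))) = -1
    rw [psi_test (hN j) _ (hz j) (hU j) hz7]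
    exact psi_eq (hN j) (NN_odd m j) _ (hz j) (iA_odd (NN_odd m j))
      (by rw [map_pow, ev_X, Cn_pow_dvd dvd_rfl])
  · intro i j hij
    refine Units.ext ?_
    change psi (rho (2 + r) (NN m i) (test r z (X ^ NN m j))) = 1
    rw [psi_test (hN i) _ (hz i) (hU i) hz7]
    refine psi_ne (hN i) _ (hz i) fun a => ?_
    rw [map_pow, ev_X]
    exact Cn_pow_diag (fun h => hij (NN_dvd h)) a

end SKN

theorem SK1_not_boundedly_generated (d : ℕ) (hd : 4 ≤ d) (m : ℕ) :
    ∃ U : Ideal (Polynomial ℤ), Finite (Polynomial ℤ ⧸ U) ∧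
      ¬ ∃ s : Finset (↥(congSubgroup d U) ⧸ (EL d U).subgroupOf (congSubgroup d U)),
          s.card ≤ m ∧
            Subgroup.closure
              (s : Set (↥(congSubgroup d U) ⧸ (EL d U).subgroupOf (congSubgroup d U))) = ⊤ := by
  obtain ⟨r, rfl⟩ : ∃ r, d = 2 + r := ⟨d - 2, by omega⟩
  exact SKN.main r m
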